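/- If a planar graph G has treewidth at least 3, then there exists a plane embedding of G and a triangulation Ĝ of that embedding (a plane supergraph of G on the same vertex set in which every bounded face is a triangle) such that the embedded-width of Ĝ equals the treewidth of G. -/

import Mathlib

open Set Bornology

/-- A plane embedding of a simple graph: each vertex is mapped to a point of the
plane, each edge to an injective arc joining its endpoints; arcs avoid vertices
other than their endpoints and distinct arcs meet only at common endpoints. -/
structure PlaneEmbedding {V : Type} (G : SimpleGraph V) where
  pos : V → ℝ × ℝ
  pos_inj : Function.Injective pos
  arc : G.edgeSet → Set (ℝ × ℝ)
  arc_path : ∀ e : G.edgeSet, ∃ u v : V, (e : Sym2 V) = s(u, v) ∧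
    ∃ γ : Path (pos u) (pos v), Function.Injective ⇑γ ∧ Set.range ⇑γ = arc e
  arc_avoid : ∀ (e : G.edgeSet) (w : V), pos w ∈ arc e → w ∈ (e : Sym2 V)
  arc_inter : ∀ e f : G.edgeSet, e ≠ f → ∀ x ∈ arc e ∩ arc f,
    ∃ w : V, w ∈ (e : Sym2 V) ∧ w ∈ (f : Sym2 V) ∧ x = pos w

namespace PlaneEmbedding

variable {V : Type} {G : SimpleGraph V}

/-- The image (drawing) of the plane graph in the plane. -/
def image (P : PlaneEmbedding G) : Set (ℝ × ℝ) :=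
  Set.range P.pos ∪ ⋃ e : G.edgeSet, P.arc e

/-- A face: a connected component of the complement of the image. -/
def IsFace (P : PlaneEmbedding G) (f : Set (ℝ × ℝ)) : Prop :=
  ∃ x, x ∉ P.image ∧ f = connectedComponentIn (P.image)ᶜ x

def IsBoundedFace (P : PlaneEmbedding G) (f : Set (ℝ × ℝ)) : Prop :=
  P.IsFace f ∧ IsBounded f

def IsOuterFace (P : PlaneEmbedding G) (f : Set (ℝ × ℝ)) : Prop :=
  P.IsFace f ∧ ¬ IsBounded f

/-- The vertices on the boundary of a face `f`. -/
def boundaryVerts (P : PlaneEmbedding G) (f : Set (ℝ × ℝ)) : Set V :=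
  {v | P.pos v ∈ closure f}

/-- The weak dual: vertices are the bounded faces, two distinct faces being
adjacent when some edge lies on the boundary of both. -/
def weakDual (P : PlaneEmbedding G) :
    SimpleGraph {f : Set (ℝ × ℝ) // P.IsBoundedFace f} :=
  SimpleGraph.fromRel fun f g =>
    ∃ e : G.edgeSet, P.arc e ⊆ closure f.1 ∧ P.arc e ⊆ closure g.1

/-- `u⁺`: the bounded faces having `u` on their boundary. -/
def uPlus (P : PlaneEmbedding G) (u : V) :
    Set {f : Set (ℝ × ℝ) // P.IsBoundedFace f} :=
  {f | u ∈ P.boundaryVerts f.1}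

/-- The drawing of the subgraph induced by a set `S` of vertices. -/
def subImage (P : PlaneEmbedding G) (S : Set V) : Set (ℝ × ℝ) :=
  P.pos '' S ∪ ⋃ e ∈ {e : G.edgeSet | ∀ w, w ∈ (e : Sym2 V) → w ∈ S}, P.arc e

/-- The vertices of `S` lying on the boundary of the unbounded face of the
drawing of the subgraph induced by `S`. -/
def outerVerts (P : PlaneEmbedding G) (S : Set V) : Set V :=
  {v | v ∈ S ∧ ∃ x, x ∉ P.subImage S ∧
    ¬ IsBounded (connectedComponentIn (P.subImage S)ᶜ x) ∧
    P.pos v ∈ closure (connectedComponentIn (P.subImage S)ᶜ x)}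

/-- Remove the outer layer of vertices. -/
def peel (P : PlaneEmbedding G) (S : Set V) : Set V := S \ P.outerVerts S

/-- The embedding is (at most) `k`-outerplanar: `k` rounds of removing the
vertices on the outer boundary remove every vertex. -/
def OuterplanarAtMost (P : PlaneEmbedding G) (k : ℕ) : Prop :=
  (P.peel)^[k] Set.univ = ∅

/-- The drawing of the subgraph of all edges incident to vertices of `R`. -/
def familyImage (P : PlaneEmbedding G) (R : Set V) : Set (ℝ × ℝ) :=
  ⋃ e ∈ {e : G.edgeSet | ∃ v ∈ R, v ∈ (e : Sym2 V)}, P.arc e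

/-- `R` is nicely embedded: no bounded face of the subgraph of edges incident
to `R` strictly encloses a vertex of `G`. -/
def NicelyEmbedded (P : PlaneEmbedding G) (R : Set V) : Prop :=
  ∀ x, x ∉ P.familyImage R →
    IsBounded (connectedComponentIn (P.familyImage R)ᶜ x) →
    ∀ v : V, P.pos v ∉ connectedComponentIn (P.familyImage R)ᶜ x

/-- The facial completion: add a clique on the boundary of each bounded face. -/
def facialCompletion (P : PlaneEmbedding G) : SimpleGraph V :=
  G ⊔ SimpleGraph.fromRel fun u v =>
    ∃ f, P.IsBoundedFace f ∧ u ∈ P.boundaryVerts f ∧ v ∈ P.boundaryVerts f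

end PlaneEmbedding

/-- A tree together with a bag of vertices at each node. -/
structure Decomp (V : Type) : Type 1 where
  ι : Type
  tree : SimpleGraph ι
  isTree : tree.IsTree
  bag : ι → Set V

/-- `D` is a tree decomposition of `G`. -/
def IsTreeDecomp {V : Type} (G : SimpleGraph V) (D : Decomp V) : Prop :=
  (∀ v, ∃ i, v ∈ D.bag i) ∧
  (∀ u v, G.Adj u v → ∃ i, u ∈ D.bag i ∧ v ∈ D.bag i) ∧
  (∀ v, (D.tree.induce {i | v ∈ D.bag i}).Connected)

/-- The treewidth of a graph. -/
noncomputable def treewidth {V : Type} (G : SimpleGraph V) : ℕ :=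
  sInf {k | ∃ D : Decomp V, IsTreeDecomp G D ∧ ∀ i, (D.bag i).ncard ≤ k + 1}

/-- `D` is an embedded tree decomposition of the plane graph given by `P`. -/
def IsEmDecomp {V : Type} {G : SimpleGraph V} (P : PlaneEmbedding G)
    (D : Decomp V) : Prop :=
  IsTreeDecomp G D ∧ ∀ f, P.IsBoundedFace f → ∃ i, P.boundaryVerts f ⊆ D.bag i

/-- The em-width of a plane graph. -/
noncomputable def emwidth {V : Type} {G : SimpleGraph V}
    (P : PlaneEmbedding G) : ℕ :=
  sInf {k | ∃ D : Decomp V, IsEmDecomp P D ∧ ∀ i, (D.bag i).ncard ≤ k + 1}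

/-- A cut vertex: its removal disconnects two vertices that were connected. -/
def SimpleGraph.IsCutVertex {V : Type} (G : SimpleGraph V) (u : V) : Prop :=
  ∃ x y, ∃ (hx : x ≠ u) (hy : y ≠ u), G.Reachable x y ∧
    ¬ (G.induce {v | v ≠ u}).Reachable ⟨x, hx⟩ ⟨y, hy⟩

/-- An `r`-family: `r` vertices of degree 2 sharing the same two neighbors. -/
def IsRFamily {V : Type} (G : SimpleGraph V) (R : Set V) (r : ℕ) : Prop :=
  R.ncard = r ∧ ∃ a b : V, a ≠ b ∧ ∀ v ∈ R, G.neighborSet v = {a, b}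


namespace MacLane

set_option linter.unusedSectionVars false

variable {V : Type} [Fintype V] [DecidableEq V]

/-- The coboundary of a vertex labelling over `ZMod 2`. -/
def cob (X : V → ZMod 2) : Sym2 V → ZMod 2 :=
  Sym2.lift ⟨fun u v => X u + X v, fun _ _ => add_comm _ _⟩

@[simp] theorem cob_mk (X : V → ZMod 2) (u v : V) : cob X s(u, v) = X u + X v := rfl

theorem zmod_two_eq_one {x : ZMod 2} (h : x ≠ 0) : x = 1 := by
  revert x; decide

theorem zmod_two_add_self (x : ZMod 2) : x + x = 0 := CharTwo.add_self_eq_zero x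

theorem zmod_two_eq_of_add {x y : ZMod 2} (h : x + y = 0) : x = y := by
  revert x y; decide

theorem dot_congr {f g g' : Sym2 V → ZMod 2} (h : ∀ e, f e ≠ 0 → g e = g' e) :
    f ⬝ᵥ g = f ⬝ᵥ g' := by
  refine Finset.sum_congr rfl fun e _ => ?_
  by_cases he : f e = 0
  · simp [he]
  · rw [h e he]

/-- The indicator of an edge. -/
abbrev ind (e : Sym2 V) : Sym2 V → ZMod 2 := Pi.single e 1

/-- A family of even edge sets of `G`, covering each edge at most twice, whose
orthogonal complement consists of coboundaries. -/
structure TwoFam (G : SimpleGraph V) {ι : Type} (f : ι → Sym2 V → ZMod 2) : Prop where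
  supp : ∀ i e, f i e ≠ 0 → e ∈ G.edgeSet
  cap : ∀ e i j k, i ≠ j → i ≠ k → j ≠ k → f i e ≠ 0 → f j e ≠ 0 → f k e ≠ 0 → False
  even : ∀ i X, f i ⬝ᵥ cob X = 0
  exact : ∀ g : Sym2 V → ZMod 2, (∀ i, f i ⬝ᵥ g = 0) → ∃ X, ∀ e ∈ G.edgeSet, g e = cob X e

/-- Graphs carrying a `TwoFam`: MacLane's planarity criterion. -/
def IsMacLane (G : SimpleGraph V) : Prop :=
  ∃ (ι : Type) (_ : Fintype ι) (f : ι → Sym2 V → ZMod 2), TwoFam G f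

variable {G : SimpleGraph V} {ι : Type} {f : ι → Sym2 V → ZMod 2}

theorem TwoFam.delete (h : TwoFam G f) (e0 : Sym2 V) :
    ∃ f' : ι → Sym2 V → ZMod 2, TwoFam (G.deleteEdges {e0}) f' ∧
      ∀ i, f i e0 = 0 → f' i = f i := by
  by_cases hex : ∃ i, f i e0 ≠ 0
  swap
  · push Not at hex
    refine ⟨f, ⟨fun i e he => ?_, h.cap, h.even, fun g hg => ?_⟩, fun _ _ => rfl⟩
    · rw [SimpleGraph.edgeSet_deleteEdges]
      refine ⟨h.supp i e he, ?_⟩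
      rintro rfl
      exact he (hex i)
    · obtain ⟨X, hX⟩ := h.exact g hg
      refine ⟨X, fun e he => hX e ?_⟩
      rw [SimpleGraph.edgeSet_deleteEdges] at he
      exact he.1
  obtain ⟨i1, hi1⟩ := hex
  have hi1' : f i1 e0 = 1 := zmod_two_eq_one hi1
  refine ⟨fun i => f i + f i e0 • f i1, ⟨fun i e he => ?_, ?_, ?_, ?_⟩, ?_⟩
  · rw [SimpleGraph.edgeSet_deleteEdges]
    refine ⟨?_, ?_⟩
    · by_contra hne
      have h1 : f i e = 0 := by
        by_contra h1
        exact hne (h.supp i e h1)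
      have h2 : f i1 e = 0 := by
        by_contra h2
        exact hne (h.supp i1 e h2)
      simp [h1, h2] at he
    · rintro rfl
      simp [hi1', zmod_two_add_self] at he
  · intro e i j k hij hik hjk hi hj hk
    have key : ∀ a, f a e + f a e0 * f i1 e ≠ 0 → a ≠ i1 ∧
        (f a e ≠ 0 ∨ (f a e0 ≠ 0 ∧ f i1 e ≠ 0)) := by
      intro a ha
      constructor
      · rintro rfl
        simp [hi1', zmod_two_add_self] at ha
      · by_contra hcon
        push Not at hcon
        by_cases h0 : f a e0 = 0
        · simp [h0, hcon.1] at ha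
        · simp [hcon.1, hcon.2 h0] at ha
    have hc := h.cap
    obtain ⟨a1, a2⟩ := key i (by simpa using hi)
    obtain ⟨b1, b2⟩ := key j (by simpa using hj)
    obtain ⟨c1, c2⟩ := key k (by simpa using hk)
    rcases a2 with a2 | ⟨a2, a3⟩ <;> rcases b2 with b2 | ⟨b2, b3⟩ <;>
      rcases c2 with c2 | ⟨c2, c3⟩
    · exact hc e i j k hij hik hjk a2 b2 c2
    · exact hc e i j i1 hij a1 b1 a2 b2 c3
    · exact hc e i k i1 hik a1 c1 a2 c2 b3
    · exact hc e0 j k i1 hjk b1 c1 b2 c2 hi1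
    · exact hc e j k i1 hjk b1 c1 b2 c2 a3
    · exact hc e0 i k i1 hik a1 c1 a2 c2 hi1
    · exact hc e0 i j i1 hij a1 b1 a2 b2 hi1
    · exact hc e0 i j i1 hij a1 b1 a2 b2 hi1
  · intro i X
    simp [add_dotProduct, h.even]
  · intro g hg
    obtain ⟨X, hX⟩ := h.exact (g + (f i1 ⬝ᵥ g) • ind e0) fun i => by
      have := hg i
      simp only [add_dotProduct, smul_dotProduct, smul_eq_mul] at this
      have h2 := zmod_two_eq_of_add this
      simp only [dotProduct_add, dotProduct_smul, dotProduct_single_one, smul_eq_mul, h2]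
      rw [mul_comm]
      exact zmod_two_add_self _
    refine ⟨X, fun e he => ?_⟩
    rw [SimpleGraph.edgeSet_deleteEdges] at he
    have hne : e ≠ e0 := fun hh => he.2 hh
    rw [← hX e he.1]
    simp [hne]
  · intro i hi
    simp [hi]

theorem TwoFam.mono (h : TwoFam G f) {G' : SimpleGraph V} (hle : G' ≤ G) :
    ∃ f' : ι → Sym2 V → ZMod 2, TwoFam G' f' ∧
      ∀ i, (∀ e, f i e ≠ 0 → e ∈ G'.edgeSet) → f' i = f i := by
  classical
  induction hn : (G.edgeFinset \ G'.edgeFinset).card using Nat.strong_induction_on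
    generalizing G f with
  | _ n ih =>
    by_cases heq : G = G'
    · subst heq
      exact ⟨f, h, fun _ _ => rfl⟩
    have : ∃ e0, e0 ∈ G.edgeSet ∧ e0 ∉ G'.edgeSet := by
      by_contra hcon
      push Not at hcon
      exact heq (le_antisymm (SimpleGraph.edgeSet_subset_edgeSet.1 hcon) hle)
    obtain ⟨e0, he0, he0'⟩ := this
    obtain ⟨f1, hf1, hf1'⟩ := h.delete e0
    have hle' : G' ≤ G.deleteEdges {e0} := by
      rw [← SimpleGraph.edgeSet_subset_edgeSet, SimpleGraph.edgeSet_deleteEdges]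
      exact fun e he => ⟨SimpleGraph.edgeSet_subset_edgeSet.2 hle he, fun hh => he0' (hh ▸ he)⟩
    obtain ⟨f2, hf2, hf2'⟩ := ih _ (by
      rw [← hn]
      apply Finset.card_lt_card
      rw [Finset.ssubset_iff_of_subset]
      · refine ⟨e0, by simp [he0, he0'], ?_⟩
        simp
      · intro e
        simp only [Finset.mem_sdiff, SimpleGraph.mem_edgeFinset,
          SimpleGraph.edgeSet_deleteEdges]
        exact fun hh => ⟨hh.1.1, hh.2⟩) hf1 hle' rfl
    refine ⟨f2, hf2, fun i hi => ?_⟩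
    have h1 : f1 i = f i := hf1' i (by
      by_contra hne
      exact he0' (hi _ hne))
    rw [hf2' i (by rw [h1]; exact hi), h1]

/-- Splitting a member along a subset of its edges, possibly together with new edges. -/
theorem TwoFam.split_aux [DecidableEq ι] (h : TwoFam G f) {G' : SimpleGraph V} (hle : G ≤ G') (i0 : ι)
    {Q D : Sym2 V → ZMod 2} (hQ : ∀ e, Q e ≠ 0 → f i0 e ≠ 0)
    (hD : ∀ e, D e ≠ 0 → e ∉ G.edgeSet ∧ e ∈ G'.edgeSet)
    (hev : ∀ X, (Q + D) ⬝ᵥ cob X = 0)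
    (hex : ∀ g X, (Q + D) ⬝ᵥ g = 0 → (∀ e ∈ G.edgeSet, g e = cob X e) →
      ∀ e ∈ G'.edgeSet, g e = cob X e) :
    TwoFam G' (fun o : Option ι => o.elim (Q + D)
      (fun i => if i = i0 then f i0 + (Q + D) else f i)) := by
  have hle' := SimpleGraph.edgeSet_subset_edgeSet.2 hle
  have hsuppD : ∀ e, (Q + D) e ≠ 0 → e ∈ G'.edgeSet := by
    intro e he
    by_cases hd : D e = 0
    · have : Q e ≠ 0 := by
        intro hq
        simp [hq, hd] at he
      exact hle' (h.supp i0 e (hQ e this))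
    · exact (hD e hd).2
  have hsupp0 : ∀ e, (f i0 + (Q + D)) e ≠ 0 → e ∈ G'.edgeSet := by
    intro e he
    by_cases hd : (Q + D) e = 0
    · refine hle' (h.supp i0 e ?_)
      intro hq
      apply he
      rw [Pi.add_apply, hq, hd, add_zero]
    · exact hsuppD e hd
  refine ⟨?_, ?_, ?_, ?_⟩
  · rintro (_ | i) e he
    · exact hsuppD e he
    · by_cases hi : i = i0
      · simp only [Option.elim, hi, if_true] at he
        exact hsupp0 e he
      · simp only [Option.elim, hi, if_false] at he
        exact hle' (h.supp i e he)
  · intro e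
    set F : Option ι → ZMod 2 := fun o => (o.elim (Q + D)
      (fun i => if i = i0 then f i0 + (Q + D) else f i)) e with hF
    suffices H : ∀ i j k, i ≠ j → i ≠ k → j ≠ k → F i ≠ 0 → F j ≠ 0 → F k ≠ 0 → False from
      H
    by_cases hd : D e = 0
    · set π : Option ι → ι := fun o => o.elim i0 id with hπ
      have h1 : ∀ o, F o ≠ 0 → f (π o) e ≠ 0 := by
        rintro (_ | i) ho
        · simp only [hF, Option.elim, Pi.add_apply, hd, add_zero] at ho
          exact hQ e ho
        · by_cases hi : i = i0
          · subst hi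
            intro h0
            have h0' : f i e = 0 := h0
            simp only [hF, Option.elim, if_true, Pi.add_apply, hd, add_zero, h0', zero_add] at ho
            exact hQ e ho h0'
          · simpa [hF, hi, hπ] using ho
      have h2 : ∀ o o', F o ≠ 0 → F o' ≠ 0 → π o = π o' → o = o' := by
        have hnot : F none ≠ 0 → F (some i0) ≠ 0 → False := by
          intro ha hb
          simp only [hF, Option.elim, if_true, Pi.add_apply, hd, add_zero] at ha hb
          rw [zmod_two_eq_one ha, zmod_two_eq_one (hQ e ha)] at hb
          exact hb (by decide)
        rintro (_ | i) (_ | j) ho ho' heq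
        · rfl
        · simp only [hπ, Option.elim, id] at heq
          subst heq
          exact (hnot ho ho').elim
        · simp only [hπ, Option.elim, id] at heq
          subst heq
          exact (hnot ho' ho).elim
        · simpa [hπ] using heq
      intro i j k hij hik hjk hi hj hk
      exact h.cap e (π i) (π j) (π k) (fun hh => hij (h2 _ _ hi hj hh))
        (fun hh => hik (h2 _ _ hi hk hh)) (fun hh => hjk (h2 _ _ hj hk hh))
        (h1 _ hi) (h1 _ hj) (h1 _ hk)
    · have hne := (hD e hd).1
      have h1 : ∀ o, F o ≠ 0 → o = none ∨ o = some i0 := by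
        rintro (_ | i) ho
        · exact Or.inl rfl
        · right
          by_contra hi
          have hi' : i ≠ i0 := fun hh => hi (congrArg some hh)
          simp only [hF, Option.elim, hi', if_false] at ho
          exact hne (h.supp i e ho)
      intro i j k hij hik hjk hi hj hk
      rcases h1 i hi with rfl | rfl <;> rcases h1 j hj with rfl | rfl <;>
        rcases h1 k hk with rfl | rfl <;>
        first | exact hij rfl | exact hik rfl | exact hjk rfl
  · rintro (_ | i) X
    · exact hev X
    · by_cases hi : i = i0
      · simp only [Option.elim, hi, if_true]
        rw [add_dotProduct, hev, h.even, add_zero]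
      · simp only [Option.elim, hi, if_false]
        exact h.even i X
  · intro g hg
    have hn : (Q + D) ⬝ᵥ g = 0 := hg none
    obtain ⟨X, hX⟩ := h.exact g fun i => by
      have := hg (some i)
      by_cases hi : i = i0
      · simp only [Option.elim, hi, if_true] at this
        rw [add_dotProduct, hn, add_zero] at this
        rw [hi, this]
      · simpa only [Option.elim, hi, if_false] using this
    exact ⟨X, hex g X hn hX⟩

theorem TwoFam.split [DecidableEq ι] (h : TwoFam G f) (i0 : ι)
    {Q : Sym2 V → ZMod 2} (hQ : ∀ e, Q e ≠ 0 → f i0 e ≠ 0)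
    (hev : ∀ X, Q ⬝ᵥ cob X = 0) :
    TwoFam G (fun o : Option ι => o.elim Q
      (fun i => if i = i0 then f i0 + Q else f i)) := by
  have := h.split_aux le_rfl i0 (D := 0) hQ (by simp) (by simpa using hev)
    (fun g X _ h => h)
  simpa using this

theorem mem_edgeSet_sup_edge {c d : V} (hcd : c ≠ d) {e : Sym2 V} :
    e ∈ (G ⊔ SimpleGraph.edge c d).edgeSet ↔ e ∈ G.edgeSet ∨ e = s(c, d) := by
  rw [SimpleGraph.edgeSet_sup, SimpleGraph.edgeSet_edge_of_ne hcd]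
  rfl

theorem ind_dot (e : Sym2 V) (g : Sym2 V → ZMod 2) : ind e ⬝ᵥ g = g e := by
  simp

theorem TwoFam.chord (h : TwoFam G f) [Fintype ι] (i0 : ι)
    {Q : Sym2 V → ZMod 2} (hQ : ∀ e, Q e ≠ 0 → f i0 e ≠ 0) {c d : V} (hcd : c ≠ d)
    (hadj : ¬ G.Adj c d) (hev : ∀ X, Q ⬝ᵥ cob X = X c + X d) :
    IsMacLane (G ⊔ SimpleGraph.edge c d) := by
  classical
  refine ⟨Option ι, inferInstance, _, h.split_aux le_sup_left i0 (D := ind s(c, d)) hQ ?_ ?_ ?_⟩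
  · intro e he
    have : e = s(c, d) := by
      by_contra hne
      simp [hne] at he
    subst this
    exact ⟨hadj, (mem_edgeSet_sup_edge hcd).2 (Or.inr rfl)⟩
  · intro X
    rw [add_dotProduct, hev, ind_dot, cob_mk, zmod_two_add_self]
  · intro g X hg hX e he
    rcases (mem_edgeSet_sup_edge hcd).1 he with he | rfl
    · exact hX e he
    · rw [add_dotProduct, ind_dot] at hg
      rw [← zmod_two_eq_of_add hg, cob_mk, ← hev]
      exact dot_congr fun e he => hX e (h.supp i0 e (hQ e he))

theorem TwoFam.sum_eq_zero (h : TwoFam G f) [Fintype ι] {e : Sym2 V} {j k : ι} (hjk : j ≠ k)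
    (hj : f j e ≠ 0) (hk : f k e ≠ 0) : (∑ i, f i) e = 0 := by
  classical
  rw [Finset.sum_apply, ← Finset.sum_subset (Finset.subset_univ {j, k}), Finset.sum_pair hjk,
    zmod_two_eq_one hj, zmod_two_eq_one hk]
  · rfl
  · intro i _ hi
    by_contra hne
    simp only [Finset.mem_insert, Finset.mem_singleton, not_or] at hi
    exact h.cap e i j k hi.1 hi.2 hjk hne hj hk

end MacLane

namespace MacLane
set_option linter.unusedSectionVars false
variable {V : Type} [Fintype V] [DecidableEq V]
variable {G : SimpleGraph V} {ι : Type} {f : ι → Sym2 V → ZMod 2}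

theorem TwoFam.sum_even (h : TwoFam G f) [Fintype ι] (X : V → ZMod 2) :
    (∑ i, f i) ⬝ᵥ cob X = 0 := by
  rw [sum_dotProduct]
  exact Finset.sum_eq_zero fun i _ => h.even i X

theorem TwoFam.sum_supp (h : TwoFam G f) [Fintype ι] {e : Sym2 V} (he : (∑ i, f i) e ≠ 0) :
    e ∈ G.edgeSet := by
  rw [Finset.sum_apply] at he
  obtain ⟨i, _, hi⟩ := Finset.exists_ne_zero_of_sum_ne_zero he
  exact h.supp i e hi

/-- The sum of the family can be adjoined as a further member. -/
theorem TwoFam.addSum (h : TwoFam G f) [Fintype ι] :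
    TwoFam G (fun o : Option ι => o.elim (∑ i, f i) f) := by
  have key : ∀ e j k, j ≠ k → f j e ≠ 0 → f k e ≠ 0 → (∑ i, f i) e ≠ 0 → False :=
    fun e j k hjk hj hk hs => hs (h.sum_eq_zero hjk hj hk)
  refine ⟨?_, ?_, ?_, ?_⟩
  · rintro (_ | i) e he
    · exact h.sum_supp he
    · exact h.supp i e he
  · rintro e (_ | i) (_ | j) (_ | k) hij hik hjk hi hj hk
    · exact hij rfl
    · exact hij rfl
    · exact hik rfl
    · exact key e j k (fun hh => hjk (congrArg some hh)) hj hk hi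
    · exact hjk rfl
    · exact key e i k (fun hh => hik (congrArg some hh)) hi hk hj
    · exact key e i j (fun hh => hij (congrArg some hh)) hi hj hk
    · exact h.cap e i j k (fun hh => hij (congrArg some hh)) (fun hh => hik (congrArg some hh))
        (fun hh => hjk (congrArg some hh)) hi hj hk
  · rintro (_ | i) X
    · exact h.sum_even X
    · exact h.even i X
  · intro g hg
    exact h.exact g fun i => hg (some i)

/-- A family can be modified so that a given member becomes the outer one. -/
theorem TwoFam.puncture (h : TwoFam G f) [Fintype ι] (i0 : ι) :
    ∃ f' : ι → Sym2 V → ZMod 2, TwoFam G f' ∧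
      ∀ e, f i0 e ≠ 0 → ∀ i j, f' i e ≠ 0 → f' j e ≠ 0 → i = j := by
  classical
  set f' : ι → Sym2 V → ZMod 2 := fun i => if i = i0 then ∑ i, f i else f i with hf'
  have h0 : f' i0 = ∑ i, f i := by simp [hf']
  have h1 : ∀ i, i ≠ i0 → f' i = f i := fun i hi => by simp [hf', hi]
  have key : ∀ e j k, j ≠ k → f j e ≠ 0 → f k e ≠ 0 → f' i0 e ≠ 0 → False :=
    fun e j k hjk hj hk hs => hs (h0 ▸ h.sum_eq_zero hjk hj hk)
  refine ⟨f', ⟨?_, ?_, ?_, ?_⟩, ?_⟩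
  · intro i e he
    by_cases hi : i = i0
    · rw [hi, h0] at he
      exact h.sum_supp he
    · rw [h1 i hi] at he
      exact h.supp i e he
  · intro e i j k hij hik hjk hi hj hk
    by_cases hi0 : i = i0
    · subst hi0
      rw [h1 j hij.symm] at hj
      rw [h1 k hik.symm] at hk
      exact key e j k hjk hj hk hi
    by_cases hj0 : j = i0
    · subst hj0
      rw [h1 i hij] at hi
      rw [h1 k hjk.symm] at hk
      exact key e i k hik hi hk hj
    by_cases hk0 : k = i0
    · subst hk0
      rw [h1 i hik] at hi
      rw [h1 j hjk] at hj
      exact key e i j hij hi hj hk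
    rw [h1 i hi0] at hi
    rw [h1 j hj0] at hj
    rw [h1 k hk0] at hk
    exact h.cap e i j k hij hik hjk hi hj hk
  · intro i X
    by_cases hi : i = i0
    · rw [hi, h0]
      exact h.sum_even X
    · rw [h1 i hi]
      exact h.even i X
  · intro g hg
    refine h.exact g fun i => ?_
    by_cases hi : i = i0
    · subst hi
      have := hg i
      rw [h0, ← Finset.add_sum_erase _ _ (Finset.mem_univ i), add_dotProduct, sum_dotProduct] at this
      rw [Finset.sum_eq_zero, add_zero] at this
      · exact this
      · intro j hj
        have := hg j
        rwa [h1 j (Finset.ne_of_mem_erase hj)] at this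
    · have := hg i
      rwa [h1 i hi] at this
  · intro e he
    have main : ∀ i, i ≠ i0 → f' i e ≠ 0 → f' i0 e ≠ 0 → False := by
      intro i hi hie h0e
      rw [h1 i hi] at hie
      exact key e i i0 hi hie he h0e
    intro i j hi hj
    by_contra hij
    by_cases hi0 : i = i0
    · subst hi0
      exact main j (Ne.symm hij) hj hi
    by_cases hj0 : j = i0
    · subst hj0
      exact main i hij hi hj
    rw [h1 i hi0] at hi
    rw [h1 j hj0] at hj
    exact h.cap e i j i0 hij hi0 hj0 hi hj he

theorem cob_add_const (X : V → ZMod 2) (c : ZMod 2) : cob (fun v => X v + c) = cob X := by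
  funext e
  induction e with
  | _ u v =>
    simp only [cob_mk]
    rw [add_add_add_comm, zmod_two_add_self, add_zero]

/-- Joining two components by a bridge. -/
theorem TwoFam.bridge (h : TwoFam G f) {x y : V} (hxy : ¬ G.Reachable x y) :
    TwoFam (G ⊔ SimpleGraph.edge x y) f := by
  classical
  have hne : x ≠ y := by
    rintro rfl
    exact hxy (SimpleGraph.Reachable.refl _)
  refine ⟨fun i e he => (mem_edgeSet_sup_edge hne).2 (Or.inl (h.supp i e he)), h.cap, h.even, ?_⟩
  intro g hg
  obtain ⟨X, hX⟩ := h.exact g hg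
  set c := X x + X y + g s(x, y) with hc
  refine ⟨fun v => X v + if G.Reachable y v then c else 0, fun e he => ?_⟩
  rcases (mem_edgeSet_sup_edge hne).1 he with he | rfl
  · rw [hX e he]
    induction e with
    | _ u v =>
      have huv : G.Reachable y u ↔ G.Reachable y v :=
        ⟨fun hh => hh.trans (SimpleGraph.Adj.reachable he),
          fun hh => hh.trans (SimpleGraph.Adj.reachable he).symm⟩
      simp only [cob_mk, huv]
      rw [add_add_add_comm, zmod_two_add_self, add_zero]
  · have hyx : ¬ G.Reachable y x := fun hh => hxy hh.symm
    simp only [cob_mk, hyx, if_false, SimpleGraph.Reachable.refl, if_true, hc]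
    generalize X x = a
    generalize X y = b
    generalize g s(x, y) = d
    revert a b d
    decide

/-- Gluing two graphs along a vertex or an edge and adding an edge across. -/
theorem TwoFam.glue {HA HB : SimpleGraph V} {ιA ιB : Type} [Fintype ιA] [Fintype ιB]
    {fA : ιA → Sym2 V → ZMod 2} {fB : ιB → Sym2 V → ZMod 2}
    (hA : TwoFam HA fA) (hB : TwoFam HB fB) {A B : Set V} {u v x y : V}
    (hAB : ∀ w, w ∈ A → w ∈ B → w = u ∨ w = v)
    (hHA : ∀ a b, HA.Adj a b → a ∈ A ∧ b ∈ A) (hHB : ∀ a b, HB.Adj a b → a ∈ B ∧ b ∈ B)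
    (huv : u ≠ v → HA.Adj u v ∧ HB.Adj u v)
    (hcA : ∀ i j, fA i s(u, v) ≠ 0 → fA j s(u, v) ≠ 0 → i = j)
    (hcB : ∀ i j, fB i s(u, v) ≠ 0 → fB j s(u, v) ≠ 0 → i = j)
    (hxB : x ∉ B) (hy : y ∈ B) (hyA : y ∉ A)
    {QA QB : Sym2 V → ZMod 2}
    (hQA : ∀ e, QA e ≠ 0 → e ∈ HA.edgeSet ∧ e ≠ s(u, v) ∧
      ∀ i j, fA i e ≠ 0 → fA j e ≠ 0 → i = j)
    (hQB : ∀ e, QB e ≠ 0 → e ∈ HB.edgeSet ∧ e ≠ s(u, v) ∧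
      ∀ i j, fB i e ≠ 0 → fB j e ≠ 0 → i = j)
    (hQA' : ∀ X, QA ⬝ᵥ cob X = X x + X u) (hQB' : ∀ X, QB ⬝ᵥ cob X = X u + X y)
    (huA : u ∈ A) (huB : u ∈ B) :
    IsMacLane (HA ⊔ HB ⊔ SimpleGraph.edge x y) := by
  classical
  have hxy : x ≠ y := by
    rintro rfl
    exact hxB hy
  set N : Sym2 V → ZMod 2 := QA + QB + ind s(x, y) with hN
  have hboth : ∀ e, e ∈ HA.edgeSet → e ∈ HB.edgeSet → e = s(u, v) := by
    intro e
    induction e with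
    | _ a b =>
      intro h1 h2
      rw [SimpleGraph.mem_edgeSet] at h1 h2
      have hab := h1.ne
      obtain ⟨a1, b1⟩ := hHA a b h1
      obtain ⟨a2, b2⟩ := hHB a b h2
      rcases hAB a a1 a2 with rfl | rfl <;> rcases hAB b b1 b2 with rfl | rfl
      · exact (hab rfl).elim
      · rfl
      · exact Sym2.eq_swap
      · exact (hab rfl).elim
  have hxyA : s(x, y) ∉ HA.edgeSet := fun hh => hyA (hHA x y hh).2
  have hxyB : s(x, y) ∉ HB.edgeSet := fun hh => hxB (hHB x y hh).1
  have hmem : ∀ e, e ∈ (HA ⊔ HB ⊔ SimpleGraph.edge x y).edgeSet ↔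
      (e ∈ HA.edgeSet ∨ e ∈ HB.edgeSet) ∨ e = s(x, y) := by
    intro e
    rw [mem_edgeSet_sup_edge hxy, SimpleGraph.edgeSet_sup]
    rfl
  set F : Option (ιA ⊕ ιB) → Sym2 V → ZMod 2 := fun o => o.elim N (Sum.elim fA fB) with hF
  have hNe : ∀ e, N e ≠ 0 → QA e ≠ 0 ∨ QB e ≠ 0 ∨ e = s(x, y) := by
    intro e he
    by_contra hcon
    push Not at hcon
    obtain ⟨h1, h2, h3⟩ := hcon
    simp [hN, h1, h2, h3] at he
  have hAe : ∀ {i e}, fA i e ≠ 0 → e ∈ HA.edgeSet := fun {i e} h => hA.supp i e h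
  have hBe : ∀ {i e}, fB i e ≠ 0 → e ∈ HB.edgeSet := fun {i e} h => hB.supp i e h
  -- pairs of members of the union family exclude the new member
  have pair : ∀ e (a b : ιA ⊕ ιB), a ≠ b → F (some a) e ≠ 0 → F (some b) e ≠ 0 → N e ≠ 0 →
      False := by
    have mixed : ∀ e i j, fA i e ≠ 0 → fB j e ≠ 0 → N e ≠ 0 → False := by
      intro e i j hi hj hn
      have := hboth e (hAe hi) (hBe hj)
      rcases hNe e hn with h1 | h1 | h1
      · exact (hQA e h1).2.1 this
      · exact (hQB e h1).2.1 this
      · exact hxyA (h1 ▸ hAe hi)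
    rintro e (i | i) (j | j) hij hi hj hn
    · rcases hNe e hn with h1 | h1 | h1
      · exact hij (congrArg Sum.inl ((hQA e h1).2.2 i j hi hj))
      · exact (hQB e h1).2.1 (hboth e (hAe hi) (hQB e h1).1)
      · exact hxyA (h1 ▸ hAe hi)
    · exact mixed e i j hi hj hn
    · exact mixed e j i hj hi hn
    · rcases hNe e hn with h1 | h1 | h1
      · exact (hQA e h1).2.1 (hboth e (hQA e h1).1 (hBe hi))
      · exact hij (congrArg Sum.inr ((hQB e h1).2.2 i j hi hj))
      · exact hxyB (h1 ▸ hBe hi)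
  have two : ∀ e i j k, i ≠ j → fA i e ≠ 0 → fA j e ≠ 0 → fB k e ≠ 0 → False := by
    intro e i j k hij hi hj hk
    have := hboth e (hAe hi) (hBe hk)
    subst this
    exact hij (hcA i j hi hj)
  have two' : ∀ e i j k, i ≠ j → fB i e ≠ 0 → fB j e ≠ 0 → fA k e ≠ 0 → False := by
    intro e i j k hij hi hj hk
    have := hboth e (hAe hk) (hBe hi)
    subst this
    exact hij (hcB i j hi hj)
  refine ⟨Option (ιA ⊕ ιB), inferInstance, F, ?_, ?_, ?_, ?_⟩
  · rintro (_ | i | i) e he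
    · rw [hmem]
      rcases hNe e he with h1 | h1 | h1
      · exact Or.inl (Or.inl (hQA e h1).1)
      · exact Or.inl (Or.inr (hQB e h1).1)
      · exact Or.inr h1
    · exact (hmem e).2 (Or.inl (Or.inl (hAe he)))
    · exact (hmem e).2 (Or.inl (Or.inr (hBe he)))
  · rintro e (_ | i) (_ | j) (_ | k) hij hik hjk hi hj hk
    · exact hij rfl
    · exact hij rfl
    · exact hik rfl
    · exact pair e j k (fun hh => hjk (congrArg some hh)) hj hk hi
    · exact hjk rfl
    · exact pair e i k (fun hh => hik (congrArg some hh)) hi hk hj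
    · exact pair e i j (fun hh => hij (congrArg some hh)) hi hj hk
    · replace hij : i ≠ j := fun hh => hij (congrArg some hh)
      replace hik : i ≠ k := fun hh => hik (congrArg some hh)
      replace hjk : j ≠ k := fun hh => hjk (congrArg some hh)
      have nl : ∀ {a b : ιA}, (Sum.inl a : ιA ⊕ ιB) ≠ Sum.inl b → a ≠ b :=
        fun h hh => h (congrArg Sum.inl hh)
      have nr : ∀ {a b : ιB}, (Sum.inr a : ιA ⊕ ιB) ≠ Sum.inr b → a ≠ b :=
        fun h hh => h (congrArg Sum.inr hh)
      rcases i with i | i <;> rcases j with j | j <;> rcases k with k | k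
      · exact hA.cap e i j k (nl hij) (nl hik) (nl hjk) hi hj hk
      · exact two e i j k (nl hij) hi hj hk
      · exact two e i k j (nl hik) hi hk hj
      · exact two' e j k i (nr hjk) hj hk hi
      · exact two e j k i (nl hjk) hj hk hi
      · exact two' e i k j (nr hik) hi hk hj
      · exact two' e i j k (nr hij) hi hj hk
      · exact hB.cap e i j k (nr hij) (nr hik) (nr hjk) hi hj hk
  · rintro (_ | i | i) X
    · change N ⬝ᵥ cob X = 0
      rw [hN, add_dotProduct, add_dotProduct, hQA', hQB', ind_dot, cob_mk]
      generalize X x = a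
      generalize X y = b
      generalize X u = d
      revert a b d
      decide
    · exact hA.even i X
    · exact hB.even i X
  · intro g hg
    obtain ⟨XA, hXA⟩ := hA.exact g fun i => hg (some (Sum.inl i))
    obtain ⟨XB', hXB'⟩ := hB.exact g fun i => hg (some (Sum.inr i))
    obtain ⟨XB, hXB, hu⟩ : ∃ XB, (∀ e ∈ HB.edgeSet, g e = cob XB e) ∧ XB u = XA u := by
      refine ⟨fun w => XB' w + (XB' u + XA u), ?_, ?_⟩
      · intro e he
        rw [cob_add_const, hXB' e he]
      · dsimp only
        rw [← add_assoc, zmod_two_add_self, zero_add]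
    have hv : u ≠ v → XB v = XA v := by
      intro hne
      obtain ⟨h1, h2⟩ := huv hne
      have e1 := hXA s(u, v) h1
      have e2 := hXB s(u, v) h2
      rw [e1, cob_mk, cob_mk, hu] at e2
      exact (add_left_cancel e2).symm
    have hagree : ∀ w, w ∈ A → w ∈ B → XB w = XA w := by
      intro w h1 h2
      rcases hAB w h1 h2 with rfl | rfl
      · exact hu
      · by_cases hne : u = w
        · rw [← hne]
          exact hu
        · exact hv hne
    set X : V → ZMod 2 := fun w => if w ∈ A then XA w else XB w with hX
    have hXa : ∀ w, w ∈ A → X w = XA w := fun w hw => by simp [hX, hw]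
    have hXb : ∀ w, w ∈ B → X w = XB w := by
      intro w hw
      by_cases h : w ∈ A
      · rw [hXa w h, hagree w h hw]
      · simp [hX, h]
    have gA : ∀ e ∈ HA.edgeSet, g e = cob X e := by
      intro e he
      rw [hXA e he]
      induction e with
      | _ a b =>
        obtain ⟨h1, h2⟩ := hHA a b he
        rw [cob_mk, cob_mk, hXa a h1, hXa b h2]
    have gB : ∀ e ∈ HB.edgeSet, g e = cob X e := by
      intro e he
      rw [hXB e he]
      induction e with
      | _ a b =>
        obtain ⟨h1, h2⟩ := hHB a b he
        rw [cob_mk, cob_mk, hXb a h1, hXb b h2]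
    refine ⟨X, fun e he => ?_⟩
    rcases (hmem e).1 he with (he | he) | rfl
    · exact gA e he
    · exact gB e he
    · have h0 : N ⬝ᵥ g = 0 := hg none
      rw [hN, add_dotProduct, add_dotProduct, dot_congr (fun e he => gA e (hQA e he).1),
        dot_congr (fun e he => gB e (hQB e he).1), hQA', hQB', ind_dot] at h0
      rw [← zmod_two_eq_of_add h0, cob_mk]
      generalize X x = a
      generalize X y = b
      generalize X u = d
      revert a b d
      decide

end MacLane

namespace MacLane
set_option linter.unusedSectionVars false
variable {V : Type} [Fintype V] [DecidableEq V]
variable {G : SimpleGraph V} {ι : Type} {f : ι → Sym2 V → ZMod 2}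

theorem eq_of_reachable {W α : Type} {K : SimpleGraph W} {X : W → α}
    (hX : ∀ a b, K.Adj a b → X a = X b) {a b : W} (h : K.Reachable a b) : X a = X b := by
  obtain ⟨p⟩ := h
  induction p with
  | nil => rfl
  | cons hadj _ ih => exact (hX _ _ hadj).trans ih

theorem IsMacLane.mono {G' : SimpleGraph V} (h : IsMacLane G) (hle : G' ≤ G) : IsMacLane G' := by
  obtain ⟨ι, hι, f, hf⟩ := h
  obtain ⟨f', hf', _⟩ := hf.mono hle
  exact ⟨ι, hι, f', hf'⟩

/-- The edges of `G` inside the fibres of `r`. -/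
def fiberGraph {W α : Type} (G : SimpleGraph W) (r : W → α) : SimpleGraph W where
  Adj a b := G.Adj a b ∧ r a = r b
  symm := ⟨fun _ _ h => ⟨h.1.symm, h.2.symm⟩⟩
  loopless := ⟨fun _ h => G.loopless.irrefl _ h.1⟩

/-- The property `IsMacLane` passes to minors. -/
theorem IsMacLane.minor {W : Type} [Fintype W] [DecidableEq W] {G0 : SimpleGraph W}
    [Nonempty W] (h : IsMacLane G0) (r : W → Option V)
    (hconn : ∀ v a b, r a = some v → r b = some v → (fiberGraph G0 r).Reachable a b)
    (hadj : ∀ u v, G.Adj u v → ∃ a b, G0.Adj a b ∧ r a = some u ∧ r b = some v) :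
    IsMacLane G := by
  classical
  have hrep : ∀ e : Sym2 V, ∃ e0 : Sym2 W, e ∈ G.edgeSet →
      e0 ∈ G0.edgeSet ∧ e0.map r = e.map some := by
    intro e
    induction e with
    | _ u v =>
      by_cases huv : G.Adj u v
      · obtain ⟨a, b, hab, ha, hb⟩ := hadj u v huv
        exact ⟨s(a, b), fun _ => ⟨hab, by simp [ha, hb]⟩⟩
      · obtain ⟨w⟩ := ‹Nonempty W›
        exact ⟨s(w, w), fun hh => (huv hh).elim⟩
  choose rep hrep using hrep
  set G1 : SimpleGraph W := fiberGraph G0 r ⊔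
    SimpleGraph.fromEdgeSet (rep '' G.edgeSet) with hG1
  have hrepne : ∀ e ∈ G.edgeSet, ¬ (rep e).IsDiag := by
    intro e he
    exact G0.not_isDiag_of_mem_edgeSet (hrep e he).1
  have hG1mem : ∀ e ∈ G.edgeSet, rep e ∈ G1.edgeSet := by
    intro e he
    rw [hG1, SimpleGraph.edgeSet_sup, SimpleGraph.edgeSet_fromEdgeSet]
    exact Or.inr ⟨⟨e, he, rfl⟩, hrepne e he⟩
  have hG1cases : ∀ e0 ∈ G1.edgeSet, e0 ∈ (fiberGraph G0 r).edgeSet ∨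
      ∃ e ∈ G.edgeSet, rep e = e0 := by
    intro e0 he0
    rw [hG1, SimpleGraph.edgeSet_sup, SimpleGraph.edgeSet_fromEdgeSet] at he0
    rcases he0 with he0 | he0
    · exact Or.inl he0
    · exact Or.inr he0.1
  have hG1le : G1 ≤ G0 := by
    rw [← SimpleGraph.edgeSet_subset_edgeSet]
    intro e0 he0
    rcases hG1cases e0 he0 with he0 | ⟨e, he, rfl⟩
    · induction e0 with
      | _ a b => exact he0.1
    · exact (hrep e he).1
  have hinj : ∀ e ∈ G.edgeSet, ∀ e' ∈ G.edgeSet, rep e = rep e' → e = e' := by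
    intro e he e' he' heq
    have h1 := (hrep e he).2
    rw [heq, (hrep e' he').2] at h1
    exact (Sym2.map.injective (Option.some_injective V) h1).symm
  have hnotfib : ∀ e ∈ G.edgeSet, rep e ∉ (fiberGraph G0 r).edgeSet := by
    intro e he hf
    have h1 := (hrep e he).2
    have h2 := G.not_isDiag_of_mem_edgeSet he
    generalize rep e = e0 at h1 hf
    induction e0 with
    | _ a b =>
      induction e with
      | _ u v =>
        have hr : r a = r b := hf.2
        simp only [Sym2.map_mk, hr, Sym2.eq_iff] at h1
        apply h2
        rw [Sym2.mk_isDiag_iff]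
        rcases h1 with ⟨h1, h3⟩ | ⟨h1, h3⟩
        · exact Option.some_injective _ (h1.symm.trans h3)
        · exact Option.some_injective _ (h3.symm.trans h1)
  obtain ⟨ι, hι, f0, hf0⟩ := h.mono hG1le
  set F : ι → Sym2 V → ZMod 2 := fun i e => if e ∈ G.edgeSet then f0 i (rep e) else 0 with hF
  set pull : (Sym2 V → ZMod 2) → Sym2 W → ZMod 2 := fun g e0 =>
    ∑ e ∈ Finset.univ.filter (fun e => e ∈ G.edgeSet ∧ rep e = e0), g e with hpull
  have hdual : ∀ i g, f0 i ⬝ᵥ pull g = F i ⬝ᵥ g := by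
    intro i g
    have h1 : ∀ e0, f0 i e0 * pull g e0 =
        ∑ e, if rep e = e0 then F i e * g e else 0 := by
      intro e0
      rw [hpull, Finset.mul_sum, Finset.sum_filter]
      refine Finset.sum_congr rfl fun e _ => ?_
      by_cases he : e ∈ G.edgeSet
      · by_cases hr : rep e = e0
        · simp [he, hr, hF]
        · simp [hr]
      · simp [he, hF]
    unfold dotProduct
    simp_rw [h1]
    rw [Finset.sum_comm]
    simp
  have hpullrep : ∀ g, ∀ e ∈ G.edgeSet, pull g (rep e) = g e := by
    intro g e he
    have : Finset.univ.filter (fun e' => e' ∈ G.edgeSet ∧ rep e' = rep e) = {e} := by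
      ext e'
      simp only [Finset.mem_filter, Finset.mem_univ, true_and, Finset.mem_singleton]
      constructor
      · rintro ⟨h1, h2⟩
        exact hinj e' h1 e he h2
      · rintro rfl
        exact ⟨he, rfl⟩
    simp only [hpull, this, Finset.sum_singleton]
  have hpullfib : ∀ g, ∀ e0 ∈ (fiberGraph G0 r).edgeSet, pull g e0 = 0 := by
    intro g e0 he0
    refine Finset.sum_eq_zero fun e he => ?_
    simp only [Finset.mem_filter, Finset.mem_univ, true_and] at he
    exact (hnotfib e he.1 (he.2 ▸ he0)).elim
  refine ⟨ι, hι, F, ?_, ?_, ?_, ?_⟩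
  · intro i e he
    by_contra hcon
    simp [hF, hcon] at he
  · intro e i j k hij hik hjk hi hj hk
    have he : e ∈ G.edgeSet := by
      by_contra hcon
      simp [hF, hcon] at hi
    simp only [hF, he, if_true] at hi hj hk
    exact hf0.cap (rep e) i j k hij hik hjk hi hj hk
  · intro i X
    rw [← hdual, ← hf0.even i fun w => (r w).elim 0 X]
    refine dot_congr fun e0 he0 => ?_
    rcases hG1cases e0 (hf0.supp i e0 he0) with hfib | ⟨e, he, rfl⟩
    · rw [hpullfib _ _ hfib]
      induction e0 with
      | _ a b =>
        have : r a = r b := hfib.2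
        rw [cob_mk, this, zmod_two_add_self]
    · rw [hpullrep _ _ he]
      have h1 := (hrep e he).2
      clear he0
      generalize rep e = e0 at h1
      induction e0 with
      | _ a b =>
        induction e with
        | _ u v =>
          simp only [Sym2.map_mk, Sym2.eq_iff] at h1
          rcases h1 with ⟨h1, h2⟩ | ⟨h1, h2⟩
          · simp [h1, h2]
          · simp [h1, h2, add_comm]
  · intro g hg
    obtain ⟨X', hX'⟩ := hf0.exact (pull g) fun i => by rw [hdual, hg]
    have hne : ∀ v, ∃ w, ∀ a, r a = some v → r w = some v := by
      intro v
      by_cases hv : ∃ a, r a = some v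
      · obtain ⟨a, ha⟩ := hv
        exact ⟨a, fun _ _ => ha⟩
      · exact ⟨Classical.arbitrary W, fun a ha => (hv ⟨a, ha⟩).elim⟩
    choose w hw using hne
    have hconst : ∀ v a, r a = some v → X' a = X' (w v) := by
      intro v a ha
      refine eq_of_reachable (K := fiberGraph G0 r) ?_ (hconn v a (w v) ha (hw v a ha))
      intro a b hab
      have h1 := hX' s(a, b) (by
        rw [hG1, SimpleGraph.edgeSet_sup]
        exact Or.inl hab)
      rw [hpullfib g s(a, b) hab, cob_mk] at h1
      exact zmod_two_eq_of_add h1.symm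
    refine ⟨fun v => X' (w v), fun e he => ?_⟩
    rw [← hpullrep g e he, hX' _ (hG1mem e he)]
    have h1 := (hrep e he).2
    generalize rep e = e0 at h1
    induction e0 with
    | _ a b =>
      induction e with
      | _ u v =>
        simp only [Sym2.map_mk, Sym2.eq_iff] at h1
        rcases h1 with ⟨h1, h2⟩ | ⟨h1, h2⟩
        · rw [cob_mk, cob_mk, hconst u a h1, hconst v b h2]
        · rw [cob_mk, cob_mk, hconst v a h1, hconst u b h2, add_comm]

/-- Each edge of an even set lies on a cycle of that set. -/
theorem reachable_of_even {Q : Sym2 V → ZMod 2} (hev : ∀ X, Q ⬝ᵥ cob X = 0) {u v : V}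
    (huv : Q s(u, v) ≠ 0) :
    (SimpleGraph.fromEdgeSet {e | Q e ≠ 0 ∧ e ≠ s(u, v)}).Reachable u v := by
  classical
  set K := SimpleGraph.fromEdgeSet {e | Q e ≠ 0 ∧ e ≠ s(u, v)} with hK
  by_contra hcon
  set X : V → ZMod 2 := fun w => if K.Reachable u w then 1 else 0 with hX
  have h1 : Q ⬝ᵥ cob X = Q ⬝ᵥ ind s(u, v) := by
    refine dot_congr fun e he => ?_
    by_cases heq : e = s(u, v)
    · subst heq
      simp [hX, hcon]
    · have h0 : ind s(u, v) e = 0 := Pi.single_eq_of_ne heq _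
      rw [h0]
      induction e with
      | _ a b =>
        by_cases hab : a = b
        · subst hab
          rw [cob_mk, zmod_two_add_self]
        · have hadj : K.Adj a b := by
            rw [hK, SimpleGraph.fromEdgeSet_adj]
            exact ⟨⟨he, heq⟩, hab⟩
          have : K.Reachable u a ↔ K.Reachable u b :=
            ⟨fun hh => hh.trans hadj.reachable, fun hh => hh.trans hadj.reachable.symm⟩
          simp only [cob_mk, hX, this]
          exact zmod_two_add_self _
  rw [hev, dotProduct_single_one] at h1
  exact huv h1.symm

end MacLane

namespace MacLane
set_option linter.unusedSectionVars false
set_option linter.unusedSimpArgs false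
variable {V : Type} [Fintype V] [DecidableEq V]
variable {G : SimpleGraph V} {ι : Type} {f : ι → Sym2 V → ZMod 2}

/-- The edges of `G` with both ends in `S`, as a graph on all of `V`. -/
def inside {W : Type} (G : SimpleGraph W) (S : Set W) : SimpleGraph W where
  Adj a b := G.Adj a b ∧ a ∈ S ∧ b ∈ S
  symm := ⟨fun _ _ h => ⟨h.1.symm, h.2.2, h.2.1⟩⟩
  loopless := ⟨fun _ h => G.loopless.irrefl _ h.1⟩

theorem exists_adj_of_reachable {W : Type} {K : SimpleGraph W} {S : Set W} {a b : W}
    (h : K.Reachable a b) (ha : a ∈ S) (hb : b ∉ S) : ∃ p q, K.Adj p q ∧ p ∈ S ∧ q ∉ S := by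
  by_contra hcon
  push Not at hcon
  have := eq_of_reachable (K := K) (X := fun w => w ∈ S) (fun p q hpq => by
    apply propext
    exact ⟨fun h => hcon p q hpq h, fun h => hcon q p hpq.symm h⟩) h
  exact hb (this ▸ ha)

theorem ind_eq_zero {e e' : Sym2 V} (h : e ≠ e') : ind e' e = 0 :=
  Pi.single_eq_of_ne h _

set_option maxHeartbeats 1000000 in
/-- A chord of a member separates the two sides of that member. -/
theorem TwoFam.crossing_aux (h : TwoFam G f) (i0 : ι) {A0 B0 : Set V} {c d a1 a2 b1 b2 : V}
    (hcd : c ≠ d) (hadj : G.Adj c d) (hcA0 : c ∉ A0) (hdA0 : d ∉ A0) (hcB : c ∉ B0) (hdB : d ∉ B0)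
    (hdisj : ∀ x, x ∈ A0 → x ∉ B0) (ha1 : a1 ∈ A0) (ha2 : a2 ∈ A0) (hb1 : b1 ∈ B0) (hb2 : b2 ∈ B0)
    (hA0c : ∀ x ∈ A0, ∀ y ∈ A0, (inside G A0).Reachable x y)
    (hBc : ∀ x ∈ B0, ∀ y ∈ B0, (inside G B0).Reachable x y)
    (hr1 : f i0 s(c, a1) ≠ 0) (hr2 : f i0 s(a2, d) ≠ 0)
    (hr3 : f i0 s(d, b1) ≠ 0) (hr4 : f i0 s(b2, c) ≠ 0)
    (hC : ∀ e, f i0 e ≠ 0 → (∃ x y, x ∈ A0 ∧ y ∈ A0 ∧ e = s(x, y)) ∨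
      (∃ x y, x ∈ B0 ∧ y ∈ B0 ∧ e = s(x, y)) ∨ e = s(c, a1) ∨ e = s(a2, d) ∨ e = s(d, b1) ∨
      e = s(b2, c)) :
    ∀ a ∈ A0, ∀ b ∈ B0, ¬ (inside G {c, d}ᶜ).Reachable a b := by
  classical
  intro a0 ha0 b0 hb0 hreach
  set S : Set V := ({c, d} ∪ B0)ᶜ with hS
  set A : Set V := {x | (inside G S).Reachable a0 x} with hA
  have hA0S : ∀ x ∈ A0, x ∈ S := by
    rintro x hx ((rfl | rfl) | hx')
    · exact hcA0 hx
    · exact hdA0 hx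
    · exact hdisj x hx hx'
  have hAS : ∀ x ∈ A, x ∈ S := by
    intro x hx
    by_contra hxs
    obtain ⟨p, q, hpq, _, hq⟩ := exists_adj_of_reachable hx (hA0S a0 ha0) hxs
    exact hq hpq.2.2
  have hA0A : ∀ x ∈ A0, x ∈ A := by
    intro x hx
    refine (hA0c a0 ha0 x hx).mono ?_
    intro p q hpq
    exact ⟨hpq.1, hA0S p hpq.2.1, hA0S q hpq.2.2⟩
  have hcA : c ∉ A := fun hh => hAS c hh (Or.inl (Or.inl rfl))
  have hdA : d ∉ A := fun hh => hAS d hh (Or.inl (Or.inr rfl))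
  have hAB : ∀ x ∈ A, x ∉ B0 := fun x hx hb => hAS x hx (Or.inr hb)
  obtain ⟨a, b, hab, haA, hbA⟩ := exists_adj_of_reachable hreach (S := A)
    (SimpleGraph.Reachable.refl _) (fun hh => hAB b0 hh hb0)
  have hbB : b ∈ B0 := by
    by_contra hbB
    apply hbA
    refine SimpleGraph.Reachable.trans haA (SimpleGraph.Adj.reachable ⟨hab.1, hAS a haA, ?_⟩)
    rintro (hh | hh)
    · exact hab.2.2 hh
    · exact hbB hh
  have hAc : ∀ x ∈ A, (inside G A).Reachable a0 x := by
    intro x hx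
    by_contra hnr
    obtain ⟨p, q, hpq, hp, hq⟩ := exists_adj_of_reachable hx
      (S := {x | (inside G A).Reachable a0 x}) (SimpleGraph.Reachable.refl _) hnr
    have hpA : p ∈ A := by
      refine SimpleGraph.Reachable.mono ?_ hp
      intro s t hst
      exact ⟨hst.1, hAS s hst.2.1, hAS t hst.2.2⟩
    apply hq
    refine SimpleGraph.Reachable.trans hp (SimpleGraph.Adj.reachable ⟨hpq.1, hpA, ?_⟩)
    exact SimpleGraph.Reachable.trans hpA hpq.reachable
  have ha1A := hA0A a1 ha1
  have ha2A := hA0A a2 ha2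
  set K : SimpleGraph V := inside G A ⊔ inside G B0 ⊔ SimpleGraph.fromEdgeSet
    {s(c, a1), s(a2, d), s(d, b1), s(b2, c), s(c, d), s(a, b)} with hK
  have hKG : K ≤ G := by
    rw [hK]
    refine sup_le (sup_le (fun p q hpq => hpq.1) (fun p q hpq => hpq.1)) ?_
    rw [← SimpleGraph.edgeSet_subset_edgeSet, SimpleGraph.edgeSet_fromEdgeSet]
    rintro e ⟨he, -⟩
    rcases he with rfl | rfl | rfl | rfl | rfl | rfl
    · exact h.supp _ _ hr1
    · exact h.supp _ _ hr2
    · exact h.supp _ _ hr3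
    · exact h.supp _ _ hr4
    · exact hadj
    · exact hab.1
  have kcases : ∀ e ∈ K.edgeSet, (∃ x y, x ∈ A ∧ y ∈ A ∧ e = s(x, y)) ∨
      (∃ x y, x ∈ B0 ∧ y ∈ B0 ∧ e = s(x, y)) ∨ e = s(c, a1) ∨ e = s(a2, d) ∨ e = s(d, b1) ∨
      e = s(b2, c) ∨ e = s(c, d) ∨ e = s(a, b) := by
    intro e he
    rw [hK, SimpleGraph.edgeSet_sup, SimpleGraph.edgeSet_sup, SimpleGraph.edgeSet_fromEdgeSet]
      at he
    rcases he with (he | he) | ⟨he, -⟩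
    · induction e with
      | _ x y => exact Or.inl ⟨x, y, he.2.1, he.2.2, rfl⟩
    · induction e with
      | _ x y => exact Or.inr (Or.inl ⟨x, y, he.2.1, he.2.2, rfl⟩)
    · exact Or.inr (Or.inr he)
  have kmem : ∀ p q, p ≠ q → s(p, q) ∈ ({s(c, a1), s(a2, d), s(d, b1), s(b2, c), s(c, d), s(a, b)}
      : Set (Sym2 V)) → K.Adj p q := by
    intro p q hpq hmem
    rw [hK]
    refine Or.inr ?_
    rw [SimpleGraph.fromEdgeSet_adj]
    exact ⟨hmem, hpq⟩
  have neA : ∀ {x y : V}, x ∈ A → y ∉ A → x ≠ y := fun hx hy hh => hy (hh ▸ hx)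
  have neB : ∀ {x y : V}, x ∈ B0 → y ∉ B0 → x ≠ y := fun hx hy hh => hy (hh ▸ hx)
  have hBA : ∀ x ∈ B0, x ∉ A := fun x hb hx => hAB x hx hb
  have kca1 := kmem c a1 (neA ha1A hcA).symm (by simp)
  have ka2d := kmem a2 d (neA ha2A hdA) (by simp)
  have kdb1 := kmem d b1 (neB hb1 hdB).symm (by simp)
  have kb2c := kmem b2 c (neB hb2 hcB) (by simp)
  have kcd := kmem c d hcd (by simp)
  have kab := kmem a b (neA haA hbA) (by simp)
  obtain ⟨f', hf', hf'C⟩ := h.mono hKG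
  have hC' : f' i0 = f i0 := by
    refine hf'C i0 fun e he => ?_
    rcases hC e he with ⟨x, y, hx, hy, rfl⟩ | ⟨x, y, hx, hy, rfl⟩ | rfl | rfl | rfl | rfl
    · exact Or.inl (Or.inl ⟨h.supp _ _ he, hA0A x hx, hA0A y hy⟩)
    · exact Or.inl (Or.inr ⟨h.supp _ _ he, hx, hy⟩)
    · exact kca1
    · exact ka2d
    · exact kdb1
    · exact kb2c
  -- vertex inequalities
  have n1 := hcd
  have n2 := neA ha1A hcA
  have n3 := neA ha1A hdA
  have n4 := neA ha2A hcA
  have n5 := neA ha2A hdA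
  have n6 := neA haA hcA
  have n7 := neA haA hdA
  have n8 := neB hb1 hcB
  have n9 := neB hb1 hdB
  have n10 := neB hb2 hcB
  have n11 := neB hb2 hdB
  have n12 := neB hbB hcB
  have n13 := neB hbB hdB
  have n14 := neA ha1A (hBA b1 hb1)
  have n15 := neA ha1A (hBA b2 hb2)
  have n16 := neA ha1A (hBA b hbB)
  have n17 := neA ha2A (hBA b1 hb1)
  have n18 := neA ha2A (hBA b2 hb2)
  have n19 := neA ha2A (hBA b hbB)
  have n20 := neA haA (hBA b1 hb1)
  have n21 := neA haA (hBA b2 hb2)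
  have n22 := neA haA (hBA b hbB)
  have indA : ∀ {x y p q : V}, x ∈ A → y ∈ A → (p ∉ A ∨ q ∉ A) → ind s(p, q) s(x, y) = 0 := by
    intro x y p q hx hy hpq
    apply ind_eq_zero
    intro heq
    rw [Sym2.eq_iff] at heq
    rcases heq with ⟨rfl, rfl⟩ | ⟨rfl, rfl⟩ <;> tauto
  have indB : ∀ {x y p q : V}, x ∈ B0 → y ∈ B0 → (p ∉ B0 ∨ q ∉ B0) →
      ind s(p, q) s(x, y) = 0 := by
    intro x y p q hx hy hpq
    apply ind_eq_zero
    intro heq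
    rw [Sym2.eq_iff] at heq
    rcases heq with ⟨rfl, rfl⟩ | ⟨rfl, rfl⟩ <;> tauto
  have hAc' : ∀ x ∈ A, ∀ y ∈ A, (inside G A).Reachable x y :=
    fun x hx y hy => (hAc x hx).symm.trans (hAc y hy)
  have hab' := hab.1
  have kA : inside G A ≤ K := le_sup_left.trans le_sup_left
  have kB : inside G B0 ≤ K := le_sup_right.trans le_sup_left
  clear_value K A
  clear hK hA hAc hreach hab
  have haB := hAB a haA
  have ha1B := hAB a1 ha1A
  have ha2B := hAB a2 ha2A
  have hb1A := hBA b1 hb1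
  have hb2A := hBA b2 hb2
  have m1 := n1.symm
  have m2 := n2.symm
  have m3 := n3.symm
  have m4 := n4.symm
  have m5 := n5.symm
  have m6 := n6.symm
  have m7 := n7.symm
  have m8 := n8.symm
  have m9 := n9.symm
  have m10 := n10.symm
  have m11 := n11.symm
  have m12 := n12.symm
  have m13 := n13.symm
  have m14 := n14.symm
  have m15 := n15.symm
  have m16 := n16.symm
  have m17 := n17.symm
  have m18 := n18.symm
  have m19 := n19.symm
  have m20 := n20.symm
  have m21 := n21.symm
  have m22 := n22.symm
  have eqA : ∀ j, f' j s(c, a1) + f' j s(a2, d) + f' j s(a, b) = 0 := by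
    intro j
    have e1 := hf'.even j (fun w => if w ∈ A then 1 else 0)
    rw [dot_congr (g' := ind s(c, a1) + ind s(a2, d) + ind s(a, b))] at e1
    · simpa only [dotProduct_add, dotProduct_single_one] using e1
    clear e1
    intro e he
    replace he := kcases e (hf'.supp j e he)
    clear hf' hf'C hC' h hC hA0c hBc hAc' kcases kmem
    rcases he with ⟨x, y, hx, hy, rfl⟩ | ⟨x, y, hx, hy, rfl⟩ | rfl | rfl |
      rfl | rfl | rfl | rfl
    · have := hAB x hx
      have := hAB y hy
      have := neA hx hcA
      have := neA hx hdA
      have := neA hx hbA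
      have := neA hy hcA
      have := neA hy hdA
      have := neA hy hbA
      have := neA hx hb1A
      have := neA hy hb1A
      have := neA hx hb2A
      have := neA hy hb2A
      simp [*, zmod_two_add_self]
    · have := hBA x hx
      have := hBA y hy
      have := neB hx hcB
      have := neB hx hdB
      have := neB hx haB
      have := neB hy hcB
      have := neB hy hdB
      have := neB hy haB
      have := neB hx ha1B
      have := neB hy ha1B
      have := neB hx ha2B
      have := neB hy ha2B
      simp [*, zmod_two_add_self]
    all_goals simp [*, zmod_two_add_self]
  have eqB : ∀ j, f' j s(d, b1) + f' j s(b2, c) + f' j s(a, b) = 0 := by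
    intro j
    have e1 := hf'.even j (fun w => if w ∈ B0 then 1 else 0)
    rw [dot_congr (g' := ind s(d, b1) + ind s(b2, c) + ind s(a, b))] at e1
    · simpa only [dotProduct_add, dotProduct_single_one] using e1
    clear e1
    intro e he
    replace he := kcases e (hf'.supp j e he)
    clear hf' hf'C hC' h hC hA0c hBc hAc' kcases kmem
    rcases he with ⟨x, y, hx, hy, rfl⟩ | ⟨x, y, hx, hy, rfl⟩ | rfl | rfl |
      rfl | rfl | rfl | rfl
    · have := hAB x hx
      have := hAB y hy
      have := neA hx hcA
      have := neA hx hdA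
      have := neA hx hbA
      have := neA hy hcA
      have := neA hy hdA
      have := neA hy hbA
      have := neA hx hb1A
      have := neA hy hb1A
      have := neA hx hb2A
      have := neA hy hb2A
      simp [*, zmod_two_add_self]
    · have := hBA x hx
      have := hBA y hy
      have := neB hx hcB
      have := neB hx hdB
      have := neB hx haB
      have := neB hy hcB
      have := neB hy hdB
      have := neB hy haB
      have := neB hx ha1B
      have := neB hy ha1B
      have := neB hx ha2B
      have := neB hy ha2B
      simp [*, zmod_two_add_self]
    all_goals simp [*, zmod_two_add_self]
  have eqc : ∀ j, f' j s(c, a1) + f' j s(b2, c) + f' j s(c, d) = 0 := by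
    intro j
    have e1 := hf'.even j (fun w => if w ∈ ({c} : Set V) then 1 else 0)
    rw [dot_congr (g' := ind s(c, a1) + ind s(b2, c) + ind s(c, d))] at e1
    · simpa only [dotProduct_add, dotProduct_single_one] using e1
    clear e1
    intro e he
    replace he := kcases e (hf'.supp j e he)
    clear hf' hf'C hC' h hC hA0c hBc hAc' kcases kmem
    rcases he with ⟨x, y, hx, hy, rfl⟩ | ⟨x, y, hx, hy, rfl⟩ | rfl | rfl |
      rfl | rfl | rfl | rfl
    · have := hAB x hx
      have := hAB y hy
      have := neA hx hcA
      have := neA hx hdA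
      have := neA hx hbA
      have := neA hy hcA
      have := neA hy hdA
      have := neA hy hbA
      have := neA hx hb1A
      have := neA hy hb1A
      have := neA hx hb2A
      have := neA hy hb2A
      simp [*, zmod_two_add_self]
    · have := hBA x hx
      have := hBA y hy
      have := neB hx hcB
      have := neB hx hdB
      have := neB hx haB
      have := neB hy hcB
      have := neB hy hdB
      have := neB hy haB
      have := neB hx ha1B
      have := neB hy ha1B
      have := neB hx ha2B
      have := neB hy ha2B
      simp [*, zmod_two_add_self]
    all_goals simp [*, zmod_two_add_self]
  have eqd : ∀ j, f' j s(a2, d) + f' j s(d, b1) + f' j s(c, d) = 0 := by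
    intro j
    have e1 := hf'.even j (fun w => if w ∈ ({d} : Set V) then 1 else 0)
    rw [dot_congr (g' := ind s(a2, d) + ind s(d, b1) + ind s(c, d))] at e1
    · simpa only [dotProduct_add, dotProduct_single_one] using e1
    clear e1
    intro e he
    replace he := kcases e (hf'.supp j e he)
    clear hf' hf'C hC' h hC hA0c hBc hAc' kcases kmem
    rcases he with ⟨x, y, hx, hy, rfl⟩ | ⟨x, y, hx, hy, rfl⟩ | rfl | rfl |
      rfl | rfl | rfl | rfl
    · have := hAB x hx
      have := hAB y hy
      have := neA hx hcA
      have := neA hx hdA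
      have := neA hx hbA
      have := neA hy hcA
      have := neA hy hdA
      have := neA hy hbA
      have := neA hx hb1A
      have := neA hy hb1A
      have := neA hx hb2A
      have := neA hy hb2A
      simp [*, zmod_two_add_self]
    · have := hBA x hx
      have := hBA y hy
      have := neB hx hcB
      have := neB hx hdB
      have := neB hx haB
      have := neB hy hcB
      have := neB hy hdB
      have := neB hy haB
      have := neB hx ha1B
      have := neB hy ha1B
      have := neB hx ha2B
      have := neB hy ha2B
      simp [*, zmod_two_add_self]
    all_goals simp [*, zmod_two_add_self]
  -- the pairs of values on the two crossing edges are all proportional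
  have hprop : ∃ p q : ZMod 2, (p ≠ 0 ∨ q ≠ 0) ∧
      ∀ j, p * f' j s(c, d) + q * f' j s(a, b) = 0 := by
    have hC0 : f' i0 s(c, d) = 0 ∧ f' i0 s(a, b) = 0 := by
      rw [hC']
      constructor
      · by_contra hne
        rcases hC _ hne with ⟨x, y, hx, hy, he⟩ | ⟨x, y, hx, hy, he⟩ | he | he | he | he
        · rw [Sym2.eq_iff] at he
          rcases he with ⟨h1, h2⟩ | ⟨h1, h2⟩
          · exact hcA0 (h1 ▸ hx)
          · exact hcA0 (h1 ▸ hy)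
        · rw [Sym2.eq_iff] at he
          rcases he with ⟨h1, h2⟩ | ⟨h1, h2⟩
          · exact hcB (h1 ▸ hx)
          · exact hcB (h1 ▸ hy)
        all_goals
          rw [Sym2.eq_iff] at he
          rcases he with ⟨h1, h2⟩ | ⟨h1, h2⟩ <;> contradiction
      · by_contra hne
        rcases hC _ hne with ⟨x, y, hx, hy, he⟩ | ⟨x, y, hx, hy, he⟩ | he | he | he | he
        · rw [Sym2.eq_iff] at he
          rcases he with ⟨h1, h2⟩ | ⟨h1, h2⟩
          · exact hbA (h2 ▸ hA0A y hy)
          · exact hbA (h2 ▸ hA0A x hx)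
        · rw [Sym2.eq_iff] at he
          rcases he with ⟨h1, h2⟩ | ⟨h1, h2⟩
          · exact haB (h1 ▸ hx)
          · exact haB (h1 ▸ hy)
        all_goals
          rw [Sym2.eq_iff] at he
          rcases he with ⟨h1, h2⟩ | ⟨h1, h2⟩ <;> contradiction
    have rimcap : ∀ e, f i0 e ≠ 0 → ∀ j k, j ≠ i0 → k ≠ i0 → j ≠ k → f' j e * f' k e = 0 := by
      intro e he j k hj hk hjk
      by_contra hne
      rw [← hC'] at he
      exact hf'.cap e i0 j k hj.symm hk.symm hjk he (left_ne_zero_of_mul hne)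
        (right_ne_zero_of_mul hne)
    have hpair : ∀ j k, f' j s(a, b) * f' k s(c, d) + f' j s(c, d) * f' k s(a, b) = 0 := by
      intro j k
      by_cases hj : j = i0
      · rw [hj, hC0.1, hC0.2]
        simp
      by_cases hk : k = i0
      · rw [hk, hC0.1, hC0.2]
        simp
      by_cases hjk : j = k
      · rw [hjk, mul_comm]
        exact zmod_two_add_self _
      have a1' := eqA j
      have a2' := eqB j
      have a3' := eqc j
      have a4' := eqd j
      have b1' := eqA k
      have b2' := eqB k
      have b3' := eqc k
      have b4' := eqd k
      have c1' := rimcap _ hr1 j k hj hk hjk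
      have c2' := rimcap _ hr2 j k hj hk hjk
      have c3' := rimcap _ hr3 j k hj hk hjk
      have c4' := rimcap _ hr4 j k hj hk hjk
      generalize f' j s(c, a1) = x1 at *
      generalize f' j s(a2, d) = x2 at *
      generalize f' j s(d, b1) = x3 at *
      generalize f' j s(b2, c) = x4 at *
      generalize f' j s(a, b) = x5 at *
      generalize f' j s(c, d) = x6 at *
      generalize f' k s(c, a1) = y1 at *
      generalize f' k s(a2, d) = y2 at *
      generalize f' k s(d, b1) = y3 at *
      generalize f' k s(b2, c) = y4 at *
      generalize f' k s(a, b) = y5 at *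
      generalize f' k s(c, d) = y6 at *
      have sol : ∀ x1 x2 x3 x4 x5 x6 : ZMod 2, x1 + x2 + x5 = 0 → x3 + x4 + x5 = 0 →
          x1 + x4 + x6 = 0 → x2 + x3 + x6 = 0 →
          x2 = x1 + x5 ∧ x4 = x1 + x6 ∧ x3 = x1 + x5 + x6 := by decide
      obtain ⟨rfl, rfl, rfl⟩ := sol _ _ _ _ _ _ a1' a2' a3' a4'
      obtain ⟨rfl, rfl, rfl⟩ := sol _ _ _ _ _ _ b1' b2' b3' b4'
      have fin : ∀ x1 x5 x6 y1 y5 y6 : ZMod 2, x1 * y1 = 0 → (x1 + x5) * (y1 + y5) = 0 →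
          (x1 + x5 + x6) * (y1 + y5 + y6) = 0 → (x1 + x6) * (y1 + y6) = 0 →
          x5 * y6 + x6 * y5 = 0 := by decide
      exact fin _ _ _ _ _ _ c1' c2' c3' c4'
    by_cases hex : ∃ j, f' j s(a, b) ≠ 0 ∨ f' j s(c, d) ≠ 0
    · obtain ⟨j, hj⟩ := hex
      exact ⟨_, _, hj, fun k => hpair j k⟩
    · push Not at hex
      exact ⟨1, 0, Or.inl one_ne_zero, fun j => by rw [(hex j).1, (hex j).2]; simp⟩
  obtain ⟨p, q, hpq, hperp⟩ := hprop
  obtain ⟨X, hX⟩ := hf'.exact (p • ind s(c, d) + q • ind s(a, b)) fun j => by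
    simpa [dotProduct_add, dotProduct_smul] using hperp j
  have hXzero : ∀ x y, K.Adj x y → s(x, y) ≠ s(c, d) → s(x, y) ≠ s(a, b) → X x = X y := by
    intro x y hxy h1 h2
    have h3 := hX s(x, y) hxy
    rw [Pi.add_apply, Pi.smul_apply, Pi.smul_apply, ind_eq_zero h1, ind_eq_zero h2, cob_mk,
      smul_zero, smul_zero, add_zero] at h3
    exact zmod_two_eq_of_add h3.symm
  have hXA : ∀ x ∈ A, X x = X a := by
    intro x hx
    refine eq_of_reachable (fun s t hst => hXzero s t (kA hst) ?_ ?_) (hAc' x hx a haA)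
    · rw [Ne, Sym2.eq_iff]
      have := neA hst.2.1 hcA
      have := neA hst.2.2 hcA
      tauto
    · rw [Ne, Sym2.eq_iff]
      have := neA hst.2.1 hbA
      have := neA hst.2.2 hbA
      tauto
  have hXB : ∀ x ∈ B0, X x = X b := by
    intro x hx
    refine eq_of_reachable (fun s t hst => hXzero s t (kB hst) ?_ ?_) (hBc x hx b hbB)
    · rw [Ne, Sym2.eq_iff]
      have := neB hst.2.1 hcB
      have := neB hst.2.2 hcB
      tauto
    · rw [Ne, Sym2.eq_iff]
      have := neB hst.2.1 haB
      have := neB hst.2.2 haB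
      tauto
  have e1 : X c = X a1 := hXzero c a1 kca1 (by simp [*]) (by simp [*])
  have e2 : X a2 = X d := hXzero a2 d ka2d (by simp [*]) (by simp [*])
  have e3 : X d = X b1 := hXzero d b1 kdb1 (by simp [*]) (by simp [*])
  have e4 : X b2 = X c := hXzero b2 c kb2c (by simp [*]) (by simp [*])
  rw [hXA a1 ha1A] at e1
  rw [hXA a2 ha2A] at e2
  rw [hXB b1 hb1] at e3
  have hcd' := hX s(c, d) kcd
  have hab'' := hX s(a, b) kab
  have z1 : ind s(a, b) s(c, d) = 0 := ind_eq_zero (by simp [m6, m12])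
  have z2 : ind s(c, d) s(a, b) = 0 := ind_eq_zero (by simp [n6, n7])
  simp only [Pi.add_apply, Pi.smul_apply, z1, z2, Pi.single_eq_same, smul_eq_mul, mul_one, mul_zero,
    add_zero, zero_add, cob_mk] at hcd' hab''
  rw [e1, ← e2, zmod_two_add_self] at hcd'
  rw [← e3, ← e2, zmod_two_add_self] at hab''
  rcases hpq with h1 | h1
  · exact h1 hcd'
  · exact h1 hab''

end MacLane

namespace MacLane
set_option linter.unusedSectionVars false
variable {V : Type} [Fintype V] [DecidableEq V]
variable {G : SimpleGraph V} {ι : Type} {f : ι → Sym2 V → ZMod 2}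

/-- `w` runs cyclically, with period `n`, around the cycle with indicator `C`. -/
structure IsCyc (C : Sym2 V → ZMod 2) (w : ℕ → V) (n : ℕ) : Prop where
  per : ∀ i, w (i + n) = w i
  inj : ∀ i < n, ∀ j < n, w i = w j → i = j
  mem : ∀ i, C s(w i, w (i + 1)) ≠ 0
  only : ∀ e, C e ≠ 0 → ∃ i < n, e = s(w i, w (i + 1))

theorem IsCyc.mod {C : Sym2 V → ZMod 2} {w : ℕ → V} {n : ℕ} (h : IsCyc C w n) (i : ℕ) :
    w (i % n) = w i := by
  have : ∀ k, w (i % n + k * n) = w (i % n) := by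
    intro k
    induction k with
    | zero => simp
    | succ k ih => rw [Nat.succ_mul, ← add_assoc, h.per, ih]
  rw [← this (i / n), mul_comm, Nat.mod_add_div]

theorem IsCyc.rotate {C : Sym2 V → ZMod 2} {w : ℕ → V} {n : ℕ} (h : IsCyc C w n) (hn : 0 < n)
    (a : ℕ) : IsCyc C (fun i => w (i + a)) n where
  per i := by
    rw [add_right_comm, h.per]
  inj i hi j hj hij := by
    rw [← h.mod, ← h.mod (j + a)] at hij
    have := h.inj _ (Nat.mod_lt _ hn) _ (Nat.mod_lt _ hn) hij
    have h2 : i ≡ j [MOD n] := Nat.ModEq.add_right_cancel' a this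
    have h3 : i % n = j % n := h2
    rwa [Nat.mod_eq_of_lt hi, Nat.mod_eq_of_lt hj] at h3
  mem i := by
    rw [add_right_comm]
    exact h.mem _
  only e he := by
    obtain ⟨i, hi, rfl⟩ := h.only e he
    refine ⟨(i + (n - 1) * a) % n, Nat.mod_lt _ hn, ?_⟩
    have e1 : ((i + (n - 1) * a) % n + a) % n = i := by
      rw [Nat.mod_add_mod, add_assoc]
      have : (n - 1) * a + a = a * n := by
        obtain ⟨m, rfl⟩ : ∃ m, n = m + 1 := ⟨n - 1, by omega⟩
        rw [Nat.add_sub_cancel]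
        ring
      rw [this, Nat.add_mul_mod_self_right, Nat.mod_eq_of_lt hi]
    change _ = s(w ((i + (n - 1) * a) % n + a), w ((i + (n - 1) * a) % n + 1 + a))
    rw [add_right_comm, ← h.mod ((i + (n - 1) * a) % n + a), e1,
      ← h.mod ((i + (n - 1) * a) % n + a + 1), Nat.add_mod, e1, ← Nat.add_mod_mod,
      Nat.mod_mod, Nat.add_mod_mod, h.mod]

theorem reachable_inside {H : SimpleGraph V} {S : Set V} {w : ℕ → V} {a b : ℕ}
    (hadj : ∀ i, a ≤ i → i < b → H.Adj (w i) (w (i + 1)))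
    (hS : ∀ i, a ≤ i → i ≤ b → w i ∈ S) :
    ∀ i, a ≤ i → i ≤ b → ∀ j, a ≤ j → j ≤ b → (inside H S).Reachable (w i) (w j) := by
  have key : ∀ i, a ≤ i → i ≤ b → (inside H S).Reachable (w a) (w i) := by
    intro i hai
    induction i, hai using Nat.le_induction with
    | base => intro; rfl
    | succ i hi ih =>
      intro hib
      exact (ih (by omega)).trans (SimpleGraph.Adj.reachable
        ⟨hadj i hi (by omega), hS i hi (by omega), hS _ (by omega) hib⟩)
  intro i hi hi' j hj hj'
  exact (key i hi hi').symm.trans (key j hj hj')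

/-- A chord of a member cycle separates its two sides. -/
theorem TwoFam.crossing (h : TwoFam G f) {i0 : ι} {w : ℕ → V} {n j : ℕ} (hc : IsCyc (f i0) w n)
    (hj : 2 ≤ j) (hjn : j + 2 ≤ n) (hadj : G.Adj (w 0) (w j)) {a b : ℕ} (ha : 0 < a) (haj : a < j)
    (hb : j < b) (hbn : b < n) : ¬ (inside G {w 0, w j}ᶜ).Reachable (w a) (w b) := by
  have hG : ∀ i, G.Adj (w i) (w (i + 1)) := fun i => h.supp _ _ (hc.mem i)
  have hw0 : w n = w 0 := by simpa using hc.per 0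
  refine h.crossing_aux i0 (A0 := w '' Ioo 0 j) (B0 := w '' Ioo j n) (c := w 0) (d := w j)
    (a1 := w 1) (a2 := w (j - 1)) (b1 := w (j + 1)) (b2 := w (n - 1)) hadj.ne hadj
    ?_ ?_ ?_ ?_ ?_ ?_ ?_ ?_ ?_ ?_ ?_ ?_ ?_ ?_ ?_ ?_ _ ⟨a, ⟨ha, haj⟩, rfl⟩ _ ⟨b, ⟨hb, hbn⟩, rfl⟩
  · rintro ⟨i, ⟨h1, h2⟩, h3⟩
    have := hc.inj _ (by omega) _ (by omega) h3
    omega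
  · rintro ⟨i, ⟨h1, h2⟩, h3⟩
    have := hc.inj _ (by omega) _ (by omega) h3
    omega
  · rintro ⟨i, ⟨h1, h2⟩, h3⟩
    have := hc.inj _ (by omega) _ (by omega) h3
    omega
  · rintro ⟨i, ⟨h1, h2⟩, h3⟩
    have := hc.inj _ (by omega) _ (by omega) h3
    omega
  · rintro x ⟨i, ⟨h1, h2⟩, rfl⟩ ⟨k, ⟨h3, h4⟩, h5⟩
    have := hc.inj _ (by omega) _ (by omega) h5
    omega
  · exact ⟨1, ⟨by omega, by omega⟩, rfl⟩
  · exact ⟨j - 1, ⟨by omega, by omega⟩, rfl⟩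
  · exact ⟨j + 1, ⟨by omega, by omega⟩, rfl⟩
  · exact ⟨n - 1, ⟨by omega, by omega⟩, rfl⟩
  · rintro _ ⟨i, ⟨h1, h2⟩, rfl⟩ _ ⟨k, ⟨h3, h4⟩, rfl⟩
    exact reachable_inside (S := w '' Ioo 0 j) (a := 1) (b := j - 1) (fun i _ _ => hG i)
      (fun i _ _ => ⟨i, ⟨by omega, by omega⟩, rfl⟩) i (by omega) (by omega) k (by omega) (by omega)
  · rintro _ ⟨i, ⟨h1, h2⟩, rfl⟩ _ ⟨k, ⟨h3, h4⟩, rfl⟩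
    exact reachable_inside (S := w '' Ioo j n) (a := j + 1) (b := n - 1) (fun i _ _ => hG i)
      (fun i _ _ => ⟨i, ⟨by omega, by omega⟩, rfl⟩) i (by omega) (by omega) k (by omega) (by omega)
  · exact hc.mem 0
  · have := hc.mem (j - 1)
    rwa [Nat.sub_add_cancel (by omega)] at this
  · exact hc.mem j
  · have := hc.mem (n - 1)
    rwa [Nat.sub_add_cancel (by omega), hw0] at this
  · intro e he
    obtain ⟨i, hi, rfl⟩ := hc.only e he
    by_cases h0 : i = 0
    · subst h0
      exact Or.inr (Or.inr (Or.inl rfl))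
    by_cases h1 : i = j - 1
    · subst h1
      rw [Nat.sub_add_cancel (by omega)]
      exact Or.inr (Or.inr (Or.inr (Or.inl rfl)))
    by_cases h2 : i = j
    · subst h2
      exact Or.inr (Or.inr (Or.inr (Or.inr (Or.inl rfl))))
    by_cases h3 : i = n - 1
    · subst h3
      rw [Nat.sub_add_cancel (by omega), hw0]
      exact Or.inr (Or.inr (Or.inr (Or.inr (Or.inr rfl))))
    by_cases h4 : i < j
    · exact Or.inl ⟨_, _, ⟨i, ⟨by omega, by omega⟩, rfl⟩, ⟨i + 1, ⟨by omega, by omega⟩, rfl⟩, rfl⟩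
    · exact Or.inr (Or.inl ⟨_, _, ⟨i, ⟨by omega, by omega⟩, rfl⟩,
        ⟨i + 1, ⟨by omega, by omega⟩, rfl⟩, rfl⟩)

/-- The sum of the edges of the walk `p a, p (a + 1), …, p b`. -/
noncomputable def chi (p : ℕ → V) (a b : ℕ) : Sym2 V → ZMod 2 :=
  ∑ i ∈ Finset.Ico a b, ind s(p i, p (i + 1))

theorem chi_self (p : ℕ → V) (a : ℕ) : chi p a a = 0 := by simp [chi]

theorem chi_succ (p : ℕ → V) {a b : ℕ} (hab : a ≤ b) :
    chi p a (b + 1) = chi p a b + ind s(p b, p (b + 1)) := by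
  rw [chi, Finset.sum_Ico_succ_top hab, chi]

theorem chi_split (p : ℕ → V) {a b c : ℕ} (hab : a ≤ b) (hbc : b ≤ c) :
    chi p a c = chi p a b + chi p b c := by
  rw [chi, ← Finset.sum_Ico_consecutive _ hab hbc, chi, chi]

theorem chi_congr {p q : ℕ → V} {a b : ℕ} (h : ∀ i, a ≤ i → i ≤ b → p i = q i) :
    chi p a b = chi q a b := by
  refine Finset.sum_congr rfl fun i hi => ?_
  rw [Finset.mem_Ico] at hi
  rw [h i hi.1 hi.2.le, h (i + 1) (by omega) hi.2]

theorem chi_shift (p : ℕ → V) (a b k : ℕ) : chi (fun i => p (i + k)) a b = chi p (a + k) (b + k) := by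
  unfold chi
  rw [← Finset.sum_Ico_add' (fun i => ind s(p i, p (i + 1))) a b k]
  refine Finset.sum_congr rfl fun i hi => ?_
  rw [add_right_comm i k 1]

theorem chi_cob (p : ℕ → V) {a b : ℕ} (hab : a ≤ b) (X : V → ZMod 2) :
    chi p a b ⬝ᵥ cob X = X (p a) + X (p b) := by
  induction b, hab using Nat.le_induction with
  | base => rw [chi_self, zero_dotProduct, zmod_two_add_self]
  | succ b hb ih =>
    rw [chi_succ p hb, add_dotProduct, ih, ind_dot, cob_mk]
    generalize X (p a) = x
    generalize X (p b) = y
    generalize X (p (b + 1)) = z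
    revert x y z
    decide

theorem chi_ne_zero {p : ℕ → V} {a b : ℕ} {e : Sym2 V} (h : chi p a b e ≠ 0) :
    ∃ i, a ≤ i ∧ i < b ∧ e = s(p i, p (i + 1)) := by
  by_contra hcon
  push Not at hcon
  apply h
  rw [chi, Finset.sum_apply]
  refine Finset.sum_eq_zero fun i hi => ?_
  rw [Finset.mem_Ico] at hi
  exact ind_eq_zero (hcon i hi.1 hi.2)

theorem chi_apply {p : ℕ → V} {m a b i : ℕ} (hp : ∀ i ≤ m, ∀ j ≤ m, p i = p j → i = j)
    (hbm : b ≤ m) (hai : a ≤ i) (hib : i < b) : chi p a b s(p i, p (i + 1)) = 1 := by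
  rw [chi, Finset.sum_apply, Finset.sum_eq_single i]
  · simp
  · intro k hk hki
    rw [Finset.mem_Ico] at hk
    apply ind_eq_zero
    rw [Ne, Sym2.eq_iff]
    rintro (⟨h1, h2⟩ | ⟨h1, h2⟩)
    · exact hki (hp _ (by omega) _ (by omega) h1).symm
    · have := hp _ (by omega) _ (by omega) h1
      have := hp _ (by omega) _ (by omega) h2
      omega
  · intro hi
    exact absurd (Finset.mem_Ico.2 ⟨hai, hib⟩) hi

theorem chi_end {p : ℕ → V} {m : ℕ} (hp : ∀ i ≤ m, ∀ j ≤ m, p i = p j → i = j) (hm : 2 ≤ m) :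
    chi p 0 m s(p 0, p m) = 0 := by
  by_contra h
  obtain ⟨i, -, hi, he⟩ := chi_ne_zero h
  rw [Sym2.eq_iff] at he
  rcases he with ⟨h1, h2⟩ | ⟨h1, h2⟩
  · have := hp _ (by omega) _ (by omega) h1
    have := hp _ (by omega) _ (by omega) h2
    omega
  · have := hp _ (by omega) _ (by omega) h1
    omega

theorem isCyc_of_path {p : ℕ → V} {m : ℕ} (hp : ∀ i ≤ m, ∀ j ≤ m, p i = p j → i = j)
    (hm : 2 ≤ m) : IsCyc (chi p 0 m + ind s(p 0, p m)) (fun i => p (i % (m + 1))) (m + 1) where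
  per i := by simp
  inj i hi j hj hij := by
    simp only [Nat.mod_eq_of_lt hi, Nat.mod_eq_of_lt hj] at hij
    exact hp i (by omega) j (by omega) hij
  mem i := by
    have hlt : i % (m + 1) < m + 1 := Nat.mod_lt i (Nat.succ_pos m)
    by_cases him : i % (m + 1) = m
    · have : (i + 1) % (m + 1) = 0 := by rw [Nat.add_mod, him]; simp
      simp only [him, this]
      rw [Sym2.eq_swap (a := p m), Pi.add_apply, chi_end hp hm]
      simp
    · have : (i + 1) % (m + 1) = i % (m + 1) + 1 := by
        rw [Nat.add_mod, Nat.mod_eq_of_lt (b := m + 1) (a := 1) (by omega)]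
        exact Nat.mod_eq_of_lt (by omega)
      simp only [this]
      generalize i % (m + 1) = k at *
      rw [Pi.add_apply, chi_apply hp le_rfl (Nat.zero_le _) (by omega), ind_eq_zero]
      · simp
      · rw [Ne, Sym2.eq_iff]
        rintro (⟨h1, h2⟩ | ⟨h1, h2⟩)
        · have := hp _ (by omega) _ (by omega) h1
          have := hp _ (by omega) _ (by omega) h2
          omega
        · have := hp _ (by omega) _ (by omega) h1
          have := hp _ (by omega) _ (by omega) h2
          omega
  only e he := by
    by_cases h1 : chi p 0 m e = 0
    · rw [Pi.add_apply, h1, zero_add] at he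
      have : e = s(p 0, p m) := by
        by_contra hne
        exact he (ind_eq_zero hne)
      refine ⟨m, by omega, ?_⟩
      simp only [Nat.mod_self, Nat.mod_eq_of_lt (Nat.lt_succ_self m)]
      rw [this, Sym2.eq_swap]
    · obtain ⟨i, -, hi, rfl⟩ := chi_ne_zero h1
      refine ⟨i, by omega, ?_⟩
      rw [Nat.mod_eq_of_lt (by omega : i < m + 1), Nat.mod_eq_of_lt (by omega : i + 1 < m + 1)]

/-- A chord of a member cycle, presented through a path `p`, separates its two sides. -/
theorem TwoFam.crossing_path (h : TwoFam G f) {i0 : ι} {p : ℕ → V} {m : ℕ}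
    (hp : ∀ i ≤ m, ∀ j ≤ m, p i = p j → i = j) (hm : 2 ≤ m)
    (hf : f i0 = chi p 0 m + ind s(p 0, p m)) {a b c d : ℕ} (hac : a < c) (hcb : c < b)
    (hbm : b ≤ m) (hdm : d ≤ m) (hd : d < a ∨ b < d) (hadj : G.Adj (p a) (p b)) :
    ¬ (inside G {p a, p b}ᶜ).Reachable (p c) (p d) := by
  have hc := isCyc_of_path hp hm
  rw [← hf] at hc
  have hr := hc.rotate (by omega) a
  have e : ∀ i ≤ m, p (i % (m + 1)) = p i := fun i hi => by rw [Nat.mod_eq_of_lt (by omega)]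
  have key : ∀ b' d', b' < m + 1 → d' < m + 1 → 2 ≤ b' → b' < d' →
      p ((b' + a) % (m + 1)) = p b → p ((d' + a) % (m + 1)) = p d → c - a < b' →
      ¬ (inside G {p a, p b}ᶜ).Reachable (p c) (p d) := by
    intro b' d' hb' hd' h2 hbd hb hd hcb
    have := h.crossing hr (j := b') h2 (by omega)
      (by simp only [zero_add]; rwa [hb, e a (by omega)]) (a := c - a) (b := d') (by omega) hcb hbd hd'
    simp only [zero_add] at this
    rwa [hb, hd, Nat.sub_add_cancel (by omega), e a (by omega), e c (by omega)] at this
  rcases hd with hd | hd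
  · refine key (b - a) (d + (m + 1) - a) (by omega) (by omega) (by omega) (by omega) ?_ ?_ (by omega)
    · rw [Nat.sub_add_cancel (by omega), e b hbm]
    · rw [Nat.sub_add_cancel (by omega), Nat.add_mod_right, e d hdm]
  · refine key (b - a) (d - a) (by omega) (by omega) (by omega) (by omega) ?_ ?_ (by omega)
    · rw [Nat.sub_add_cancel (by omega), e b hbm]
    · rw [Nat.sub_add_cancel (by omega), e d hdm]

/-- Two reachable vertices are joined by an injective sequence of adjacent vertices. -/
theorem exists_path_seq {W : Type} {K : SimpleGraph W} {u v : W} (h : K.Reachable u v) :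
    ∃ (p : ℕ → W) (m : ℕ), p 0 = u ∧ p m = v ∧ (∀ i ≤ m, ∀ j ≤ m, p i = p j → i = j) ∧
      ∀ i < m, K.Adj (p i) (p (i + 1)) := by
  classical
  obtain ⟨w, hw⟩ := h.exists_isPath
  refine ⟨w.getVert, w.length, w.getVert_zero, w.getVert_length, ?_, ?_⟩
  · intro i hi j hj hij
    exact hw.getVert_injOn hi hj hij
  · intro i hi
    exact w.adj_getVert_succ hi

end MacLane

namespace MacLane

/-- The vertex with coordinates `i`, `j` of the `n` by `n` grid. -/
def gridPt (n i j : ℕ) : Fin (n + 1) × Fin (n + 1) := (Fin.ofNat (n + 1) i, Fin.ofNat (n + 1) j)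

/-- The square grid. -/
def gridGraph (n : ℕ) : SimpleGraph (Fin (n + 1) × Fin (n + 1)) where
  Adj p q := (p.2 = q.2 ∧ ((p.1 : ℕ) + 1 = q.1 ∨ (q.1 : ℕ) + 1 = p.1)) ∨
    (p.1 = q.1 ∧ ((p.2 : ℕ) + 1 = q.2 ∨ (q.2 : ℕ) + 1 = p.2))
  symm := ⟨by
    rintro p q (⟨h1, h2⟩ | ⟨h1, h2⟩)
    · exact Or.inl ⟨h1.symm, h2.symm⟩
    · exact Or.inr ⟨h1.symm, h2.symm⟩⟩
  loopless := ⟨by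
    rintro p (⟨-, h⟩ | ⟨-, h⟩) <;> omega⟩

theorem gridPt_eq_iff {n i j i' j' : ℕ} (hi : i ≤ n) (hj : j ≤ n) (hi' : i' ≤ n) (hj' : j' ≤ n) :
    gridPt n i j = gridPt n i' j' ↔ i = i' ∧ j = j' := by
  rw [gridPt, gridPt, Prod.mk.injEq, Fin.ext_iff, Fin.ext_iff]
  simp only [Fin.ofNat_eq_cast, Fin.val_natCast]
  rw [Nat.mod_eq_of_lt (by omega), Nat.mod_eq_of_lt (by omega), Nat.mod_eq_of_lt (by omega),
    Nat.mod_eq_of_lt (by omega)]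

theorem gridPt_val {n : ℕ} (p : Fin (n + 1) × Fin (n + 1)) : gridPt n p.1 p.2 = p := by
  rw [gridPt]
  simp

theorem gridGraph_adj_right {n i j : ℕ} (hi : i < n) :
    (gridGraph n).Adj (gridPt n i j) (gridPt n (i + 1) j) := by
  refine Or.inl ⟨rfl, Or.inl ?_⟩
  simp only [gridPt, Fin.ofNat_eq_cast, Fin.val_natCast]
  rw [Nat.mod_eq_of_lt (by omega), Nat.mod_eq_of_lt (by omega)]

theorem gridGraph_adj_up {n i j : ℕ} (hj : j < n) :
    (gridGraph n).Adj (gridPt n i j) (gridPt n i (j + 1)) := by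
  refine Or.inr ⟨rfl, Or.inl ?_⟩
  simp only [gridPt, Fin.ofNat_eq_cast, Fin.val_natCast]
  rw [Nat.mod_eq_of_lt (by omega), Nat.mod_eq_of_lt (by omega)]

theorem gridGraph_edge_cases {n : ℕ} {e : Sym2 (Fin (n + 1) × Fin (n + 1))}
    (he : e ∈ (gridGraph n).edgeSet) :
    (∃ i j, i < n ∧ j ≤ n ∧ e = s(gridPt n i j, gridPt n (i + 1) j)) ∨
    (∃ i j, i ≤ n ∧ j < n ∧ e = s(gridPt n i j, gridPt n i (j + 1))) := by
  induction e with
  | _ p q =>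
    have hp1 := p.1.2
    have hp2 := p.2.2
    have hq1 := q.1.2
    have hq2 := q.2.2
    rcases he with ⟨h1, h2 | h2⟩ | ⟨h1, h2 | h2⟩ <;> dsimp only at h1 h2
    · refine Or.inl ⟨p.1, p.2, by omega, by omega, ?_⟩
      conv_rhs => rw [h2, gridPt_val, h1, gridPt_val]
    · refine Or.inl ⟨q.1, q.2, by omega, by omega, ?_⟩
      conv_rhs => rw [h2, gridPt_val, ← h1, gridPt_val, Sym2.eq_swap]
    · refine Or.inr ⟨p.1, p.2, by omega, by omega, ?_⟩
      conv_rhs => rw [h2, gridPt_val, h1, gridPt_val]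
    · refine Or.inr ⟨q.1, q.2, by omega, by omega, ?_⟩
      conv_rhs => rw [h2, gridPt_val, ← h1, gridPt_val, Sym2.eq_swap]

/-- The boundary of a unit square of the grid. -/
noncomputable def gridSq (n i j : ℕ) : Sym2 (Fin (n + 1) × Fin (n + 1)) → ZMod 2 :=
  ind s(gridPt n i j, gridPt n (i + 1) j) + ind s(gridPt n i (j + 1), gridPt n (i + 1) (j + 1)) +
  ind s(gridPt n i j, gridPt n i (j + 1)) + ind s(gridPt n (i + 1) j, gridPt n (i + 1) (j + 1))

theorem gridSq_ne_zero {n i j : ℕ} {e : Sym2 (Fin (n + 1) × Fin (n + 1))}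
    (h : gridSq n i j e ≠ 0) : e = s(gridPt n i j, gridPt n (i + 1) j) ∨
      e = s(gridPt n i (j + 1), gridPt n (i + 1) (j + 1)) ∨
      e = s(gridPt n i j, gridPt n i (j + 1)) ∨
      e = s(gridPt n (i + 1) j, gridPt n (i + 1) (j + 1)) := by
  by_contra hcon
  push Not at hcon
  apply h
  simp only [gridSq, Pi.add_apply]
  rw [ind_eq_zero hcon.1, ind_eq_zero hcon.2.1, ind_eq_zero hcon.2.2.1, ind_eq_zero hcon.2.2.2]
  simp

theorem gridSq_right {n i j a b : ℕ} (hi : i < n) (hj : j < n) (ha : a < n) (hb : b ≤ n)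
    (h : gridSq n i j s(gridPt n a b, gridPt n (a + 1) b) ≠ 0) : i = a ∧ (j = b ∨ j + 1 = b) := by
  rcases gridSq_ne_zero h with h | h | h | h <;> rw [Sym2.eq_iff] at h <;>
  · rw [gridPt_eq_iff (by omega) (by omega) (by omega) (by omega),
      gridPt_eq_iff (by omega) (by omega) (by omega) (by omega),
      gridPt_eq_iff (by omega) (by omega) (by omega) (by omega),
      gridPt_eq_iff (by omega) (by omega) (by omega) (by omega)] at h
    omega

theorem gridSq_up {n i j a b : ℕ} (hi : i < n) (hj : j < n) (ha : a ≤ n) (hb : b < n)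
    (h : gridSq n i j s(gridPt n a b, gridPt n a (b + 1)) ≠ 0) : j = b ∧ (i = a ∨ i + 1 = a) := by
  rcases gridSq_ne_zero h with h | h | h | h <;> rw [Sym2.eq_iff] at h <;>
  · rw [gridPt_eq_iff (by omega) (by omega) (by omega) (by omega),
      gridPt_eq_iff (by omega) (by omega) (by omega) (by omega),
      gridPt_eq_iff (by omega) (by omega) (by omega) (by omega),
      gridPt_eq_iff (by omega) (by omega) (by omega) (by omega)] at h
    omega

theorem gridGraph_isMacLane (n : ℕ) : IsMacLane (gridGraph n) := by
  refine ⟨Fin n × Fin n, inferInstance, fun k => gridSq n k.1 k.2, ?_, ?_, ?_, ?_⟩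
  · rintro ⟨i, j⟩ e he
    have hi := i.2
    have hj := j.2
    rcases gridSq_ne_zero he with rfl | rfl | rfl | rfl
    · exact gridGraph_adj_right hi
    · exact gridGraph_adj_right hi
    · exact gridGraph_adj_up hj
    · exact gridGraph_adj_up hj
  · rintro e ⟨i1, j1⟩ ⟨i2, j2⟩ ⟨i3, j3⟩ h12 h13 h23 h1 h2 h3
    have he : e ∈ (gridGraph n).edgeSet := by
      rcases gridSq_ne_zero h1 with rfl | rfl | rfl | rfl
      · exact gridGraph_adj_right i1.2
      · exact gridGraph_adj_right i1.2
      · exact gridGraph_adj_up j1.2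
      · exact gridGraph_adj_up j1.2
    rw [Ne, Prod.mk.injEq, Fin.ext_iff, Fin.ext_iff] at h12 h13 h23
    rcases gridGraph_edge_cases he with ⟨a, b, ha, hb, rfl⟩ | ⟨a, b, ha, hb, rfl⟩
    · have := gridSq_right i1.2 j1.2 ha hb h1
      have := gridSq_right i2.2 j2.2 ha hb h2
      have := gridSq_right i3.2 j3.2 ha hb h3
      omega
    · have := gridSq_up i1.2 j1.2 ha hb h1
      have := gridSq_up i2.2 j2.2 ha hb h2
      have := gridSq_up i3.2 j3.2 ha hb h3
      omega
  · rintro ⟨i, j⟩ X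
    simp only [gridSq, add_dotProduct, ind_dot, cob_mk]
    generalize X _ = a
    generalize X _ = b
    generalize X _ = c
    generalize X _ = d
    revert a b c d
    decide
  · intro Q hQ
    set X : ℕ → ℕ → ZMod 2 := fun i j => (∑ k ∈ Finset.range i,
      Q s(gridPt n k 0, gridPt n (k + 1) 0)) +
      ∑ l ∈ Finset.range j, Q s(gridPt n i l, gridPt n i (l + 1)) with hX
    have hup : ∀ i j, X i j + X i (j + 1) = Q s(gridPt n i j, gridPt n i (j + 1)) := by
      intro i j
      simp only [hX, Finset.sum_range_succ]
      generalize (∑ k ∈ Finset.range i, Q s(gridPt n k 0, gridPt n (k + 1) 0)) = x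
      generalize (∑ l ∈ Finset.range j, Q s(gridPt n i l, gridPt n i (l + 1))) = y
      generalize Q _ = z
      revert x y z
      decide
    have hright : ∀ i, i < n → ∀ j, j ≤ n →
        X i j + X (i + 1) j = Q s(gridPt n i j, gridPt n (i + 1) j) := by
      intro i hi j
      induction j with
      | zero =>
        intro _
        simp only [hX, Finset.sum_range_succ, Finset.range_zero, Finset.sum_empty, add_zero]
        rw [← add_assoc, zmod_two_add_self, zero_add]
      | succ j ih =>
        intro hj
        have h1 := ih (by omega)
        have h2 := hup i j
        have h3 := hup (i + 1) j
        have h4 := hQ (⟨i, hi⟩, ⟨j, by omega⟩)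
        simp only [gridSq, add_dotProduct, single_one_dotProduct] at h4
        rw [← h1, ← h2, ← h3] at h4
        generalize X i j = a at *
        generalize X i (j + 1) = b at *
        generalize X (i + 1) j = c at *
        generalize X (i + 1) (j + 1) = d at *
        generalize Q s(gridPt n i (j + 1), gridPt n (i + 1) (j + 1)) = z at *
        clear h1 h2 h3 ih
        revert a b c d z
        decide
    refine ⟨fun p => X p.1 p.2, fun e he => ?_⟩
    have hv : ∀ i j, i ≤ n → j ≤ n → X (gridPt n i j).1 (gridPt n i j).2 = X i j := by
      intro i j hi hj
      simp only [gridPt, Fin.ofNat_eq_cast, Fin.val_natCast]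
      rw [Nat.mod_eq_of_lt (by omega), Nat.mod_eq_of_lt (by omega)]
    rcases gridGraph_edge_cases he with ⟨a, b, ha, hb, rfl⟩ | ⟨a, b, ha, hb, rfl⟩
    · rw [cob_mk, hv _ _ (by omega) (by omega), hv _ _ (by omega) (by omega)]
      exact (hright a ha b hb).symm
    · rw [cob_mk, hv _ _ (by omega) (by omega), hv _ _ (by omega) (by omega)]
      exact (hup a b).symm

end MacLane

namespace MacLane
set_option linter.unusedSectionVars false

/-- The position of a grid vertex in the plane. -/
noncomputable def gridPos (δ R : ℝ) {n : ℕ} (g : Fin (n + 1) × Fin (n + 1)) : ℝ × ℝ :=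
  (-R + (g.1 : ℕ) * δ, -R + (g.2 : ℕ) * δ)

/-- Grid vertices close to the set `Z`. -/
def nearGrid (δ R : ℝ) (n : ℕ) (Z : Set (ℝ × ℝ)) : Set (Fin (n + 1) × Fin (n + 1)) :=
  {g | ∃ z ∈ Z, dist (gridPos δ R g) z < 2 * δ}

theorem gridPos_dist {δ R : ℝ} {n : ℕ} {g : Fin (n + 1) × Fin (n + 1)} {z : ℝ × ℝ} {r : ℝ} :
    dist (gridPos δ R g) z < r ↔
      |-R + (g.1 : ℕ) * δ - z.1| < r ∧ |-R + (g.2 : ℕ) * δ - z.2| < r := by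
  rw [Prod.dist_eq, max_lt_iff, Real.dist_eq, Real.dist_eq]
  rfl

theorem gridPt_fst {n i j : ℕ} (hi : i ≤ n) : ((gridPt n i j).1 : ℕ) = i := by
  simp only [gridPt, Fin.ofNat_eq_cast, Fin.val_natCast]
  exact Nat.mod_eq_of_lt (by omega)

theorem gridPt_snd {n i j : ℕ} (hj : j ≤ n) : ((gridPt n i j).2 : ℕ) = j := by
  simp only [gridPt, Fin.ofNat_eq_cast, Fin.val_natCast]
  exact Nat.mod_eq_of_lt (by omega)

theorem exists_near {δ R : ℝ} (hδ : 0 < δ) {n : ℕ} (hn : 2 * R ≤ n * δ) {x : ℝ} (h1 : -R ≤ x)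
    (h2 : x ≤ R) : ∃ i ≤ n, |-R + (i : ℕ) * δ - x| < 2 * δ ∧ |-R + (i : ℕ) * δ - x| ≤ δ := by
  have h0 : 0 ≤ (x + R) / δ := div_nonneg (by linarith) hδ.le
  have e1 := (le_div_iff₀ hδ).1 (Nat.floor_le h0)
  have e2 := (div_lt_iff₀ hδ).1 (Nat.lt_floor_add_one ((x + R) / δ))
  refine ⟨⌊(x + R) / δ⌋₊, ?_, ?_, ?_⟩
  · have : (x + R) / δ ≤ n := (div_le_iff₀ hδ).2 (by linarith)
    exact_mod_cast (Nat.floor_le h0).trans this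
  · rw [abs_lt]
    constructor <;> nlinarith
  · rw [abs_le]
    constructor <;> nlinarith

theorem exists_near_pt {δ R : ℝ} (hδ : 0 < δ) {n : ℕ} (hn : 2 * R ≤ n * δ) {z : ℝ × ℝ}
    (hz : z ∈ Icc (-R) R ×ˢ Icc (-R) R) :
    ∃ g : Fin (n + 1) × Fin (n + 1), dist (gridPos δ R g) z ≤ δ := by
  obtain ⟨i, hi, -, h1⟩ := exists_near hδ hn hz.1.1 hz.1.2
  obtain ⟨j, hj, -, h2⟩ := exists_near hδ hn hz.2.1 hz.2.2
  refine ⟨gridPt n i j, ?_⟩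
  rw [Prod.dist_eq, max_le_iff, Real.dist_eq, Real.dist_eq]
  simp only [gridPos, gridPt_fst hi, gridPt_snd hj]
  exact ⟨h1, h2⟩

theorem interval_between {δ R x : ℝ} (hδ : 0 < δ) {i j k : ℕ} (h1 : i ≤ k) (h2 : k ≤ j)
    (hi : |-R + (i : ℕ) * δ - x| < 2 * δ) (hj : |-R + (j : ℕ) * δ - x| < 2 * δ) :
    |-R + (k : ℕ) * δ - x| < 2 * δ := by
  rw [abs_lt] at *
  have e1 : (i : ℝ) * δ ≤ k * δ := by gcongr
  have e2 : (k : ℝ) * δ ≤ j * δ := by gcongr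
  constructor <;> linarith

theorem box_reachable {δ R : ℝ} (hδ : 0 < δ) {n : ℕ} {z : ℝ × ℝ}
    {g g' : Fin (n + 1) × Fin (n + 1)} (hg : dist (gridPos δ R g) z < 2 * δ)
    (hg' : dist (gridPos δ R g') z < 2 * δ) :
    (inside (gridGraph n) {g | dist (gridPos δ R g) z < 2 * δ}).Reachable g g' := by
  have hmem : ∀ i j, i ≤ n → j ≤ n → |-R + (i : ℕ) * δ - z.1| < 2 * δ →
      |-R + (j : ℕ) * δ - z.2| < 2 * δ →
      gridPt n i j ∈ {g : Fin (n + 1) × Fin (n + 1) | dist (gridPos δ R g) z < 2 * δ} := by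
    intro i j hi hj h1 h2
    rw [mem_ofPred_eq, gridPos_dist, gridPt_fst hi, gridPt_snd hj]
    exact ⟨h1, h2⟩
  have hor : ∀ i i' j, i ≤ i' → i' ≤ n → j ≤ n → |-R + (i : ℕ) * δ - z.1| < 2 * δ →
      |-R + (i' : ℕ) * δ - z.1| < 2 * δ → |-R + (j : ℕ) * δ - z.2| < 2 * δ →
      (inside (gridGraph n) {g | dist (gridPos δ R g) z < 2 * δ}).Reachable
        (gridPt n i j) (gridPt n i' j) := by
    intro i i' j hii hi' hj h1 h2 h3
    exact reachable_inside (w := fun k => gridPt n k j) (a := i) (b := i')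
      (fun k _ hk => gridGraph_adj_right (by omega))
      (fun k hk hk' => hmem k j (by omega) hj (interval_between hδ hk hk' h1 h2) h3)
      i le_rfl hii i' hii le_rfl
  have ver : ∀ i j j', j ≤ j' → j' ≤ n → i ≤ n → |-R + (j : ℕ) * δ - z.2| < 2 * δ →
      |-R + (j' : ℕ) * δ - z.2| < 2 * δ → |-R + (i : ℕ) * δ - z.1| < 2 * δ →
      (inside (gridGraph n) {g | dist (gridPos δ R g) z < 2 * δ}).Reachable
        (gridPt n i j) (gridPt n i j') := by
    intro i j j' hii hi' hj h1 h2 h3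
    exact reachable_inside (w := fun k => gridPt n i k) (a := j) (b := j')
      (fun k _ hk => gridGraph_adj_up (by omega))
      (fun k hk hk' => hmem i k hj (by omega) h3 (interval_between hδ hk hk' h1 h2))
      j le_rfl hii j' hii le_rfl
  rw [gridPos_dist] at hg hg'
  have b1 := g.1.2
  have b2 := g.2.2
  have b3 := g'.1.2
  have b4 := g'.2.2
  have r1 : (inside (gridGraph n) {g | dist (gridPos δ R g) z < 2 * δ}).Reachable
      (gridPt n g.1 g.2) (gridPt n g'.1 g.2) := by
    rcases le_total (g.1 : ℕ) g'.1 with h | h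
    · exact hor _ _ _ h (by omega) (by omega) hg.1 hg'.1 hg.2
    · exact (hor _ _ _ h (by omega) (by omega) hg'.1 hg.1 hg.2).symm
  have r2 : (inside (gridGraph n) {g | dist (gridPos δ R g) z < 2 * δ}).Reachable
      (gridPt n g'.1 g.2) (gridPt n g'.1 g'.2) := by
    rcases le_total (g.2 : ℕ) g'.2 with h | h
    · exact ver _ _ _ h (by omega) (by omega) hg.2 hg'.2 hg'.1
    · exact (ver _ _ _ h (by omega) (by omega) hg'.2 hg.2 hg'.1).symm
  simpa only [gridPt_val] using r1.trans r2

theorem inside_mono {W : Type} (G : SimpleGraph W) {S T : Set W} (h : S ⊆ T) :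
    inside G S ≤ inside G T :=
  fun _ _ hpq => ⟨hpq.1, h hpq.2.1, h hpq.2.2⟩

theorem nearGrid_reachable {δ R : ℝ} (hδ : 0 < δ) {n : ℕ} (hn : 2 * R ≤ n * δ)
    {Z : Set (ℝ × ℝ)} (hZ : IsPreconnected Z) (hZR : Z ⊆ Icc (-R) R ×ˢ Icc (-R) R)
    {g g' : Fin (n + 1) × Fin (n + 1)} (hg : g ∈ nearGrid δ R n Z) (hg' : g' ∈ nearGrid δ R n Z) :
    (inside (gridGraph n) (nearGrid δ R n Z)).Reachable g g' := by
  obtain ⟨z, hz, hgz⟩ := hg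
  obtain ⟨z', hz', hgz'⟩ := hg'
  have : PreconnectedSpace Z := isPreconnected_iff_preconnectedSpace.1 hZ
  have hbox : ∀ z ∈ Z, ∀ g g' : Fin (n + 1) × Fin (n + 1), dist (gridPos δ R g) z < 2 * δ →
      dist (gridPos δ R g') z < 2 * δ →
      (inside (gridGraph n) (nearGrid δ R n Z)).Reachable g g' := by
    intro z hz g g' h h'
    exact (box_reachable hδ h h').mono (inside_mono _ fun g hg => ⟨z, hz, hg⟩)
  have hex : ∀ z : Z, ∃ g : Fin (n + 1) × Fin (n + 1), dist (gridPos δ R g) z ≤ δ :=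
    fun z => exists_near_pt hδ hn (hZR z.2)
  choose c hc using hex
  have hloc : IsLocallyConstant fun z : Z =>
      (inside (gridGraph n) (nearGrid δ R n Z)).connectedComponentMk (c z) := by
    rw [IsLocallyConstant.iff_eventually_eq]
    intro x
    filter_upwards [Metric.ball_mem_nhds x hδ] with y hy
    rw [SimpleGraph.ConnectedComponent.eq]
    refine hbox x x.2 _ _ ?_ ?_
    · have h1 := dist_triangle (gridPos δ R (c y)) y x
      have h2 := hc y
      have h3 : dist (y : ℝ × ℝ) x < δ := hy
      linarith
    · exact (hc x).trans_lt (by linarith)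
  have h1 := hloc.apply_eq_of_preconnectedSpace ⟨z, hz⟩ ⟨z', hz'⟩
  rw [SimpleGraph.ConnectedComponent.eq] at h1
  exact (hbox z hz _ _ hgz ((hc ⟨z, hz⟩).trans_lt (by linarith))).trans
    (h1.trans (hbox z' hz' _ _ ((hc ⟨z', hz'⟩).trans_lt (by linarith)) hgz'))

theorem nearGrid_nonempty {δ R : ℝ} (hδ : 0 < δ) {n : ℕ} (hn : 2 * R ≤ n * δ)
    {Z : Set (ℝ × ℝ)} (hZ : Z.Nonempty) (hZR : Z ⊆ Icc (-R) R ×ˢ Icc (-R) R) :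
    (nearGrid δ R n Z).Nonempty := by
  obtain ⟨z, hz⟩ := hZ
  obtain ⟨g, hg⟩ := exists_near_pt (n := n) hδ hn (hZR hz)
  exact ⟨g, z, hz, hg.trans_lt (by linarith)⟩

theorem nearGrid_union (δ R : ℝ) (n : ℕ) (Z Y : Set (ℝ × ℝ)) :
    nearGrid δ R n (Z ∪ Y) = nearGrid δ R n Z ∪ nearGrid δ R n Y := by
  ext g
  simp only [nearGrid, mem_ofPred_eq, mem_union]
  constructor
  · rintro ⟨z, hz | hz, h⟩
    · exact Or.inl ⟨z, hz, h⟩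
    · exact Or.inr ⟨z, hz, h⟩
  · rintro (⟨z, hz, h⟩ | ⟨z, hz, h⟩)
    · exact ⟨z, Or.inl hz, h⟩
    · exact ⟨z, Or.inr hz, h⟩

/-- Two compact disjoint sets stay apart. -/
theorem eventually_far {A B : Set (ℝ × ℝ)} (hA : IsCompact A) (hB : IsCompact B)
    (hAB : Disjoint A B) : ∀ᶠ ε in nhdsWithin (0 : ℝ) (Ioi 0),
      ∀ x ∈ A, ∀ y ∈ B, ε < dist x y := by
  obtain ⟨r, hr, h⟩ := Metric.exists_pos_forall_lt_edist hA hB.isClosed hAB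
  filter_upwards [Ioo_mem_nhdsGT (NNReal.coe_pos.2 hr)] with ε hε x hx y hy
  have h1 := h x hx y hy
  rw [edist_nndist] at h1
  have h2 : r < nndist x y := by exact_mod_cast h1
  exact hε.2.trans (by exact_mod_cast h2)

theorem nearGrid_far {δ R ε : ℝ} (hδ : 4 * δ ≤ ε) {n : ℕ} {A B : Set (ℝ × ℝ)}
    (h : ∀ x ∈ A, ∀ y ∈ B, ε < dist x y) {g : Fin (n + 1) × Fin (n + 1)}
    (hA : g ∈ nearGrid δ R n A) (hB : g ∈ nearGrid δ R n B) : False := by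
  obtain ⟨x, hx, h1⟩ := hA
  obtain ⟨y, hy, h2⟩ := hB
  have h3 := h x hx y hy
  have h4 := dist_triangle_left x y (gridPos δ R g)
  linarith

end MacLane

namespace MacLane
set_option linter.unusedSectionVars false

/-- A graph whose vertices and edges are modelled by plane continua, disjoint unless incident,
satisfies MacLane's criterion. -/
theorem isMacLane_of_continua {V : Type} [Fintype V] [DecidableEq V] {G : SimpleGraph V}
    {E : Type} [Finite E] (a b : E → V) (Z : V → Set (ℝ × ℝ)) (Y : E → Set (ℝ × ℝ))
    (hE : ∀ u v, G.Adj u v → ∃ e, s(u, v) = s(a e, b e)) (hab : ∀ e, a e ≠ b e)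
    (hZ : ∀ v, IsConnected (Z v)) (hZc : ∀ v, IsCompact (Z v))
    (hY : ∀ e, IsConnected (Y e)) (hYc : ∀ e, IsCompact (Y e))
    (hZZ : ∀ u v, u ≠ v → Disjoint (Z u) (Z v)) (hYY : ∀ e e', e ≠ e' → Disjoint (Y e) (Y e'))
    (hYZ : ∀ e v, v ≠ a e → v ≠ b e → Disjoint (Y e) (Z v))
    (hYa : ∀ e, (Y e ∩ Z (a e)).Nonempty) (hYb : ∀ e, (Y e ∩ Z (b e)).Nonempty) :
    IsMacLane G := by
  classical
  obtain ⟨ε, ⟨⟨h1, h2⟩, h3⟩, hε⟩ : ∃ ε : ℝ, (((∀ u v, u ≠ v → ∀ x ∈ Z u, ∀ y ∈ Z v, ε < dist x y) ∧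
      (∀ e e', e ≠ e' → ∀ x ∈ Y e, ∀ y ∈ Y e', ε < dist x y)) ∧
      (∀ e v, v ≠ a e → v ≠ b e → ∀ x ∈ Y e, ∀ y ∈ Z v, ε < dist x y)) ∧ 0 < ε := by
    refine Filter.Eventually.exists (f := nhdsWithin (0 : ℝ) (Ioi 0)) ?_
    refine ((Filter.Eventually.and ?_ ?_).and ?_).and self_mem_nhdsWithin
    · simp only [Filter.eventually_all]
      exact fun u v huv => eventually_far (hZc u) (hZc v) (hZZ u v huv)
    · simp only [Filter.eventually_all]
      exact fun u v huv => eventually_far (hYc u) (hYc v) (hYY u v huv)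
    · simp only [Filter.eventually_all]
      exact fun e v hv hv' => eventually_far (hYc e) (hZc v) (hYZ e v hv hv')
  obtain ⟨R, hR⟩ : ∃ R : ℝ, ((⋃ v, Z v) ∪ ⋃ e, Y e) ⊆ Icc (-R) R ×ˢ Icc (-R) R := by
    have hc : IsCompact ((⋃ v, Z v) ∪ ⋃ e, Y e) :=
      (isCompact_iUnion hZc).union (isCompact_iUnion hYc)
    obtain ⟨R, hR⟩ := hc.isBounded.subset_closedBall 0
    refine ⟨R, hR.trans ?_⟩
    intro z hz
    rw [Metric.mem_closedBall, Prod.dist_eq, max_le_iff, Real.dist_eq, Real.dist_eq] at hz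
    simp only [Prod.fst_zero, Prod.snd_zero, sub_zero, abs_le] at hz
    exact ⟨hz.1, hz.2⟩
  have hZR : ∀ v, Z v ⊆ Icc (-R) R ×ˢ Icc (-R) R := fun v =>
    (subset_iUnion Z v).trans (subset_union_left.trans hR)
  have hYR : ∀ e, Y e ⊆ Icc (-R) R ×ˢ Icc (-R) R := fun e =>
    (subset_iUnion Y e).trans (subset_union_right.trans hR)
  set δ := ε / 4 with hδ
  have hδ0 : 0 < δ := by positivity
  obtain ⟨n, hn⟩ := exists_nat_ge (2 * R / δ)
  rw [div_le_iff₀ hδ0] at hn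
  have hδε : 4 * δ ≤ ε := by rw [hδ]; linarith
  set N : Set (ℝ × ℝ) → Set (Fin (n + 1) × Fin (n + 1)) := nearGrid δ R n with hN
  set S : E → Set (Fin (n + 1) × Fin (n + 1)) := fun e => N (Z (a e)) ∪ (N (Y e) \ N (Z (b e)))
    with hS
  set re : E → Set (Fin (n + 1) × Fin (n + 1)) := fun e =>
    {g | ∃ g0 ∈ N (Z (a e)), (inside (gridGraph n) (S e)).Reachable g0 g} with hre
  set Br : V → Set (Fin (n + 1) × Fin (n + 1)) := fun v =>
    N (Z v) ∪ {g | ∃ e, a e = v ∧ g ∈ re e} with hBr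
  have hreS : ∀ e, re e ⊆ S e := by
    rintro e g ⟨g0, hg0, hg⟩
    by_contra hcon
    obtain ⟨p, q, hpq, -, hq⟩ := exists_adj_of_reachable hg (Or.inl hg0) hcon
    exact hq hpq.2.2
  have dZZ : ∀ u v g, g ∈ N (Z u) → g ∈ N (Z v) → u = v := by
    intro u v g hu hv
    by_contra hne
    exact nearGrid_far hδε (h1 u v hne) hu hv
  have dYY : ∀ u v g, g ∈ N (Y u) → g ∈ N (Y v) → u = v := by
    intro u v g hu hv
    by_contra hne
    exact nearGrid_far hδε (h2 u v hne) hu hv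
  have dYZ : ∀ e v g, g ∈ N (Y e) → g ∈ N (Z v) → v = a e ∨ v = b e := by
    intro e v g hu hv
    by_contra! hne
    exact nearGrid_far hδε (h3 e v hne.1 hne.2) hu hv
  have key : ∀ v e g, g ∈ N (Z v) → g ∈ re e → v = a e := by
    intro v e g hv he
    rcases hreS e he with h | ⟨h, h'⟩
    · exact dZZ _ _ _ hv h
    · rcases dYZ _ _ _ h hv with rfl | rfl
      · rfl
      · exact (h' hv).elim
  have hBrd : ∀ u v g, g ∈ Br u → g ∈ Br v → u = v := by
    rintro u v g (hu | ⟨e, rfl, hu⟩) (hv | ⟨e', rfl, hv⟩)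
    · exact dZZ _ _ _ hu hv
    · exact key _ _ _ hu hv
    · exact (key _ _ _ hv hu).symm
    · rcases hreS e hu with h | ⟨h, h'⟩
      · exact key _ _ _ h hv
      · rcases hreS e' hv with k | ⟨k, k'⟩
        · exact (key _ _ _ k hu).symm
        · rw [dYY _ _ _ h k]
  have hr : ∃ r : Fin (n + 1) × Fin (n + 1) → Option V, ∀ g v, r g = some v ↔ g ∈ Br v := by
    refine ⟨fun g => if h : ∃ v, g ∈ Br v then some h.choose else none, fun g v => ?_⟩
    by_cases h : ∃ v, g ∈ Br v
    · simp only [dif_pos h, Option.some.injEq]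
      constructor
      · rintro rfl
        exact h.choose_spec
      · exact fun hv => hBrd _ _ _ h.choose_spec hv
    · simp only [dif_neg h]
      exact ⟨fun hh => by simp at hh, fun hv => (h ⟨v, hv⟩).elim⟩
  obtain ⟨r, hr⟩ := hr
  have hNBr : ∀ v, N (Z v) ⊆ Br v := fun v => subset_union_left
  have hfib : ∀ v, inside (gridGraph n) (Br v) ≤ fiberGraph (gridGraph n) r := by
    intro v p q hpq
    exact ⟨hpq.1, by rw [(hr p v).2 hpq.2.1, (hr q v).2 hpq.2.2]⟩
  refine (gridGraph_isMacLane n).minor r ?_ ?_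
  · intro v
    obtain ⟨g0, hg0⟩ := nearGrid_nonempty hδ0 hn (hZ v).nonempty (hZR v)
    have hreach : ∀ g ∈ Br v, (inside (gridGraph n) (Br v)).Reachable g0 g := by
      have hN' : ∀ g ∈ N (Z v), (inside (gridGraph n) (Br v)).Reachable g0 g := by
        intro g hg
        exact (nearGrid_reachable hδ0 hn (hZ v).isPreconnected (hZR v) hg0 hg).mono
          (inside_mono _ (hNBr v))
      rintro g (hg | ⟨e, rfl, g1, hg1, hg⟩)
      · exact hN' g hg
      · refine (hN' g1 hg1).trans ?_
        by_contra hcon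
        obtain ⟨p, q, hpq, hp, hq⟩ := exists_adj_of_reachable hg
          (S := {x | (inside (gridGraph n) (S e)).Reachable g1 x ∧
            (inside (gridGraph n) (Br (a e))).Reachable g1 x}) ⟨by rfl, by rfl⟩ (fun h => hcon h.2)
        have hq1 := hp.1.trans hpq.reachable
        refine hq ⟨hq1, hp.2.trans (SimpleGraph.Adj.reachable ⟨hpq.1, ?_, ?_⟩)⟩
        · exact Or.inr ⟨e, rfl, g1, hg1, hp.1⟩
        · exact Or.inr ⟨e, rfl, g1, hg1, hq1⟩
    intro x y hx hy
    rw [hr] at hx hy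
    exact ((hreach x hx).symm.trans (hreach y hy)).mono (hfib v)
  · have main : ∀ e, ∃ x y, (gridGraph n).Adj x y ∧ r x = some (a e) ∧ r y = some (b e) := by
      intro e
      obtain ⟨g0, hg0⟩ := nearGrid_nonempty hδ0 hn (hZ (a e)).nonempty (hZR (a e))
      obtain ⟨g1, hg1⟩ := nearGrid_nonempty hδ0 hn (hZ (b e)).nonempty (hZR (b e))
      obtain ⟨x, hx1, hx2⟩ := hYa e
      obtain ⟨y, hy1, hy2⟩ := hYb e
      have hU : IsPreconnected (Z (a e) ∪ Y e ∪ Z (b e)) := by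
        refine IsPreconnected.union y (Or.inr hy1) hy2 ?_ (hZ _).isPreconnected
        exact IsPreconnected.union x hx2 hx1 (hZ _).isPreconnected (hY _).isPreconnected
      have hUR : Z (a e) ∪ Y e ∪ Z (b e) ⊆ Icc (-R) R ×ˢ Icc (-R) R :=
        union_subset (union_subset (hZR _) (hYR _)) (hZR _)
      have hNU : nearGrid δ R n (Z (a e) ∪ Y e ∪ Z (b e)) = N (Z (a e)) ∪ N (Y e) ∪ N (Z (b e)) := by
        rw [nearGrid_union, nearGrid_union]
      have hreach := nearGrid_reachable (g := g0) (g' := g1) hδ0 hn hU hUR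
        (by rw [hNU]; exact Or.inl (Or.inl hg0)) (by rw [hNU]; exact Or.inr hg1)
      have hg0re : g0 ∈ re e := ⟨g0, hg0, by rfl⟩
      have hg1re : g1 ∉ re e := fun h => hab e (key _ _ _ hg1 h).symm
      obtain ⟨p, q, hpq, hp, hq⟩ := exists_adj_of_reachable hreach hg0re hg1re
      refine ⟨p, q, hpq.1, (hr _ _).2 (Or.inr ⟨e, rfl, hp⟩), (hr _ _).2 (hNBr _ ?_)⟩
      by_contra hqb
      have hqS : q ∈ S e := by
        have := hpq.2.2
        rw [hNU] at this
        rcases this with (h | h) | h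
        · exact Or.inl h
        · exact Or.inr ⟨h, hqb⟩
        · exact (hqb h).elim
      obtain ⟨g2, hg2, hg2p⟩ := hp
      exact hq ⟨g2, hg2, hg2p.trans (SimpleGraph.Adj.reachable
        ⟨hpq.1, hreS e ⟨g2, hg2, hg2p⟩, hqS⟩)⟩
    intro u v huv
    obtain ⟨e, he⟩ := hE u v huv
    obtain ⟨x, y, hxy, hx, hy⟩ := main e
    rw [Sym2.eq_iff] at he
    rcases he with ⟨rfl, rfl⟩ | ⟨rfl, rfl⟩
    · exact ⟨x, y, hxy, hx, hy⟩
    · exact ⟨y, x, hxy.symm, hy, hx⟩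

end MacLane

namespace MacLane
set_option linter.unusedSectionVars false

theorem isMacLane_of_planeEmbedding {V : Type} [Fintype V] [DecidableEq V] {G : SimpleGraph V}
    (P : PlaneEmbedding G) : IsMacLane G := by
  classical
  choose a b hs γ hγi hγr using P.arc_path
  set c : G.edgeSet → ℝ → ℝ × ℝ := fun e => (γ e).extend with hc
  have hcont : ∀ e, Continuous (c e) := fun e => (γ e).continuous_extend
  have hc0 : ∀ e, c e 0 = P.pos (a e) := fun e => (γ e).extend_zero
  have hc1 : ∀ e, c e 1 = P.pos (b e) := fun e => (γ e).extend_one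
  have hcI : ∀ e t (ht : t ∈ Icc (0 : ℝ) 1), c e t = γ e ⟨t, ht⟩ :=
    fun e t ht => (γ e).extend_apply ht
  have hinj : ∀ e, ∀ s ∈ Icc (0 : ℝ) 1, ∀ t ∈ Icc (0 : ℝ) 1, c e s = c e t → s = t := by
    intro e s hs t ht hst
    rw [hcI e s hs, hcI e t ht] at hst
    exact congrArg Subtype.val (hγi e hst)
  have harc : ∀ e, ∀ t ∈ Icc (0 : ℝ) 1, c e t ∈ P.arc e := by
    intro e t ht
    rw [hcI e t ht, ← hγr e]
    exact mem_range_self _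
  have hab : ∀ e, a e ≠ b e := by
    intro e heq
    have := G.not_isDiag_of_mem_edgeSet e.2
    rw [hs e, heq] at this
    exact this rfl
  have F1 : ∀ e, ∀ t ∈ Icc (0 : ℝ) 1, ∀ w, c e t = P.pos w →
      (w = a e ∧ t = 0) ∨ (w = b e ∧ t = 1) := by
    intro e t ht w h
    have h1 : w ∈ (e : Sym2 V) := P.arc_avoid e w (h ▸ harc e t ht)
    rw [hs e, Sym2.mem_iff] at h1
    rcases h1 with rfl | rfl
    · exact Or.inl ⟨rfl, hinj e t ht 0 (by simp) (by rw [h, hc0])⟩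
    · exact Or.inr ⟨rfl, hinj e t ht 1 (by simp) (by rw [h, hc1])⟩
  have F2 : ∀ e e', ∀ s ∈ Icc (0 : ℝ) 1, ∀ t ∈ Icc (0 : ℝ) 1, c e s = c e' t →
      (e = e' ∧ s = t) ∨ ∃ w, c e s = P.pos w ∧ c e' t = P.pos w := by
    intro e e' s hs' t ht h
    by_cases hee : e = e'
    · subst hee
      exact Or.inl ⟨rfl, hinj e s hs' t ht h⟩
    · obtain ⟨w, -, -, hw⟩ := P.arc_inter e e' hee (c e s) ⟨harc e s hs', h ▸ harc e' t ht⟩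
      exact Or.inr ⟨w, hw, h ▸ hw⟩
  have i1 : ∀ t : ℝ, t ∈ Icc (0 : ℝ) (1 / 2) → t ∈ Icc (0 : ℝ) 1 :=
    fun t ht => ⟨ht.1, by linarith [ht.2]⟩
  have i2 : ∀ t : ℝ, t ∈ Icc (2 / 3 : ℝ) 1 → t ∈ Icc (0 : ℝ) 1 :=
    fun t ht => ⟨by linarith [ht.1], ht.2⟩
  have i3 : ∀ t : ℝ, t ∈ Icc (1 / 2 : ℝ) (2 / 3) → t ∈ Icc (0 : ℝ) 1 :=
    fun t ht => ⟨by linarith [ht.1], by linarith [ht.2]⟩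
  set Z : V → Set (ℝ × ℝ) := fun v => ({P.pos v} ∪ ⋃ e, ⋃ (_ : a e = v), c e '' Icc 0 (1 / 2)) ∪
    ⋃ e, ⋃ (_ : b e = v), c e '' Icc (2 / 3) 1 with hZ
  set Y : G.edgeSet → Set (ℝ × ℝ) := fun e => c e '' Icc (1 / 2) (2 / 3) with hY
  have memZ : ∀ v x, x ∈ Z v → x = P.pos v ∨ ∃ e, ∃ t ∈ Icc (0 : ℝ) 1, x = c e t ∧
      ((a e = v ∧ t ≤ 1 / 2) ∨ (b e = v ∧ 2 / 3 ≤ t)) := by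
    rintro v x ((hx | hx) | hx)
    · exact Or.inl hx
    · simp only [mem_iUnion] at hx
      obtain ⟨e, he, t, ht, rfl⟩ := hx
      exact Or.inr ⟨e, t, i1 t ht, rfl, Or.inl ⟨he, ht.2⟩⟩
    · simp only [mem_iUnion] at hx
      obtain ⟨e, he, t, ht, rfl⟩ := hx
      exact Or.inr ⟨e, t, i2 t ht, rfl, Or.inr ⟨he, ht.1⟩⟩
  have F3 : ∀ v e, ∀ t ∈ Icc (0 : ℝ) 1, ((a e = v ∧ t ≤ 1 / 2) ∨ (b e = v ∧ 2 / 3 ≤ t)) →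
      ∀ w, c e t = P.pos w → w = v := by
    intro v e t ht h w hw
    rcases F1 e t ht w hw with ⟨rfl, rfl⟩ | ⟨rfl, rfl⟩ <;> rcases h with ⟨h, h'⟩ | ⟨h, h'⟩
    · exact h
    · norm_num at h'
    · norm_num at h'
    · exact h
  have hpos : ∀ v, P.pos v ∈ Z v := fun v => Or.inl (Or.inl rfl)
  have subZ1 : ∀ e, c e '' Icc 0 (1 / 2) ⊆ Z (a e) := by
    intro e x hx
    refine Or.inl (Or.inr ?_)
    simp only [mem_iUnion]
    exact ⟨e, rfl, hx⟩
  have subZ2 : ∀ e, c e '' Icc (2 / 3) 1 ⊆ Z (b e) := by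
    intro e x hx
    refine Or.inr ?_
    simp only [mem_iUnion]
    exact ⟨e, rfl, hx⟩
  refine isMacLane_of_continua a b Z Y ?_ hab ?_ ?_ ?_ ?_ ?_ ?_ ?_ ?_ ?_
  · exact fun u v huv => ⟨⟨s(u, v), huv⟩, hs ⟨s(u, v), huv⟩⟩
  · refine fun v => ⟨⟨_, hpos v⟩, isPreconnected_of_forall (P.pos v) ?_⟩
    rintro x ((hx | hx) | hx)
    · rw [mem_singleton_iff] at hx
      subst hx
      exact ⟨{P.pos v}, by simpa using hpos v, rfl, rfl, isPreconnected_singleton⟩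
    · simp only [mem_iUnion] at hx
      obtain ⟨e, rfl, hx⟩ := hx
      exact ⟨_, subZ1 e, ⟨0, by norm_num, hc0 e⟩, hx,
        isPreconnected_Icc.image _ (hcont e).continuousOn⟩
    · simp only [mem_iUnion] at hx
      obtain ⟨e, rfl, hx⟩ := hx
      exact ⟨_, subZ2 e, ⟨1, by norm_num, hc1 e⟩, hx,
        isPreconnected_Icc.image _ (hcont e).continuousOn⟩
  · intro v
    refine (isCompact_singleton.union ?_).union ?_
    · exact isCompact_iUnion fun e => isCompact_iUnion fun _ => isCompact_Icc.image (hcont e)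
    · exact isCompact_iUnion fun e => isCompact_iUnion fun _ => isCompact_Icc.image (hcont e)
  · exact fun e => ⟨⟨_, 1 / 2, by norm_num, rfl⟩,
      isPreconnected_Icc.image _ (hcont e).continuousOn⟩
  · exact fun e => isCompact_Icc.image (hcont e)
  · intro u v huv
    rw [Set.disjoint_left]
    intro x hxu hxv
    apply huv
    rcases memZ u x hxu with h1 | ⟨e, t, ht, h1, h1'⟩ <;>
    rcases memZ v x hxv with h2 | ⟨e', t', ht', h2, h2'⟩
    · exact P.pos_inj (h1.symm.trans h2)
    · exact F3 v e' t' ht' h2' u (h2.symm.trans h1)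
    · exact (F3 u e t ht h1' v (h1.symm.trans h2)).symm
    · rcases F2 e e' t ht t' ht' (h1.symm.trans h2) with ⟨rfl, rfl⟩ | ⟨w, hw, hw'⟩
      · rcases h1' with ⟨k1, k2⟩ | ⟨k1, k2⟩ <;> rcases h2' with ⟨l1, l2⟩ | ⟨l1, l2⟩
        · exact k1.symm.trans l1
        · linarith
        · linarith
        · exact k1.symm.trans l1
      · exact (F3 u e t ht h1' w hw).symm.trans (F3 v e' t' ht' h2' w hw')
  · intro e e' hee
    rw [Set.disjoint_left]
    rintro x ⟨s, hs', rfl⟩ ⟨t, ht, hst⟩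
    rcases F2 e' e t (i3 t ht) s (i3 s hs') hst with ⟨h, -⟩ | ⟨w, hw, -⟩
    · exact hee h.symm
    · have := ht.1
      have := ht.2
      rcases F1 e' t (i3 t ht) w hw with ⟨-, h⟩ | ⟨-, h⟩ <;> linarith
  · intro e v hva hvb
    rw [Set.disjoint_left]
    rintro x ⟨s, hs', rfl⟩ hx
    have := hs'.1
    have := hs'.2
    have hnp : ∀ w, c e s ≠ P.pos w := by
      intro w hw
      rcases F1 e s (i3 s hs') w hw with ⟨-, h⟩ | ⟨-, h⟩ <;> linarith
    rcases memZ v _ hx with h | ⟨e', t, ht, h, h'⟩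
    · exact hnp v h
    · rcases F2 e e' s (i3 s hs') t ht h with ⟨rfl, -⟩ | ⟨w, hw, -⟩
      · rcases h' with ⟨h', -⟩ | ⟨h', -⟩
        · exact hva h'.symm
        · exact hvb h'.symm
      · exact hnp w hw
  · exact fun e => ⟨c e (1 / 2), ⟨_, by norm_num, rfl⟩, subZ1 e ⟨_, by norm_num, rfl⟩⟩
  · exact fun e => ⟨c e (2 / 3), ⟨_, by norm_num, rfl⟩, subZ2 e ⟨_, by norm_num, rfl⟩⟩

end MacLane

namespace MacLane
set_option linter.unusedSectionVars false

/-- `S` induces a preconnected subgraph of `T`. -/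
def Sub {ι : Type} (T : SimpleGraph ι) (S : Set ι) : Prop :=
  ∀ i ∈ S, ∀ j ∈ S, (inside T S).Reachable i j

variable {ι : Type} {T : SimpleGraph ι} {A B C S : Set ι}

theorem Sub.union (hA : Sub T A) (hB : Sub T B) {x : ι} (hxA : x ∈ A) (hxB : x ∈ B) :
    Sub T (A ∪ B) := by
  have key : ∀ i ∈ A ∪ B, (inside T (A ∪ B)).Reachable i x := by
    rintro i (hi | hi)
    · exact (hA i hi x hxA).mono (inside_mono T subset_union_left)
    · exact (hB i hi x hxB).mono (inside_mono T subset_union_right)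
  exact fun i hi j hj => (key i hi).trans (key j hj).symm

theorem not_adj_of_sub (hT : T.IsAcyclic) (hB : Sub T B) (hC : Sub T C) {x p q : ι}
    (hxB : x ∈ B) (hxC : x ∈ C) (hpB : p ∈ B) (hpC : p ∉ C) (hqC : q ∈ C) (hqB : q ∉ B) :
    ¬ T.Adj p q := by
  intro hpq
  have hbr := SimpleGraph.isAcyclic_iff_forall_adj_isBridge.mp hT hpq
  rw [SimpleGraph.isBridge_iff] at hbr
  apply hbr
  refine ((hB p hpB x hxB).mono ?_).trans ((hC x hxC q hqC).mono ?_)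
  · intro a b ⟨hab, ha, hb⟩
    rw [SimpleGraph.deleteEdges_adj]
    refine ⟨hab, ?_⟩
    rw [mem_singleton_iff, Sym2.eq_iff]
    rintro (⟨rfl, rfl⟩ | ⟨rfl, rfl⟩)
    · exact hqB hb
    · exact hqB ha
  · intro a b ⟨hab, ha, hb⟩
    rw [SimpleGraph.deleteEdges_adj]
    refine ⟨hab, ?_⟩
    rw [mem_singleton_iff, Sym2.eq_iff]
    rintro (⟨rfl, rfl⟩ | ⟨rfl, rfl⟩)
    · exact hpC ha
    · exact hpC hb

theorem Sub.inter (hT : T.IsAcyclic) (hA : Sub T A) (hB : Sub T B) : Sub T (A ∩ B) := by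
  classical
  intro i hi j hj
  obtain ⟨p, hp⟩ := (hA i hi.1 j hj.1).exists_isPath
  obtain ⟨q, hq⟩ := (hB i hi.2 j hj.2).exists_isPath
  have hAT : inside T A ≤ T := fun _ _ h => h.1
  have hBT : inside T B ≤ T := fun _ _ h => h.1
  have heq := (SimpleGraph.isAcyclic_iff_subsingleton_path.mp hT i j).elim
    ⟨p.mapLe hAT, hp.mapLe hAT⟩ ⟨q.mapLe hBT, hq.mapLe hBT⟩
  have heq' : p.mapLe hAT = q.mapLe hBT := congrArg Subtype.val heq
  have hedge : ∀ e ∈ (p.mapLe hAT).edges, e ∈ (inside T (A ∩ B)).edgeSet := by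
    intro e he
    have h1 : e ∈ (inside T A).edgeSet := by
      have he' := he
      rw [SimpleGraph.Walk.edges_mapLe_eq_edges] at he'
      exact p.edges_subset_edgeSet he'
    have h2 : e ∈ (inside T B).edgeSet := by
      have he' := he
      rw [heq', SimpleGraph.Walk.edges_mapLe_eq_edges] at he'
      exact q.edges_subset_edgeSet he'
    induction e with
    | _ a b => exact ⟨h1.1, ⟨h1.2.1, h2.2.1⟩, ⟨h1.2.2, h2.2.2⟩⟩
  exact ⟨(p.mapLe hAT).transfer _ hedge⟩

/-- Helly property for three subtrees. -/
theorem Sub.helly (hT : T.IsAcyclic) (hA : Sub T A) (hB : Sub T B) (hC : Sub T C)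
    (hAB : (A ∩ B).Nonempty) (hAC : (A ∩ C).Nonempty) (hBC : (B ∩ C).Nonempty) :
    (A ∩ B ∩ C).Nonempty := by
  by_contra hne
  rw [not_nonempty_iff_eq_empty] at hne
  have hno : ∀ i, i ∈ A → i ∈ B → i ∈ C → False := fun i h1 h2 h3 => by
    have : i ∈ A ∩ B ∩ C := ⟨⟨h1, h2⟩, h3⟩
    simp [hne] at this
  obtain ⟨x, hxB, hxC⟩ := hBC
  obtain ⟨i, hiA, hiB⟩ := hAB
  obtain ⟨j, hjA, hjC⟩ := hAC
  have hs := (hA.inter hT (hB.union hC hxB hxC)) i ⟨hiA, Or.inl hiB⟩ j ⟨hjA, Or.inr hjC⟩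
  obtain ⟨p, q, hpq, hp, hq⟩ := exists_adj_of_reachable (S := B) hs hiB
    (fun h => hno j hjA h hjC)
  obtain ⟨hadj, ⟨hpA, _⟩, ⟨hqA, hqBC⟩⟩ := hpq
  have hqC : q ∈ C := hqBC.resolve_left hq
  exact not_adj_of_sub hT hB hC hxB hxC hp (fun h => hno p hpA hp h) hqC hq hadj

variable {V : Type} {G : SimpleGraph V} {D : Decomp V}

/-- A tree decomposition of a graph, in which vertices need not be covered. -/
structure PDec (G : SimpleGraph V) (D : Decomp V) : Prop where
  edge : ∀ u v, G.Adj u v → ∃ i, u ∈ D.bag i ∧ v ∈ D.bag i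
  conn : ∀ v, Sub D.tree {i | v ∈ D.bag i}

theorem sub_iff_preconnected : Sub T S ↔ (T.induce S).Preconnected := by
  constructor
  · intro h a b
    have hr := h a a.2 b b.2
    have : ∀ c, (inside T S).Reachable a c → ∀ hc : c ∈ S, (T.induce S).Reachable a ⟨c, hc⟩ := by
      rintro c hac hc
      rw [SimpleGraph.reachable_iff_reflTransGen] at hac
      induction hac with
      | refl => exact SimpleGraph.Reachable.refl _
      | tail _ hbc ih =>
        refine (ih hbc.2.1).trans (SimpleGraph.Adj.reachable ?_)
        exact hbc.1
    exact this b hr b.2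
  · intro h i hi j hj
    obtain ⟨p⟩ := h ⟨i, hi⟩ ⟨j, hj⟩
    let g : T.induce S →g inside T S := ⟨Subtype.val, fun {a b} hab => ⟨hab, a.2, b.2⟩⟩
    exact ⟨p.map g⟩

theorem IsTreeDecomp.pDec (h : IsTreeDecomp G D) : PDec G D :=
  ⟨h.2.1, fun v => sub_iff_preconnected.mpr (h.2.2 v).preconnected⟩

theorem PDec.isTreeDecomp (h : PDec G D) (hcov : ∀ v, ∃ i, v ∈ D.bag i) : IsTreeDecomp G D := by
  refine ⟨hcov, h.edge, fun v => ?_⟩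
  obtain ⟨i, hi⟩ := hcov v
  have : Nonempty {i | v ∈ D.bag i} := ⟨⟨i, hi⟩⟩
  exact ⟨sub_iff_preconnected.mp (h.conn v)⟩

theorem PDec.mono {G' : SimpleGraph V} (h : PDec G D) (hle : G' ≤ G) : PDec G' D :=
  ⟨fun u v huv => h.edge u v (hle huv), h.conn⟩

theorem PDec.triangle (h : PDec G D) {a b c : V} (hab : G.Adj a b) (hac : G.Adj a c)
    (hbc : G.Adj b c) : ∃ i, a ∈ D.bag i ∧ b ∈ D.bag i ∧ c ∈ D.bag i := by
  obtain ⟨i, hi⟩ := Sub.helly D.isTree.isAcyclic (h.conn a) (h.conn b) (h.conn c)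
    (h.edge a b hab) (h.edge a c hac) (h.edge b c hbc)
  exact ⟨i, hi.1.1, hi.1.2, hi.2⟩

/-- If `u` and `v` share a bag and are joined by a path, some inner vertex of the path
shares a bag with both of them. -/
theorem PDec.path (h : PDec G D) {p : ℕ → V} {m : ℕ} (hm : 2 ≤ m)
    (hp : ∀ i < m, G.Adj (p i) (p (i + 1)))
    (h0 : ∃ i, p 0 ∈ D.bag i ∧ p m ∈ D.bag i) :
    ∃ l, 0 < l ∧ l < m ∧ ∃ i, p 0 ∈ D.bag i ∧ p m ∈ D.bag i ∧ p l ∈ D.bag i := by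
  have hsub : ∀ n, 1 ≤ n → n < m → Sub D.tree {i | ∃ l, 0 < l ∧ l ≤ n ∧ p l ∈ D.bag i} := by
    intro n hn
    induction n, hn using Nat.le_induction with
    | base =>
      intro _
      have : {i | ∃ l, 0 < l ∧ l ≤ 1 ∧ p l ∈ D.bag i} = {i | p 1 ∈ D.bag i} := by
        ext i
        constructor
        · rintro ⟨l, h1, h2, h3⟩
          obtain rfl : l = 1 := by omega
          exact h3
        · intro h3
          exact ⟨1, one_pos, le_rfl, h3⟩
      rw [this]
      exact h.conn _
    | succ n hn ih =>
      intro hnm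
      have : {i | ∃ l, 0 < l ∧ l ≤ n + 1 ∧ p l ∈ D.bag i} =
          {i | ∃ l, 0 < l ∧ l ≤ n ∧ p l ∈ D.bag i} ∪ {i | p (n + 1) ∈ D.bag i} := by
        ext i
        constructor
        · rintro ⟨l, h1, h2, h3⟩
          rcases Nat.lt_or_ge l (n + 1) with hl | hl
          · exact Or.inl ⟨l, h1, by omega, h3⟩
          · obtain rfl : l = n + 1 := by omega
            exact Or.inr h3
        · rintro (⟨l, h1, h2, h3⟩ | h3)
          · exact ⟨l, h1, by omega, h3⟩
          · exact ⟨n + 1, by omega, le_rfl, h3⟩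
      rw [this]
      obtain ⟨i, hi1, hi2⟩ := h.edge _ _ (hp n (by omega))
      exact (ih (by omega)).union (h.conn _) (x := i) ⟨n, by omega, le_rfl, hi1⟩ hi2
  obtain ⟨i1, hi1⟩ := h.edge _ _ (hp 0 (by omega))
  obtain ⟨i2, hi2⟩ := h.edge _ _ (hp (m - 1) (by omega))
  rw [show m - 1 + 1 = m by omega] at hi2
  obtain ⟨i, hi⟩ := Sub.helly D.isTree.isAcyclic (h.conn (p 0)) (h.conn (p m))
    (hsub (m - 1) (by omega) (by omega)) h0 ⟨i1, hi1.1, 1, one_pos, by omega, hi1.2⟩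
    ⟨i2, hi2.2, m - 1, by omega, le_rfl, hi2.1⟩
  obtain ⟨l, hl0, hlm, hl⟩ := hi.2
  exact ⟨l, hl0, by omega, i, hi.1.1, hi.1.2, hl⟩

/-- The image of a decomposition under contracting the fibres of `r`. -/
def decMinor {W : Type} (D : Decomp W) (r : W → Option V) : Decomp V :=
  ⟨D.ι, D.tree, D.isTree, fun i => {v | ∃ w ∈ D.bag i, r w = some v}⟩

theorem PDec.minor {W : Type} {G0 : SimpleGraph W} {D : Decomp W} (h : PDec G0 D)
    (r : W → Option V)
    (hconn : ∀ v a b, r a = some v → r b = some v → (fiberGraph G0 r).Reachable a b)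
    (hadj : ∀ u v, G.Adj u v → ∃ a b, G0.Adj a b ∧ r a = some u ∧ r b = some v) :
    PDec G (decMinor D r) := by
  constructor
  · intro u v huv
    obtain ⟨a, b, hab, ha, hb⟩ := hadj u v huv
    obtain ⟨i, hia, hib⟩ := h.edge a b hab
    exact ⟨i, ⟨a, hia, ha⟩, ⟨b, hib, hb⟩⟩
  · rintro v i ⟨a, hia, ha⟩ j ⟨b, hjb, hb⟩
    change (inside D.tree {i | ∃ w ∈ D.bag i, r w = some v}).Reachable i j
    have hmono : ∀ c, r c = some v → ∀ i j, c ∈ D.bag i → c ∈ D.bag j →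
        (inside D.tree {i | ∃ w ∈ D.bag i, r w = some v}).Reachable i j := by
      intro c hc i j hi hj
      exact (h.conn c i hi j hj).mono (inside_mono _ fun l hl => ⟨c, hl, hc⟩)
    have key : ∀ c, (fiberGraph G0 r).Reachable a c → r c = some v ∧ ∀ j, c ∈ D.bag j →
        (inside D.tree {i | ∃ w ∈ D.bag i, r w = some v}).Reachable i j := by
      intro c hac
      rw [SimpleGraph.reachable_iff_reflTransGen] at hac
      induction hac with
      | refl => exact ⟨ha, fun j hj => hmono a ha i j hia hj⟩
      | @tail b' c' _ hbc ih =>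
        have hc : r c' = some v := by rw [← hbc.2]; exact ih.1
        refine ⟨hc, fun j hj => ?_⟩
        obtain ⟨l, hl1, hl2⟩ := h.edge _ _ hbc.1
        exact (ih.2 l hl1).trans (hmono c' hc l j hl2 hj)
    exact (key b (hconn v a b ha hb)).2 j hjb

theorem decMinor_ncard {W : Type} [Finite W] (D : Decomp W) (r : W → Option V)
    (i : D.ι) : ((decMinor D r).bag i).ncard ≤ (D.bag i).ncard := by
  have hfin : (D.bag i).Finite := Set.toFinite _
  have h1 : (some '' (decMinor D r).bag i) ⊆ r '' (D.bag i) := by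
    rintro _ ⟨v, ⟨w, hw, hr⟩, rfl⟩
    exact ⟨w, hw, hr⟩
  calc ((decMinor D r).bag i).ncard = (some '' (decMinor D r).bag i).ncard :=
        (Set.ncard_image_of_injective _ (Option.some_injective V)).symm
    _ ≤ (r '' (D.bag i)).ncard := Set.ncard_le_ncard h1 (hfin.image _)
    _ ≤ (D.bag i).ncard := Set.ncard_image_le hfin

theorem decMinor_cover {W : Type} {D : Decomp W} (hcov : ∀ v, ∃ i, v ∈ D.bag i) (r : W → Option V)
    {v : V} {w : W} (hw : r w = some v) : ∃ i, v ∈ (decMinor D r).bag i := by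
  obtain ⟨i, hi⟩ := hcov w
  exact ⟨i, w, hi, hw⟩

theorem isAcyclic_sum {α β : Type} {S : SimpleGraph α} {T : SimpleGraph β} (hS : S.IsAcyclic)
    (hT : T.IsAcyclic) : (S ⊕g T).IsAcyclic := by
  rw [SimpleGraph.isAcyclic_iff_forall_adj_isBridge] at *
  rintro (a | a) (b | b) hab
  · have hb := hS (v := a) (w := b) (by simpa using hab)
    rw [SimpleGraph.isBridge_iff] at *
    intro hr
    have := eq_of_reachable
      (X := Sum.elim (fun c => (S.deleteEdges {s(a, b)}).Reachable a c) (fun _ => False)) ?_ hr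
    · simp only [Sum.elim_inl, SimpleGraph.Reachable.refl, eq_iff_iff, true_iff] at this
      exact hb this
    · rintro (c | c) (d | d) hcd
      · have hcd' : (S.deleteEdges {s(a, b)}).Adj c d := by
          simp only [SimpleGraph.deleteEdges_adj, mem_singleton_iff, Sym2.eq_iff] at hcd ⊢
          simpa using hcd
        exact propext ⟨fun h => h.trans hcd'.reachable, fun h => h.trans hcd'.symm.reachable⟩
      · simp [SimpleGraph.deleteEdges_adj] at hcd
      · simp [SimpleGraph.deleteEdges_adj] at hcd
      · rfl
  · simp at hab
  · simp at hab
  · have hb := hT (v := a) (w := b) (by simpa using hab)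
    rw [SimpleGraph.isBridge_iff] at *
    intro hr
    have := eq_of_reachable
      (X := Sum.elim (fun _ => False) (fun c => (T.deleteEdges {s(a, b)}).Reachable a c)) ?_ hr
    · simp only [Sum.elim_inr, SimpleGraph.Reachable.refl, eq_iff_iff, true_iff] at this
      exact hb this
    · rintro (c | c) (d | d) hcd
      · rfl
      · simp [SimpleGraph.deleteEdges_adj] at hcd
      · simp [SimpleGraph.deleteEdges_adj] at hcd
      · have hcd' : (T.deleteEdges {s(a, b)}).Adj c d := by
          simp only [SimpleGraph.deleteEdges_adj, mem_singleton_iff, Sym2.eq_iff] at hcd ⊢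
          simpa using hcd
        exact propext ⟨fun h => h.trans hcd'.reachable, fun h => h.trans hcd'.symm.reachable⟩

theorem isTree_sum_edge {α β : Type} {S : SimpleGraph α} {T : SimpleGraph β} (hS : S.IsTree)
    (hT : T.IsTree) (a : α) (b : β) :
    ((S ⊕g T) ⊔ SimpleGraph.edge (Sum.inl a) (Sum.inr b)).IsTree :=
  ⟨SimpleGraph.Connected.sum_sup_edge hS.connected hT.connected,
    SimpleGraph.IsAcyclic.sup_edge_of_not_reachable (SimpleGraph.not_reachable_sum_inl_inr a b)
      (isAcyclic_sum hS.isAcyclic hT.isAcyclic)⟩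

/-- Joining two decompositions by an edge. -/
def decJoin (D E : Decomp V) (a : D.ι) (b : E.ι) : Decomp V :=
  ⟨D.ι ⊕ E.ι, _, isTree_sum_edge D.isTree E.isTree a b, Sum.elim D.bag E.bag⟩

theorem PDec.join {H : SimpleGraph V} {E : Decomp V} (hD : PDec G D) (hE : PDec H E)
    (a : D.ι) (b : E.ι)
    (hab : ∀ v i j, v ∈ D.bag i → v ∈ E.bag j → v ∈ D.bag a ∧ v ∈ E.bag b) :
    PDec (G ⊔ H) (decJoin D E a b) := by
  constructor
  · rintro u v (huv | huv)
    · obtain ⟨i, hi⟩ := hD.edge u v huv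
      exact ⟨Sum.inl i, hi⟩
    · obtain ⟨i, hi⟩ := hE.edge u v huv
      exact ⟨Sum.inr i, hi⟩
  · intro v
    have hl : ∀ i j, v ∈ D.bag i → v ∈ D.bag j →
        (inside (decJoin D E a b).tree {i | v ∈ (decJoin D E a b).bag i}).Reachable
          (Sum.inl i) (Sum.inl j) := by
      intro i j hi hj
      obtain ⟨p⟩ := hD.conn v i hi j hj
      let g : inside D.tree {i | v ∈ D.bag i} →g
          inside (decJoin D E a b).tree {i | v ∈ (decJoin D E a b).bag i} :=
        ⟨Sum.inl, fun {c d} hcd => ⟨Or.inl hcd.1, hcd.2.1, hcd.2.2⟩⟩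
      exact ⟨p.map g⟩
    have hr : ∀ i j, v ∈ E.bag i → v ∈ E.bag j →
        (inside (decJoin D E a b).tree {i | v ∈ (decJoin D E a b).bag i}).Reachable
          (Sum.inr i) (Sum.inr j) := by
      intro i j hi hj
      obtain ⟨p⟩ := hE.conn v i hi j hj
      let g : inside E.tree {i | v ∈ E.bag i} →g
          inside (decJoin D E a b).tree {i | v ∈ (decJoin D E a b).bag i} :=
        ⟨Sum.inr, fun {c d} hcd => ⟨Or.inl hcd.1, hcd.2.1, hcd.2.2⟩⟩
      exact ⟨p.map g⟩
    have hlr : ∀ i j, v ∈ D.bag i → v ∈ E.bag j →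
        (inside (decJoin D E a b).tree {i | v ∈ (decJoin D E a b).bag i}).Reachable
          (Sum.inl i) (Sum.inr j) := by
      intro i j hi hj
      obtain ⟨h1, h2⟩ := hab v i j hi hj
      refine (hl i a hi h1).trans (SimpleGraph.Reachable.trans (SimpleGraph.Adj.reachable ?_)
        (hr b j h2 hj))
      refine ⟨Or.inr ?_, h1, h2⟩
      simp [SimpleGraph.edge_adj]
    rintro (i | i) hi (j | j) hj
    · exact hl i j hi hj
    · exact hlr i j hi hj
    · exact (hlr j i hj hi).symm
    · exact hr i j hi hj

/-- The decomposition with a single bag. -/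
def decOne (Z : Set V) : Decomp V := ⟨Unit, ⊥, SimpleGraph.IsTree.of_subsingleton, fun _ => Z⟩

theorem PDec.one {Z : Set V} (h : ∀ u v, G.Adj u v → u ∈ Z ∧ v ∈ Z) : PDec G (decOne Z) :=
  ⟨fun u v huv => ⟨(), h u v huv⟩, fun _ _ _ _ _ => SimpleGraph.Reachable.refl _⟩

/-- Gluing two decompositions along a new bag `Z`. -/
theorem PDec.glue {HA HB K : SimpleGraph V} {DA DB : Decomp V} {A B Z : Set V}
    (hA : PDec HA DA) (hB : PDec HB DB) (hbA : ∀ i, DA.bag i ⊆ A) (hbB : ∀ i, DB.bag i ⊆ B)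
    (hAB : A ∩ B ⊆ Z) {a : DA.ι} {b : DB.ι} (ha : Z ∩ A ⊆ DA.bag a) (hb : Z ∩ B ⊆ DB.bag b)
    (hK : ∀ u v, K.Adj u v → u ∈ Z ∧ v ∈ Z) {n : ℕ} (hnA : ∀ i, (DA.bag i).ncard ≤ n)
    (hnB : ∀ i, (DB.bag i).ncard ≤ n) (hnZ : Z.ncard ≤ n) :
    ∃ D, PDec (HA ⊔ HB ⊔ K) D ∧ (∀ i, (D.bag i).ncard ≤ n) ∧
      (∀ i, ∃ j, DA.bag i ⊆ D.bag j) ∧ (∀ i, ∃ j, DB.bag i ⊆ D.bag j) := by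
  have h1 : PDec (HA ⊔ K) (decJoin DA (decOne Z) a ()) := by
    refine hA.join (PDec.one hK) a () ?_
    intro v i j hi hj
    exact ⟨ha ⟨hj, hbA i hi⟩, hj⟩
  have h2 : PDec (HA ⊔ K ⊔ HB) (decJoin (decJoin DA (decOne Z) a ()) DB (Sum.inr ()) b) := by
    refine h1.join hB (Sum.inr ()) b ?_
    rintro v (i | i) j hi hj
    · have hvZ : v ∈ Z := hAB ⟨hbA i hi, hbB j hj⟩
      exact ⟨hvZ, hb ⟨hvZ, hbB j hj⟩⟩
    · exact ⟨hi, hb ⟨hi, hbB j hj⟩⟩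
  refine ⟨_, h2.mono ?_, ?_, fun i => ⟨Sum.inl (Sum.inl i), subset_rfl⟩,
    fun i => ⟨Sum.inr i, subset_rfl⟩⟩
  · rw [sup_right_comm]
  · rintro ((i | i) | i)
    · exact hnA i
    · exact hnZ
    · exact hnB i

end MacLane

namespace MacLane
set_option linter.unusedSectionVars false
variable {V : Type} [Fintype V] [DecidableEq V]
variable {G : SimpleGraph V} {ι : Type} {f : ι → Sym2 V → ZMod 2}

/-- Graphs satisfying MacLane's criterion that have a tree decomposition with bags of size
at most `n`. -/
def Good (n : ℕ) (G : SimpleGraph V) : Prop :=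
  IsMacLane G ∧ ∃ D : Decomp V, PDec G D ∧ (∀ v, ∃ i, v ∈ D.bag i) ∧ ∀ i, (D.bag i).ncard ≤ n

/-- One side of a separation `{u, v}`, with a vertex `x` sharing a bag with `u, v` and joined
to `u` by a path that is covered at most once. -/
structure Side (n : ℕ) (K : SimpleGraph V) (A : Set V) (u v x : V) : Prop where
  inA : ∀ a b, K.Adj a b → a ∈ A ∧ b ∈ A
  hx : x ∈ A
  hu : u ∈ A
  xu : x ≠ u
  xv : x ≠ v
  fam : ∃ (ι : Type) (_ : Fintype ι) (f : ι → Sym2 V → ZMod 2) (Q : Sym2 V → ZMod 2), TwoFam K f ∧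
    (∀ i j, f i s(u, v) ≠ 0 → f j s(u, v) ≠ 0 → i = j) ∧
    (∀ e, Q e ≠ 0 → e ∈ K.edgeSet ∧ e ≠ s(u, v) ∧ ∀ i j, f i e ≠ 0 → f j e ≠ 0 → i = j) ∧
    ∀ X, Q ⬝ᵥ cob X = X u + X x
  dec : ∃ D : Decomp V, PDec K D ∧ (∀ i, D.bag i ⊆ A) ∧ (∀ w ∈ A, ∃ i, w ∈ D.bag i) ∧
    (∀ i, (D.bag i).ncard ≤ n) ∧ ∃ i, u ∈ D.bag i ∧ v ∈ D.bag i ∧ x ∈ D.bag i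

theorem Side.glue {n : ℕ} (hn : 4 ≤ n) {HA HB : SimpleGraph V} {A B : Set V} {u v x y : V}
    (hA : Side n HA A u v x) (hB : Side n HB B u v y)
    (hAB : ∀ w, w ∈ A → w ∈ B → w = u ∨ w = v) (huv : u ≠ v → HA.Adj u v ∧ HB.Adj u v)
    (hcov : ∀ w, w ∈ A ∨ w ∈ B) : Good n (HA ⊔ HB ⊔ SimpleGraph.edge x y) := by
  have hxB : x ∉ B := fun h => (hAB x hA.hx h).elim hA.xu hA.xv
  have hyA : y ∉ A := fun h => (hAB y h hB.hx).elim hB.xu hB.xv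
  constructor
  · obtain ⟨ιA, _, fA, QA, tA, cA, sA, eA⟩ := hA.fam
    obtain ⟨ιB, _, fB, QB, tB, cB, sB, eB⟩ := hB.fam
    exact tA.glue tB hAB hA.inA hB.inA huv cA cB hxB hB.hx hyA sA sB
      (fun X => (eA X).trans (add_comm _ _)) eB hA.hu hB.hu
  · obtain ⟨DA, pA, bA, covA, nA, a, hau, hav, hax⟩ := hA.dec
    obtain ⟨DB, pB, bB, covB, nB, b, hbu, hbv, hby⟩ := hB.dec
    obtain ⟨D, hD, hDn, hD1, hD2⟩ := pA.glue (K := SimpleGraph.edge x y) (Z := {u, v, x, y}) pB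
      bA bB (fun w hw => by rcases hAB w hw.1 hw.2 with h | h <;> simp [h])
      (a := a) (b := b) (by
        rintro w ⟨(rfl | rfl | rfl | rfl), hw⟩
        exacts [hau, hav, hax, (hyA hw).elim]) (by
        rintro w ⟨(rfl | rfl | rfl | rfl), hw⟩
        exacts [hbu, hbv, (hxB hw).elim, hby]) (by
        intro p q hpq
        rw [SimpleGraph.edge_adj] at hpq
        rcases hpq.1 with ⟨rfl, rfl⟩ | ⟨rfl, rfl⟩ <;> simp) nA nB (by
        refine le_trans ?_ hn
        have := Set.ncard_insert_le u {v, x, y}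
        have := Set.ncard_insert_le v {x, y}
        have := Set.ncard_insert_le x {y}
        have := Set.ncard_singleton y
        omega)
    refine ⟨D, hD, fun w => ?_, hDn⟩
    rcases hcov w with hw | hw
    · obtain ⟨i, hi⟩ := covA w hw
      obtain ⟨j, hj⟩ := hD1 i
      exact ⟨j, hj hi⟩
    · obtain ⟨i, hi⟩ := covB w hw
      obtain ⟨j, hj⟩ := hD2 i
      exact ⟨j, hj hi⟩

theorem TwoFam.puncture_edge [Fintype ι] (h : TwoFam G f) (e : Sym2 V) :
    ∃ f' : ι → Sym2 V → ZMod 2, TwoFam G f' ∧ ∀ i j, f' i e ≠ 0 → f' j e ≠ 0 → i = j := by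
  by_cases hi : ∃ i, f i e ≠ 0
  · obtain ⟨i, hi⟩ := hi
    obtain ⟨f', hf', hc⟩ := h.puncture i
    exact ⟨f', hf', hc e hi⟩
  · push Not at hi
    exact ⟨f, h, fun i j h1 => (h1 (hi i)).elim⟩

/-- Minors of good graphs, with bags in the vertex set of the minor. -/
theorem Good.minor {n : ℕ} (h : Good n G) {K : SimpleGraph V} {A : Set V} [Nonempty V]
    (r : V → Option V)
    (hconn : ∀ v a b, r a = some v → r b = some v → (fiberGraph G r).Reachable a b)
    (hadj : ∀ u v, K.Adj u v → ∃ a b, G.Adj a b ∧ r a = some u ∧ r b = some v)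
    (hA : ∀ w ∈ A, r w = some w) (hrA : ∀ w v, r w = some v → v ∈ A) :
    IsMacLane K ∧ ∃ D : Decomp V, PDec K D ∧ (∀ i, D.bag i ⊆ A) ∧ (∀ w ∈ A, ∃ i, w ∈ D.bag i) ∧
    (∀ i, (D.bag i).ncard ≤ n) := by
  obtain ⟨hM, D, hD, hcov, hn⟩ := h
  refine ⟨hM.minor r hconn hadj, decMinor D r, hD.minor r hconn hadj, ?_, ?_, ?_⟩
  · rintro i v ⟨w, _, hw⟩
    exact hrA w v hw
  · intro w hw
    exact decMinor_cover hcov r (hA w hw)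
  · intro i
    exact (decMinor_ncard D r i).trans (hn i)

theorem Good.restrict {n : ℕ} (h : Good n G) (A : Set V) [Nonempty V] :
    IsMacLane (inside G A) ∧ ∃ D : Decomp V, PDec (inside G A) D ∧ (∀ i, D.bag i ⊆ A) ∧
    (∀ w ∈ A, ∃ i, w ∈ D.bag i) ∧ (∀ i, (D.bag i).ncard ≤ n) := by
  classical
  refine h.minor (fun w => if w ∈ A then some w else none) ?_ ?_ ?_ ?_
  · intro v a b ha hb
    have ha' : a = v := by
      by_cases h' : a ∈ A <;> simp_all
    have hb' : b = v := by
      by_cases h' : b ∈ A <;> simp_all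
    rw [ha', hb']
  · intro u v huv
    exact ⟨u, v, huv.1, by simp [huv.2.1], by simp [huv.2.2]⟩
  · intro w hw
    simp [hw]
  · intro w v hw
    by_cases h' : w ∈ A <;> simp_all

theorem Good.side_one {n : ℕ} (h : Good n G) {A : Set V} {s x : V} (hs : s ∈ A) (hx : x ∈ A)
    (hsx : G.Adj s x) : Side n (inside G A) A s s x := by
  have : Nonempty V := ⟨s⟩
  obtain ⟨⟨ι, _, f, hf⟩, D, hD, hbA, hcov, hn⟩ := h.restrict A
  obtain ⟨f', hf', hc⟩ := hf.puncture_edge s(s, x)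
  have hloop : ∀ i, f' i s(s, s) = 0 := by
    intro i
    by_contra hne
    exact (inside G A).loopless.irrefl _ (hf'.supp i _ hne)
  refine ⟨fun a b hab => hab.2, hx, hs, hsx.ne', hsx.ne', ⟨ι, ‹_›, f', ind s(s, x), hf', ?_, ?_, ?_⟩,
    D, hD, hbA, hcov, hn, ?_⟩
  · intro i j hi
    exact (hi (hloop i)).elim
  · intro e he
    have : e = s(s, x) := by
      by_contra hne
      exact he (ind_eq_zero hne)
    subst this
    refine ⟨⟨hsx, hs, hx⟩, ?_, hc⟩
    intro h'
    rw [Sym2.eq_iff] at h'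
    exact hsx.ne' (by tauto)
  · intro X
    rw [ind_dot, cob_mk]
  · obtain ⟨i, hi⟩ := hD.edge s x ⟨hsx, hs, hx⟩
    exact ⟨i, hi.1, hi.1, hi.2⟩

theorem TwoFam.exists_mem (h : TwoFam G f) {u v : V} (huv : G.Adj u v)
    (hr : (G.deleteEdges {s(u, v)}).Reachable u v) : ∃ i, f i s(u, v) ≠ 0 := by
  by_contra hcon
  push Not at hcon
  obtain ⟨X, hX⟩ := h.exact (ind s(u, v)) (fun i => by
    rw [dotProduct_comm, ind_dot]
    exact hcon i)
  have h1 : X u = X v := by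
    refine eq_of_reachable ?_ hr
    intro a b hab
    rw [SimpleGraph.deleteEdges_adj] at hab
    have := hX s(a, b) hab.1
    rw [ind_eq_zero hab.2, cob_mk] at this
    exact zmod_two_eq_of_add this.symm
  have h2 := hX s(u, v) huv
  rw [cob_mk, h1, zmod_two_add_self] at h2
  simp at h2

theorem Good.side_two {n : ℕ} (h : Good n G) {A Y : Set V} {u v c d : V} (hu : u ∈ A) (hv : v ∈ A)
    (huv : u ≠ v) (hY : Sub G Y) (hAY : ∀ w ∈ Y, w ∉ A) (hc : c ∈ Y) (hd : d ∈ Y)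
    (hcu : G.Adj u c) (hdv : G.Adj v d)
    (hr : ((inside G A).deleteEdges {s(u, v)}).Reachable u v) :
    ∃ x, Side n (inside G A ⊔ SimpleGraph.edge u v) A u v x := by
  classical
  have : Nonempty V := ⟨u⟩
  set K := inside G A ⊔ SimpleGraph.edge u v with hK
  have hKA : ∀ a b, K.Adj a b → a ∈ A ∧ b ∈ A := by
    rintro a b (hab | hab)
    · exact hab.2
    · rw [SimpleGraph.edge_adj] at hab
      rcases hab.1 with ⟨rfl, rfl⟩ | ⟨rfl, rfl⟩
      exacts [⟨hu, hv⟩, ⟨hv, hu⟩]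
  have hKuv : K.Adj u v := Or.inr (by simp [SimpleGraph.edge_adj, huv])
  set r : V → Option V := fun w => if w ∈ A then some w else if w ∈ Y then some u else none with hrdef
  have hrA : ∀ w ∈ A, r w = some w := fun w hw => by simp [hrdef, hw]
  have hrY : ∀ w ∈ Y, r w = some u := fun w hw => by simp [hrdef, hw, hAY w hw]
  have hrv : ∀ w z, r w = some z → z ∈ A ∧ (w = z ∨ (z = u ∧ w ∈ Y)) := by
    intro w z hw
    by_cases h1 : w ∈ A
    · rw [hrA w h1] at hw
      cases hw
      exact ⟨h1, Or.inl rfl⟩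
    · by_cases h2 : w ∈ Y
      · rw [hrY w h2] at hw
        cases hw
        exact ⟨hu, Or.inr ⟨rfl, h2⟩⟩
      · simp [hrdef, h1, h2] at hw
  have hfib : ∀ w ∈ Y, (fiberGraph G r).Reachable w u := by
    intro w hw
    refine ((hY w hw c hc).mono ?_).trans (SimpleGraph.Adj.reachable ?_)
    · intro a b hab
      exact ⟨hab.1, by rw [hrY a hab.2.1, hrY b hab.2.2]⟩
    · exact ⟨hcu.symm, by rw [hrY c hc, hrA u hu]⟩
  have hfib' : ∀ w z, r w = some z → (fiberGraph G r).Reachable w z := by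
    intro w z hw
    rcases (hrv w z hw).2 with rfl | ⟨rfl, hwY⟩
    · exact SimpleGraph.Reachable.refl _
    · exact hfib w hwY
  obtain ⟨⟨ι, _, f, hf⟩, D, hD, hbA, hcov, hn⟩ := h.minor (K := K) (A := A) r
    (fun z a b ha hb => (hfib' a z ha).trans (hfib' b z hb).symm)
    (by
      rintro a b (hab | hab)
      · exact ⟨a, b, hab.1, hrA a hab.2.1, hrA b hab.2.2⟩
      · rw [SimpleGraph.edge_adj] at hab
        rcases hab.1 with ⟨h1, h2⟩ | ⟨h1, h2⟩
        · rw [h1, h2]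
          exact ⟨d, v, hdv.symm, hrY d hd, hrA v hv⟩
        · rw [h1, h2]
          exact ⟨v, d, hdv, hrA v hv, hrY d hd⟩)
    hrA (fun w z hw => (hrv w z hw).1)
  obtain ⟨i, hi⟩ := hf.exists_mem hKuv (hr.mono (by
    intro a b hab
    rw [SimpleGraph.deleteEdges_adj] at hab ⊢
    exact ⟨Or.inl hab.1, hab.2⟩))
  obtain ⟨p, m, hp0, hpm, hinj, hadj⟩ := exists_path_seq (reachable_of_even (hf.even i) hi)
  have hadj' : ∀ j < m, f i s(p j, p (j + 1)) ≠ 0 ∧ s(p j, p (j + 1)) ≠ s(u, v) := by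
    intro j hj
    have := hadj j hj
    rw [SimpleGraph.fromEdgeSet_adj] at this
    exact this.1
  have hm : 2 ≤ m := by
    by_contra hlt
    have : m = 0 ∨ m = 1 := by omega
    rcases this with rfl | rfl
    · exact huv (hp0.symm.trans hpm)
    · refine (hadj' 0 one_pos).2 ?_
      simp only [zero_add, hp0, hpm]
  obtain ⟨l, hl0, hlm, b, hb⟩ := hD.path (p := p) hm (fun j hj => hf.supp i _ (hadj' j hj).1) (by
    rw [hp0, hpm]
    exact hD.edge u v hKuv)
  obtain ⟨f', hf', hcap⟩ := hf.puncture i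
  rw [hp0, hpm] at hb
  refine ⟨p l, hKA, hbA b hb.2.2, hu, ?_, ?_, ⟨ι, ‹_›, f', chi p 0 l, hf', hcap _ hi, ?_, ?_⟩,
    D, hD, hbA, hcov, hn, b, hb⟩
  · intro he
    have := hinj l hlm.le 0 (Nat.zero_le _) (he.trans hp0.symm)
    omega
  · intro he
    have := hinj l hlm.le m le_rfl (he.trans hpm.symm)
    omega
  · intro e he
    obtain ⟨j, _, hj, rfl⟩ := chi_ne_zero he
    have := hadj' j (by omega)
    exact ⟨hf.supp i _ this.1, this.2, hcap _ this.1⟩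
  · intro X
    rw [chi_cob p (Nat.zero_le _), hp0]

theorem sub_comp {W : Type} {G K : SimpleGraph W} (hle : K ≤ G) (c : W) :
    Sub G {w | K.Reachable c w} := by
  have key : ∀ w, K.Reachable c w → (inside G {w | K.Reachable c w}).Reachable c w := by
    intro w hw
    have hw' := hw
    rw [SimpleGraph.reachable_iff_reflTransGen] at hw'
    induction hw' with
    | refl => exact SimpleGraph.Reachable.refl _
    | @tail a b hca hab ih =>
      have hca' : K.Reachable c a := by rwa [SimpleGraph.reachable_iff_reflTransGen]
      exact (ih hca').trans (SimpleGraph.Adj.reachable ⟨hle hab, hca', hw⟩)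
  exact fun a ha b hb => (key a ha).symm.trans (key b hb)

theorem exists_adj_comp {S : Set V} {c u : V} {t : Set V} (hu : u ∈ S)
    (hS : ∀ w ∈ S, w = u ∨ w ∈ t) (hc : c ∉ S) (h : (inside G tᶜ).Reachable c u) :
    ∃ p, G.Adj u p ∧ (inside G Sᶜ).Reachable c p := by
  obtain ⟨p, q, hpq, hp, hq⟩ := exists_adj_of_reachable (S := {w | (inside G Sᶜ).Reachable c w}) h
    (SimpleGraph.Reachable.refl _) (by
      intro hr
      obtain ⟨a, b, hab, ha, hb⟩ := exists_adj_of_reachable (S := Sᶜ) hr hc (by simpa using hu)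
      exact hb hab.2.2)
  have hpS : p ∉ S := by
    intro hpS
    obtain ⟨a, b, hab, ha, hb⟩ := exists_adj_of_reachable (S := Sᶜ) hp hc (by simpa using hpS)
    exact hb hab.2.2
  have hqS : q ∈ S := by
    by_contra hqS
    exact hq (SimpleGraph.Reachable.trans hp (SimpleGraph.Adj.reachable ⟨hpq.1, hpS, hqS⟩))
  obtain rfl : q = u := (hS q hqS).resolve_right hpq.2.2
  exact ⟨p, hpq.1.symm, hp⟩

theorem reachable_inside_compl {S : Set V} {c w : V} (hc : c ∉ S)
    (h : (inside G Sᶜ).Reachable c w) : w ∉ S := by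
  intro hw
  obtain ⟨a, b, hab, ha, hb⟩ := exists_adj_of_reachable (S := Sᶜ) h hc (by simpa using hw)
  exact hb hab.2.2

variable {n : ℕ}

theorem adj_of_maximal (hG : Maximal (Good n) G) {H : SimpleGraph V} (hH : Good n H) (hle : G ≤ H)
    {x y : V} (hxy : H.Adj x y) : G.Adj x y :=
  hG.2 hH hle hxy

theorem reachable_of_maximal (hn : 4 ≤ n) (hG : Maximal (Good n) G) (x y : V) :
    G.Reachable x y := by
  by_contra hxy
  have : Nonempty V := ⟨x⟩
  have hne : x ≠ y := by
    rintro rfl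
    exact hxy (SimpleGraph.Reachable.refl _)
  set A : Set V := {w | G.Reachable x w} with hA
  obtain ⟨-, DA, pA, bA, covA, nA⟩ := hG.1.restrict A
  obtain ⟨-, DB, pB, bB, covB, nB⟩ := hG.1.restrict Aᶜ
  obtain ⟨a, ha⟩ := covA x (SimpleGraph.Reachable.refl _)
  obtain ⟨b, hb⟩ := covB y hxy
  obtain ⟨D, hD, hDn, hD1, hD2⟩ := pA.glue (K := SimpleGraph.edge x y) (Z := {x, y}) pB
    bA bB (fun w hw => (hw.2 hw.1).elim) (a := a) (b := b) (by
      rintro w ⟨(rfl | rfl), hw⟩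
      exacts [ha, (hxy hw).elim]) (by
      rintro w ⟨(rfl | rfl), hw⟩
      exacts [(hw (SimpleGraph.Reachable.refl _)).elim, hb]) (by
      intro p q hpq
      rw [SimpleGraph.edge_adj] at hpq
      rcases hpq.1 with ⟨rfl, rfl⟩ | ⟨rfl, rfl⟩ <;> simp) nA nB
    ((Set.ncard_insert_le x {y}).trans (by rw [Set.ncard_singleton]; omega))
  have hle : G ⊔ SimpleGraph.edge x y ≤ inside G A ⊔ inside G Aᶜ ⊔ SimpleGraph.edge x y := by
    refine sup_le_sup_right ?_ _
    intro p q hpq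
    by_cases hp : p ∈ A
    · exact Or.inl ⟨hpq, hp, SimpleGraph.Reachable.trans hp hpq.reachable⟩
    · exact Or.inr ⟨hpq, hp, fun hq => hp (SimpleGraph.Reachable.trans hq hpq.symm.reachable)⟩
  obtain ⟨⟨ι, _, f, hf⟩, _⟩ := hG.1
  have hgood : Good n (G ⊔ SimpleGraph.edge x y) := by
    refine ⟨⟨ι, ‹_›, f, hf.bridge hxy⟩, D, hD.mono hle, fun w => ?_, hDn⟩
    by_cases hw : w ∈ A
    · obtain ⟨i, hi⟩ := covA w hw
      obtain ⟨j, hj⟩ := hD1 i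
      exact ⟨j, hj hi⟩
    · obtain ⟨i, hi⟩ := covB w hw
      obtain ⟨j, hj⟩ := hD2 i
      exact ⟨j, hj hi⟩
  exact hxy (adj_of_maximal hG hgood le_sup_left
    (Or.inr (by simp [SimpleGraph.edge_adj, hne]))).reachable

theorem reachable_compl_singleton (hn : 4 ≤ n) (hG : Maximal (Good n) G) {s a b : V}
    (ha : a ≠ s) (hb : b ≠ s) : (inside G {s}ᶜ).Reachable a b := by
  by_contra hab
  set A' : Set V := {w | (inside G {s}ᶜ).Reachable a w} with hA'
  have hfull : ∀ c, (inside G ∅ᶜ).Reachable c s := fun c =>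
    (reachable_of_maximal hn hG c s).mono (fun p q hpq => ⟨hpq, by simp, by simp⟩)
  obtain ⟨x, hsx, hx⟩ := exists_adj_comp (S := {s}) (t := ∅) (u := s) rfl
    (fun w hw => Or.inl hw) ha (hfull a)
  obtain ⟨y, hsy, hy⟩ := exists_adj_comp (S := {s}) (t := ∅) (u := s) rfl
    (fun w hw => Or.inl hw) hb (hfull b)
  have hsA : s ∉ A' := fun h => reachable_inside_compl (S := {s}) ha h rfl
  have hyA : y ∉ A' := fun h => hab (SimpleGraph.Reachable.trans h hy.symm)
  have hgood := Side.glue hn (hG.1.side_one (A := insert s A') (mem_insert _ _)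
    (mem_insert_of_mem _ hx) hsx) (hG.1.side_one (A := A'ᶜ) hsA hyA hsy)
    (fun w h1 h2 => Or.inl (h1.resolve_right h2)) (fun h => (h rfl).elim)
    (fun w => by
      by_cases hw : w ∈ A'
      exacts [Or.inl (Or.inr hw), Or.inr hw])
  have hle : G ≤ inside G (insert s A') ⊔ inside G A'ᶜ ⊔ SimpleGraph.edge x y := by
    refine le_trans ?_ le_sup_left
    have key : ∀ p q, G.Adj p q → p ∈ A' → q ∈ insert s A' := by
      intro p q hpq hp
      by_cases hq : q = s
      · exact Or.inl hq
      · refine Or.inr (SimpleGraph.Reachable.trans hp (SimpleGraph.Adj.reachable ⟨hpq, ?_, hq⟩))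
        rintro rfl
        exact hsA hp
    intro p q hpq
    by_cases hp : p ∈ A'
    · exact Or.inl ⟨hpq, Or.inr hp, key p q hpq hp⟩
    · by_cases hq : q ∈ A'
      · exact Or.inl ⟨hpq, key q p hpq.symm hq, Or.inr hq⟩
      · exact Or.inr ⟨hpq, hp, hq⟩
  have hxy : x ≠ y := by
    rintro rfl
    exact hyA hx
  have hadj := adj_of_maximal hG hgood hle (x := x) (y := y)
    (Or.inr (by simp [SimpleGraph.edge_adj, hxy]))
  have hxs : x ≠ s := hsx.ne'
  have hys : y ≠ s := hsy.ne'
  exact hyA (SimpleGraph.Reachable.trans hx (SimpleGraph.Adj.reachable ⟨hadj, hxs, hys⟩))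

/-- A maximal good graph is three-connected. -/
theorem reachable_compl_pair (hn : 4 ≤ n) (hG : Maximal (Good n) G) {u v a b : V} (huv : u ≠ v)
    (hau : a ≠ u) (hav : a ≠ v) (hbu : b ≠ u) (hbv : b ≠ v) :
    (inside G {u, v}ᶜ).Reachable a b := by
  by_contra hab
  set A' : Set V := {w | (inside G {u, v}ᶜ).Reachable a w} with hA'
  set B' : Set V := {w | (inside G {u, v}ᶜ).Reachable b w} with hB'
  have haS : a ∉ ({u, v} : Set V) := by simp [hau, hav]
  have hbS : b ∉ ({u, v} : Set V) := by simp [hbu, hbv]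
  have hfu : ∀ c, c ∉ ({u, v} : Set V) → ∃ p, G.Adj u p ∧ (inside G {u, v}ᶜ).Reachable c p := by
    intro c hc
    refine exists_adj_comp (t := {v}) (by simp) (fun w hw => hw) hc ?_
    exact reachable_compl_singleton hn hG (fun h => hc (by simp [h])) huv
  have hfv : ∀ c, c ∉ ({u, v} : Set V) → ∃ p, G.Adj v p ∧ (inside G {u, v}ᶜ).Reachable c p := by
    intro c hc
    refine exists_adj_comp (t := {u}) (by simp) (fun w hw => hw.symm) hc ?_
    exact reachable_compl_singleton hn hG (fun h => hc (by simp [h])) huv.symm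
  have hAS : ∀ w ∈ A', w ∉ ({u, v} : Set V) := fun w hw => reachable_inside_compl haS hw
  have hBS : ∀ w ∈ B', w ∉ ({u, v} : Set V) := fun w hw => reachable_inside_compl hbS hw
  have hBA : ∀ w ∈ B', w ∉ A' := fun w hw h => hab (SimpleGraph.Reachable.trans h hw.symm)
  have hthru : ∀ (c : V) (A : Set V) (p q : V), c ∉ ({u, v} : Set V) → u ∈ A → v ∈ A →
      (∀ w, (inside G {u, v}ᶜ).Reachable c w → w ∈ A) →
      G.Adj u p → (inside G {u, v}ᶜ).Reachable c p →
      G.Adj v q → (inside G {u, v}ᶜ).Reachable c q →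
      ((inside G A).deleteEdges {s(u, v)}).Reachable u v := by
    intro c A p q hc hu hv hA hup hp hvq hq
    have hne : ∀ w, (inside G {u, v}ᶜ).Reachable c w → w ≠ u ∧ w ≠ v := by
      intro w hw
      have := reachable_inside_compl hc hw
      constructor <;> (rintro rfl; simp at this)
    have h1 : ((inside G A).deleteEdges {s(u, v)}).Reachable u p := by
      refine SimpleGraph.Adj.reachable ?_
      rw [SimpleGraph.deleteEdges_adj]
      refine ⟨⟨hup, hu, hA p hp⟩, ?_⟩
      have := hne p hp
      simp only [mem_singleton_iff, Sym2.eq_iff]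
      tauto
    have h2 : ((inside G A).deleteEdges {s(u, v)}).Reachable v q := by
      refine SimpleGraph.Adj.reachable ?_
      rw [SimpleGraph.deleteEdges_adj]
      refine ⟨⟨hvq, hv, hA q hq⟩, ?_⟩
      have := hne q hq
      simp only [mem_singleton_iff, Sym2.eq_iff]
      tauto
    have h3 : ((inside G A).deleteEdges {s(u, v)}).Reachable p q := by
      refine (sub_comp (G := G) (K := inside G {u, v}ᶜ) (fun _ _ h => h.1) c p hp q hq).mono ?_
      intro w z hwz
      rw [SimpleGraph.deleteEdges_adj]
      refine ⟨⟨hwz.1, hA w hwz.2.1, hA z hwz.2.2⟩, ?_⟩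
      have := hne w hwz.2.1
      simp only [mem_singleton_iff, Sym2.eq_iff]
      tauto
    exact h1.trans (h3.trans h2.symm)
  obtain ⟨p, hup, hp⟩ := hfu a haS
  obtain ⟨q, hvq, hq⟩ := hfv a haS
  obtain ⟨p', hup', hp'⟩ := hfu b hbS
  obtain ⟨q', hvq', hq'⟩ := hfv b hbS
  have huA : u ∉ A' := fun h => hAS u h (by simp)
  have hvA : v ∉ A' := fun h => hAS v h (by simp)
  set A : Set V := A' ∪ {u, v} with hA
  obtain ⟨x, hx⟩ := hG.1.side_two (A := A) (Y := B') (u := u) (v := v) (by simp [hA]) (by simp [hA])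
    huv (sub_comp (K := inside G {u, v}ᶜ) (fun _ _ h => h.1) b) (by
      rintro w hw (h | h)
      exacts [hBA w hw h, hBS w hw h]) hp' hq' hup' hvq'
    (hthru a A p q haS (by simp [hA]) (by simp [hA]) (fun w hw => Or.inl hw) hup hp hvq hq)
  obtain ⟨y, hy⟩ := hG.1.side_two (A := A'ᶜ) (Y := A') (u := u) (v := v) huA hvA
    huv (sub_comp (K := inside G {u, v}ᶜ) (fun _ _ h => h.1) a) (fun w hw h => h hw) hp hq hup hvq
    (hthru b A'ᶜ p' q' hbS huA hvA (fun w hw => hBA w hw) hup' hp' hvq' hq')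
  have hedge : (SimpleGraph.edge u v).Adj u v := by simp [SimpleGraph.edge_adj, huv]
  have hgood := Side.glue hn hx hy (fun w h1 h2 => h1.resolve_left h2)
    (fun _ => ⟨Or.inr hedge, Or.inr hedge⟩) (fun w => by
      by_cases hw : w ∈ A'
      exacts [Or.inl (Or.inl hw), Or.inr hw])
  have key : ∀ p q, G.Adj p q → p ∈ A' → q ∈ A := by
    intro p q hpq hp
    by_cases hq : q ∈ ({u, v} : Set V)
    · exact Or.inr hq
    · exact Or.inl (SimpleGraph.Reachable.trans hp
        (SimpleGraph.Adj.reachable ⟨hpq, hAS p hp, hq⟩))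
  have hyA : y ∉ A' := hy.hx
  have hyS : y ∉ ({u, v} : Set V) := by simp [hy.xu, hy.xv]
  have hxS : x ∉ ({u, v} : Set V) := by simp [hx.xu, hx.xv]
  have hxA : x ∈ A' := hx.hx.resolve_right hxS
  have hxy : x ≠ y := by
    rintro rfl
    exact hyA hxA
  have hadj := adj_of_maximal hG hgood (by
    refine le_trans ?_ le_sup_left
    intro p q hpq
    by_cases hp : p ∈ A'
    · exact Or.inl (Or.inl ⟨hpq, Or.inl hp, key p q hpq hp⟩)
    · by_cases hq : q ∈ A'
      · exact Or.inl (Or.inl ⟨hpq, key q p hpq.symm hq, Or.inl hq⟩)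
      · exact Or.inr (Or.inl ⟨hpq, hp, hq⟩)) (Or.inr (by simp [SimpleGraph.edge_adj, hxy]) :
      SimpleGraph.Adj _ x y)
  exact hyA (SimpleGraph.Reachable.trans hxA (SimpleGraph.Adj.reachable ⟨hadj, hxS, hyS⟩))

end MacLane

namespace MacLane
set_option linter.unusedSectionVars false
variable {V : Type} [Fintype V] [DecidableEq V]
variable {G : SimpleGraph V} {ι : Type} {f : ι → Sym2 V → ZMod 2} {n : ℕ}

/-- The indicator of the edge set of a triangle. -/
def IsTri (g : Sym2 V → ZMod 2) : Prop :=
  ∃ a b c : V, a ≠ b ∧ b ≠ c ∧ a ≠ c ∧ g = ind s(a, b) + ind s(b, c) + ind s(a, c)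

theorem IsTri.ne_zero {g : Sym2 V → ZMod 2} (h : IsTri g) : g ≠ 0 := by
  obtain ⟨a, b, c, hab, hbc, hac, rfl⟩ := h
  intro h0
  have := congrFun h0 s(a, b)
  have h1 : s(a, b) ≠ s(b, c) := by
    rw [Ne, Sym2.eq_iff]
    tauto
  have h2 : s(a, b) ≠ s(a, c) := by
    rw [Ne, Sym2.eq_iff]
    tauto
  simp [ind, h1, h2] at this

theorem cycle_no_chord (hn : 4 ≤ n) (hG : Maximal (Good n) G) {D : Decomp V} (hD : PDec G D)
    (hcov : ∀ v, ∃ i, v ∈ D.bag i) (hDn : ∀ i, (D.bag i).ncard ≤ n)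
    [Fintype ι] (h : TwoFam G f) {i0 : ι} {p : ℕ → V} {m : ℕ}
    (hp : ∀ i ≤ m, ∀ j ≤ m, p i = p j → i = j) (hm : 2 ≤ m)
    (hpf : ∀ i < m, f i0 s(p i, p (i + 1)) ≠ 0) (hcl : f i0 s(p 0, p m) ≠ 0)
    {a b c d : ℕ} (hac : a < c) (hcb : c < b)
    (hbm : b ≤ m) (hdm : d ≤ m) (hd : d < a ∨ b < d)
    (hbag : ∃ i, p a ∈ D.bag i ∧ p b ∈ D.bag i) : False := by
  classical
  have hne : p a ≠ p b := by
    intro he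
    have := hp a (by omega) b hbm he
    omega
  have hadj : G.Adj (p a) (p b) := by
    by_contra hadj
    have hgood : Good n (G ⊔ SimpleGraph.edge (p a) (p b)) := by
      refine ⟨h.chord i0 (Q := chi p a b) ?_ hne hadj (chi_cob p (by omega)), D, ⟨?_, hD.conn⟩,
        hcov, hDn⟩
      · intro e he
        obtain ⟨i, _, hi, rfl⟩ := chi_ne_zero he
        exact hpf i (by omega)
      · rintro u v (huv | huv)
        · exact hD.edge u v huv
        · rw [SimpleGraph.edge_adj] at huv
          obtain ⟨i, hi⟩ := hbag
          rcases huv.1 with ⟨rfl, rfl⟩ | ⟨rfl, rfl⟩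
          exacts [⟨i, hi⟩, ⟨i, hi.symm⟩]
    exact hadj (adj_of_maximal hG hgood le_sup_left (Or.inr (by simp [SimpleGraph.edge_adj, hne])))
  have hsplit := h.split i0 (Q := chi p 0 m + ind s(p 0, p m)) (by
    intro e he
    by_cases h1 : e = s(p 0, p m)
    · rw [h1]
      exact hcl
    · have : chi p 0 m e ≠ 0 := by simpa [ind_eq_zero h1] using he
      obtain ⟨i, _, hi, rfl⟩ := chi_ne_zero this
      exact hpf i hi) (by
    intro X
    rw [add_dotProduct, chi_cob p (Nat.zero_le _), ind_dot, cob_mk, zmod_two_add_self])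
  refine hsplit.crossing_path (i0 := none) hp hm rfl hac hcb hbm hdm hd hadj ?_
  refine reachable_compl_pair hn hG hne ?_ ?_ ?_ ?_ <;>
  · intro he
    have := hp _ (by omega) _ (by omega) he
    omega

theorem cycle_length (hn : 4 ≤ n) (hG : Maximal (Good n) G) [Fintype ι] (h : TwoFam G f)
    {i0 : ι} {p : ℕ → V} {m : ℕ}
    (hp : ∀ i ≤ m, ∀ j ≤ m, p i = p j → i = j) (hm : 2 ≤ m)
    (hpf : ∀ i < m, f i0 s(p i, p (i + 1)) ≠ 0) (hcl : f i0 s(p 0, p m) ≠ 0) : m = 2 := by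
  by_contra hm2
  obtain ⟨-, D, hD, hcov, hDn⟩ := hG.1
  obtain ⟨l, hl0, hlm, i, hi⟩ := hD.path hm (fun j hj => h.supp i0 _ (hpf j hj))
    (hD.edge _ _ (h.supp i0 _ hcl))
  rcases Nat.lt_or_ge l 2 with hl | hl
  · obtain rfl : l = 1 := by omega
    exact cycle_no_chord hn hG hD hcov hDn h hp hm hpf hcl (a := 1) (b := m) (c := 2) (d := 0)
      (by omega) (by omega) le_rfl (by omega) (Or.inl one_pos) ⟨i, hi.2.2, hi.2.1⟩
  · exact cycle_no_chord hn hG hD hcov hDn h hp hm hpf hcl (a := 0) (b := l) (c := 1) (d := m)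
      (by omega) (by omega) hlm.le le_rfl (Or.inr hlm) ⟨i, hi.1, hi.2.2⟩

theorem exists_tri_of_ne_zero (hn : 4 ≤ n) (hG : Maximal (Good n) G) [Fintype ι] (h : TwoFam G f)
    {i0 : ι} (hi : f i0 ≠ 0) :
    ∃ C, IsTri C ∧ (∀ e, C e ≠ 0 → f i0 e ≠ 0) ∧ ∀ X, C ⬝ᵥ cob X = 0 := by
  obtain ⟨e, he⟩ : ∃ e, f i0 e ≠ 0 := by
    by_contra hcon
    push Not at hcon
    exact hi (funext hcon)
  induction e with
  | _ u v =>
    have huv : G.Adj u v := h.supp i0 _ he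
    obtain ⟨p, m, hp0, hpm, hinj, hadj⟩ := exists_path_seq (reachable_of_even (h.even i0) he)
    have hadj' : ∀ j < m, f i0 s(p j, p (j + 1)) ≠ 0 ∧ s(p j, p (j + 1)) ≠ s(u, v) := by
      intro j hj
      have := hadj j hj
      rw [SimpleGraph.fromEdgeSet_adj] at this
      exact this.1
    have hm : 2 ≤ m := by
      by_contra hlt
      have : m = 0 ∨ m = 1 := by omega
      rcases this with rfl | rfl
      · exact huv.ne (hp0.symm.trans hpm)
      · refine (hadj' 0 one_pos).2 ?_
        simp only [zero_add, hp0, hpm]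
    obtain rfl := cycle_length hn hG h hinj hm (fun j hj => (hadj' j hj).1)
      (by rw [hp0, hpm]; exact he)
    have hne : ∀ i ≤ 2, ∀ j ≤ 2, i ≠ j → p i ≠ p j := fun i hi j hj hij hh =>
      hij (hinj i hi j hj hh)
    refine ⟨ind s(p 0, p 1) + ind s(p 1, p 2) + ind s(p 0, p 2), ⟨p 0, p 1, p 2,
      hne _ (by omega) _ (by omega) (by omega), hne _ (by omega) _ (by omega) (by omega),
      hne _ (by omega) _ (by omega) (by omega), rfl⟩, ?_, ?_⟩
    · intro e hne
      by_cases h1 : e = s(p 0, p 1)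
      · rw [h1]
        exact (hadj' 0 (by omega)).1
      by_cases h2 : e = s(p 1, p 2)
      · rw [h2]
        exact (hadj' 1 (by omega)).1
      by_cases h3 : e = s(p 0, p 2)
      · rw [h3, hp0, hpm]
        exact he
      · simp [ind_eq_zero h1, ind_eq_zero h2, ind_eq_zero h3] at hne
    · intro X
      simp only [add_dotProduct, ind_dot, cob_mk]
      generalize X (p 0) = x
      generalize X (p 1) = y
      generalize X (p 2) = z
      revert x y z
      decide

/-- The number of nonzero members of a family. -/
noncomputable def nzCount [Fintype ι] (f : ι → Sym2 V → ZMod 2) : ℕ :=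
  open Classical in (Finset.univ.filter fun i => f i ≠ 0).card

theorem nzCount_option [Fintype ι] {f' : Option ι → Sym2 V → ZMod 2} (h0 : f' none ≠ 0)
    (h1 : ∀ i, f i ≠ 0 → f' (some i) ≠ 0) : nzCount f + 1 ≤ nzCount f' := by
  classical
  unfold nzCount
  rw [← Finset.card_map Function.Embedding.some, ← Finset.card_insert_of_notMem (a := none)]
  · refine Finset.card_le_card ?_
    intro o ho
    simp only [Finset.mem_insert, Finset.mem_map, Finset.mem_filter, Finset.mem_univ, true_and,
      Function.Embedding.some_apply] at ho ⊢
    rcases ho with rfl | ⟨i, hi, rfl⟩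
    exacts [h0, h1 i hi]
  · simp

theorem TwoFam.nzCount_le [Nonempty V] [Fintype ι] (h : TwoFam G f) :
    nzCount f ≤ 2 * Fintype.card (Sym2 V) := by
  classical
  have hex : ∀ i, ∃ e, f i ≠ 0 → f i e ≠ 0 := by
    intro i
    by_cases hi : f i = 0
    · obtain ⟨v⟩ := ‹Nonempty V›
      exact ⟨s(v, v), fun hh => (hh hi).elim⟩
    · by_contra hcon
      push Not at hcon
      exact hi (funext fun e => (hcon e).2)
  choose g hg using hex
  unfold nzCount
  refine (Finset.card_le_mul_card_image (f := g) _ 2 ?_).trans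
    (Nat.mul_le_mul_left 2 (Finset.card_le_univ _))
  intro e _
  by_contra hlt
  push Not at hlt
  obtain ⟨a, b, c, ha, hb, hc, hab, hac, hbc⟩ := Finset.two_lt_card_iff.mp hlt
  simp only [Finset.mem_filter, Finset.mem_univ, true_and] at ha hb hc
  exact h.cap e a b c hab hac hbc (by rw [← ha.2]; exact hg a ha.1)
    (by rw [← hb.2]; exact hg b hb.1) (by rw [← hc.2]; exact hg c hc.1)

theorem exists_max_family [Nonempty V] (h : IsMacLane G) :
    ∃ (ι : Type) (_ : Fintype ι) (f : ι → Sym2 V → ZMod 2), TwoFam G f ∧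
    ∀ (ι' : Type) (_ : Fintype ι') (f' : ι' → Sym2 V → ZMod 2), TwoFam G f' →
      nzCount f' ≤ nzCount f := by
  classical
  let P : ℕ → Prop := fun k => ∃ (ι : Type) (_ : Fintype ι) (f : ι → Sym2 V → ZMod 2),
    TwoFam G f ∧ nzCount f = k
  obtain ⟨ι, _, f, hf⟩ := h
  have hP : P (nzCount f) := ⟨ι, ‹_›, f, hf, rfl⟩
  obtain ⟨ι1, i1, f1, hf1, he⟩ : P (Nat.findGreatest P (2 * Fintype.card (Sym2 V))) :=
    Nat.findGreatest_spec hf.nzCount_le hP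
  refine ⟨ι1, i1, f1, hf1, ?_⟩
  intro ι' _ f' hf'
  rw [he]
  exact Nat.le_findGreatest hf'.nzCount_le ⟨ι', ‹_›, f', hf', rfl⟩

/-- A maximal good graph is a triangulation in the sense of MacLane families. -/
theorem exists_triangle_family (hn : 4 ≤ n) (hG : Maximal (Good n) G) (hV : 3 ≤ Fintype.card V) :
    ∃ (ι : Type) (_ : Fintype ι) (f : ι → Sym2 V → ZMod 2), TwoFam G f ∧
      (∀ i, f i = 0 ∨ IsTri (f i)) ∧ ∑ i, f i = 0 ∧ ∃ i, f i ≠ 0 := by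
  classical
  have : Nonempty V := Fintype.card_pos_iff.mp (by omega)
  obtain ⟨ι, _, f, hf, hmax⟩ := exists_max_family hG.1.1
  refine ⟨ι, ‹_›, f, hf, ?_, ?_, ?_⟩
  · intro i
    by_contra hcon
    push Not at hcon
    obtain ⟨C, hC, hCf, hCe⟩ := exists_tri_of_ne_zero hn hG hf hcon.1
    have h1 := hmax _ inferInstance _ (hf.split i hCf hCe)
    have h2 := nzCount_option (f := f) (f' := fun o : Option ι => o.elim C
      (fun j => if j = i then f i + C else f j)) hC.ne_zero (by
        intro j hj
        by_cases hji : j = i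
        · simp only [Option.elim, hji, if_true]
          intro h0
          refine hcon.2 ?_
          have : f i = C := by
            funext e
            exact zmod_two_eq_of_add (congrFun h0 e)
          rw [this]
          exact hC
        · simpa [hji] using hj)
    omega
  · by_contra hcon
    have h1 := hmax _ inferInstance _ hf.addSum
    have h2 := nzCount_option (f := f) (f' := fun o : Option ι => o.elim (∑ i, f i) f) hcon
      (fun i hi => hi)
    omega
  · obtain ⟨a, b, hab⟩ := Fintype.exists_pair_of_one_lt_card (α := V) (by omega)
    obtain ⟨u, v, huv, -, -⟩ := exists_adj_of_reachable (S := {a})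
      (reachable_of_maximal hn hG a b) rfl (fun h => hab (by simpa using h.symm))
    obtain ⟨w, -, hw⟩ : ∃ w ∈ (Finset.univ : Finset V), w ∉ ({u, v} : Finset V) :=
      Finset.exists_mem_notMem_of_card_lt_card
        (lt_of_le_of_lt (Finset.card_insert_le u {v}) (by
          rw [Finset.card_singleton, Finset.card_univ]
          omega))
    simp only [Finset.mem_insert, Finset.mem_singleton, not_or] at hw
    obtain ⟨i, hi⟩ := hf.exists_mem huv (by
      refine ((reachable_compl_singleton hn hG (s := v) huv.ne hw.2).mono ?_).trans
        ((reachable_compl_singleton hn hG (s := u) hw.1 huv.ne').mono ?_)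
      all_goals
        intro p q hpq
        rw [SimpleGraph.deleteEdges_adj]
        refine ⟨hpq.1, ?_⟩
        rw [mem_singleton_iff, Sym2.eq_iff]
        have h1 := hpq.2.1
        have h2 := hpq.2.2
        simp only [mem_compl_iff, mem_singleton_iff] at h1 h2
        tauto)
    exact ⟨i, fun h0 => hi (by rw [h0]; rfl)⟩

end MacLane

namespace MacLane
set_option linter.unusedSectionVars false
variable {V : Type} [Fintype V] [DecidableEq V]
variable {G : SimpleGraph V} {ι : Type} {f : ι → Sym2 V → ZMod 2} {n : ℕ}

/-- The consecutive pairs of a sequence. -/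
def pathPairs {V : Type} (p : ℕ → V) (m : ℕ) : Set (V × V) := {e | ∃ i < m, e = (p i, p (i + 1))}

/-- `q` arises from `p` by inserting one vertex after position `a`. -/
structure Ins {V : Type} (p q : ℕ → V) (a : ℕ) : Prop where
  lo : ∀ i ≤ a, q i = p i
  hi : ∀ i, a < i → q (i + 1) = p i

section Ins
variable {p q : ℕ → V} {a m : ℕ}

theorem Ins.inj (h : Ins p q a) (hq : ∀ i ≤ m + 1, ∀ j ≤ m + 1, q i = q j → i = j) :
    ∀ i ≤ m, ∀ j ≤ m, p i = p j → i = j := by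
  intro i hi j hj hij
  rcases Nat.lt_or_ge a i with h1 | h1 <;> rcases Nat.lt_or_ge a j with h2 | h2
  · rw [← h.hi i h1, ← h.hi j h2] at hij
    have := hq _ (by omega) _ (by omega) hij
    omega
  · rw [← h.hi i h1, ← h.lo j h2] at hij
    have := hq _ (by omega) _ (by omega) hij
    omega
  · rw [← h.lo i h1, ← h.hi j h2] at hij
    have := hq _ (by omega) _ (by omega) hij
    omega
  · rw [← h.lo i h1, ← h.lo j h2] at hij
    exact hq _ (by omega) _ (by omega) hij

theorem Ins.cases (h : Ins p q a) (ham : a < m) {i : ℕ} (hi : i ≤ m + 1) :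
    i = a + 1 ∨ ∃ j ≤ m, q i = p j ∧ i = if j ≤ a then j else j + 1 := by
  rcases Nat.lt_trichotomy i (a + 1) with h1 | h1 | h1
  · exact Or.inr ⟨i, by omega, h.lo i (by omega), by rw [if_pos (by omega)]⟩
  · exact Or.inl h1
  · refine Or.inr ⟨i - 1, by omega, ?_, by rw [if_neg (by omega)]; omega⟩
    rw [← h.hi (i - 1) (by omega)]
    congr 1
    omega

theorem Ins.inj' (h : Ins p q a) (ham : a < m) (hp : ∀ i ≤ m, ∀ j ≤ m, p i = p j → i = j)
    (hv : ∀ i ≤ m, p i ≠ q (a + 1)) : ∀ i ≤ m + 1, ∀ j ≤ m + 1, q i = q j → i = j := by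
  intro i hi j hj hij
  rcases h.cases ham hi with h1 | ⟨i', hi', h1, h1'⟩ <;> rcases h.cases ham hj with h2 | ⟨j', hj', h2, h2'⟩
  · omega
  · subst h1
    exact (hv j' hj' (h2.symm.trans hij.symm)).elim
  · subst h2
    exact (hv i' hi' (h1.symm.trans hij)).elim
  · have := hp i' hi' j' hj' (h1.symm.trans (hij.trans h2))
    subst this
    rw [h1', h2']

theorem Ins.last (h : Ins p q a) (ham : a < m) : q (m + 1) = p m := h.hi m ham

theorem Ins.first (h : Ins p q a) : q 0 = p 0 := h.lo 0 (Nat.zero_le _)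

theorem Ins.at (h : Ins p q a) : q a = p a := h.lo a le_rfl

theorem Ins.after (h : Ins p q a) : q (a + 2) = p (a + 1) := h.hi (a + 1) (by omega)

theorem Ins.chi_eq (h : Ins p q a) (ham : a < m) : chi q 0 (m + 1) = chi p 0 m +
    (ind s(p a, p (a + 1)) + ind s(p a, q (a + 1)) + ind s(q (a + 1), p (a + 1))) := by
  rw [chi_split q (Nat.zero_le a) (by omega : a ≤ m + 1), chi_split q (by omega : a ≤ a + 2)
    (by omega : a + 2 ≤ m + 1), chi_succ q (by omega : a ≤ a + 1), chi_succ q le_rfl, chi_self,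
    chi_split p (Nat.zero_le a) ham.le, chi_split p (by omega : a ≤ a + 1) ham, chi_succ p le_rfl,
    chi_self, chi_congr (p := q) (q := p) (a := 0) (b := a) (fun i _ hi => h.lo i hi), h.at, h.after]
  have : chi q (a + 2) (m + 1) = chi p (a + 1) m := by
    rw [← chi_shift q (a + 1) m 1]
    exact chi_congr fun i hi _ => h.hi i (by omega)
  rw [this]
  funext e
  simp only [Pi.add_apply, Pi.zero_apply]
  generalize chi p 0 a e = x1
  generalize ind s(p a, p (a + 1)) e = x2
  generalize ind s(p a, q (a + 1)) e = x3
  generalize ind s(q (a + 1), p (a + 1)) e = x4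
  generalize chi p (a + 1) m e = x5
  revert x1 x2 x3 x4 x5
  decide

theorem Ins.pairs_up (h : Ins p q a) (ham : a < m)
    (hq : ∀ i ≤ m + 1, ∀ j ≤ m + 1, q i = q j → i = j) :
    pathPairs q (m + 1) = insert (q a, q (a + 1)) (insert (q (a + 1), q (a + 2))
      (pathPairs p m \ {(q a, q (a + 2))})) := by
  ext e
  constructor
  · rintro ⟨i, hi, rfl⟩
    rcases Nat.lt_trichotomy i a with h1 | h1 | h1
    · refine Or.inr (Or.inr ⟨⟨i, by omega, by rw [h.lo i (by omega), h.lo (i + 1) h1]⟩, ?_⟩)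
      rw [mem_singleton_iff, Prod.mk.injEq]
      rintro ⟨h2, _⟩
      have := hq _ (by omega) _ (by omega) h2
      omega
    · subst h1
      exact Or.inl rfl
    · by_cases h2 : i = a + 1
      · subst h2
        exact Or.inr (Or.inl rfl)
      · refine Or.inr (Or.inr ⟨⟨i - 1, by omega, ?_⟩, ?_⟩)
        · rw [← h.hi (i - 1) (by omega), ← h.hi (i - 1 + 1) (by omega),
            show i - 1 + 1 = i by omega]
        · rw [mem_singleton_iff, Prod.mk.injEq]
          rintro ⟨h2, _⟩
          have := hq _ (by omega) _ (by omega) h2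
          omega
  · rintro (rfl | rfl | ⟨⟨i, hi, rfl⟩, hne⟩)
    · exact ⟨a, by omega, rfl⟩
    · exact ⟨a + 1, by omega, rfl⟩
    · rcases Nat.lt_trichotomy i a with h1 | h1 | h1
      · exact ⟨i, by omega, by rw [h.lo i (by omega), h.lo (i + 1) h1]⟩
      · subst h1
        exact (hne (by rw [h.at, h.after]; rfl)).elim
      · exact ⟨i + 1, by omega, by rw [h.hi i h1, h.hi (i + 1) (by omega)]⟩

theorem Ins.pairs_over (h : Ins p q a) (ham : a < m)
    (hq : ∀ i ≤ m + 1, ∀ j ≤ m + 1, q i = q j → i = j) :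
    pathPairs p m = insert (q a, q (a + 2))
      (pathPairs q (m + 1) \ {(q a, q (a + 1)), (q (a + 1), q (a + 2))}) := by
  ext e
  constructor
  · rintro ⟨i, hi, rfl⟩
    have hne : ∀ k ≤ m, k ≠ a → k ≠ a + 1 → q k ≠ q a ∧ q k ≠ q (a + 1) := by
      intro k hk h1 h2
      exact ⟨fun hh => h1 (hq _ (by omega) _ (by omega) hh),
        fun hh => h2 (hq _ (by omega) _ (by omega) hh)⟩
    rcases Nat.lt_trichotomy i a with h1 | h1 | h1
    · refine Or.inr ⟨⟨i, by omega, by rw [h.lo i (by omega), h.lo (i + 1) h1]⟩, ?_⟩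
      rw [← h.lo i (by omega)]
      have := hne i (by omega) (by omega) (by omega)
      simp [this]
    · subst h1
      exact Or.inl (by rw [h.at, h.after])
    · refine Or.inr ⟨⟨i + 1, by omega, by rw [h.hi i h1, h.hi (i + 1) (by omega)]⟩, ?_⟩
      rw [← h.hi i h1]
      have := hne (i + 1) (by omega) (by omega) (by omega)
      simp [this]
  · rintro (rfl | ⟨⟨i, hi, rfl⟩, hne⟩)
    · exact ⟨a, ham, by rw [h.at, h.after]⟩
    · rcases Nat.lt_trichotomy i a with h1 | h1 | h1
      · exact ⟨i, by omega, by rw [h.lo i (by omega), h.lo (i + 1) h1]⟩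
      · subst h1
        exact (hne (Or.inl rfl)).elim
      · by_cases h2 : i = a + 1
        · subst h2
          exact (hne (Or.inr rfl)).elim
        · refine ⟨i - 1, by omega, ?_⟩
          rw [← h.hi (i - 1) (by omega), ← h.hi (i - 1 + 1) (by omega),
            show i - 1 + 1 = i by omega]

end Ins

/-- Near-triangulations of a disc built bottom up: `N` is the set of consecutive pairs of
the upper boundary path. -/
inductive Sweep {V : Type} : SimpleGraph V → Set V → Set (V × V) → Prop
  | base (s t : V) (hst : s ≠ t) : Sweep (SimpleGraph.edge s t) {s, t} {(s, t)}
  | up (K : SimpleGraph V) (L : Set V) (N : Set (V × V)) (p q x : V) (h : Sweep K L N)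
      (hpq : (p, q) ∈ N) (hx : x ∉ L) :
      Sweep (K ⊔ SimpleGraph.edge p x ⊔ SimpleGraph.edge x q) (insert x L)
        (insert (p, x) (insert (x, q) (N \ {(p, q)})))
  | close (K : SimpleGraph V) (L : Set V) (N : Set (V × V)) (p v q : V) (h : Sweep K L N)
      (hpv : (p, v) ∈ N) (hvq : (v, q) ∈ N) (hne : p ≠ q) (hadj : ¬ K.Adj p q) :
      Sweep (K ⊔ SimpleGraph.edge p q) L (insert (p, q) (N \ {(p, v), (v, q)}))

theorem TwoFam.eq_of_sum_ne [Fintype ι] (h : TwoFam G f) {e : Sym2 V} (he : (∑ i, f i) e ≠ 0)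
    {i j : ι} (hi : f i e ≠ 0) (hj : f j e ≠ 0) : i = j := by
  by_contra hne
  exact he (h.sum_eq_zero hne hi hj)

/-- Deleting a member together with an edge covered by no other member. -/
theorem TwoFam.remove [DecidableEq ι] (h : TwoFam G f) {i : ι} {e : Sym2 V} (hie : f i e ≠ 0)
    (huniq : ∀ j, f j e ≠ 0 → j = i) {K : SimpleGraph V} (hle : K ≤ G) (heK : e ∉ K.edgeSet)
    (hsupp : ∀ j, j ≠ i → ∀ e', f j e' ≠ 0 → e' ∈ K.edgeSet) :
    TwoFam K (Function.update f i 0) := by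
  have hup : ∀ j e', Function.update f i 0 j e' ≠ 0 → j ≠ i ∧ f j e' ≠ 0 := by
    intro j e' hne
    by_cases hj : j = i
    · subst hj
      simp at hne
    · rw [Function.update_of_ne hj] at hne
      exact ⟨hj, hne⟩
  refine ⟨?_, ?_, ?_, ?_⟩
  · intro j e' hne
    exact hsupp j (hup j e' hne).1 e' (hup j e' hne).2
  · intro e' j k l h1 h2 h3 hj hk hl
    exact h.cap e' j k l h1 h2 h3 (hup _ _ hj).2 (hup _ _ hk).2 (hup _ _ hl).2
  · intro j X
    by_cases hj : j = i
    · subst hj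
      simp
    · rw [Function.update_of_ne hj]
      exact h.even j X
  · intro g hg
    obtain ⟨X, hX⟩ := h.exact (g + (f i ⬝ᵥ g) • ind e) (by
      intro j
      rw [dotProduct_add, dotProduct_smul, dotProduct_comm (f j) (ind e), ind_dot]
      by_cases hj : j = i
      · subst hj
        rw [zmod_two_eq_one hie, smul_eq_mul, mul_one, zmod_two_add_self]
      · have h1 := hg j
        rw [Function.update_of_ne hj] at h1
        have h2 : f j e = 0 := by
          by_contra hne
          exact hj (huniq j hne)
        rw [h1, h2, smul_zero, add_zero])
    refine ⟨X, fun e' he' => ?_⟩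
    have hne : e' ≠ e := by
      rintro rfl
      exact heK he'
    have hle' : e' ∈ G.edgeSet := SimpleGraph.edgeSet_mono hle he'
    rw [← hX e' hle']
    simp [ind_eq_zero hne]

end MacLane

namespace MacLane
set_option linter.unusedSectionVars false
variable {V : Type} [Fintype V] [DecidableEq V]
variable {G : SimpleGraph V} {ι : Type} {f : ι → Sym2 V → ZMod 2} {n : ℕ}

theorem IsTri.third {g : Sym2 V → ZMod 2} (h : IsTri g) {x y : V} (hxy : g s(x, y) ≠ 0) :
    ∃ v, v ≠ x ∧ v ≠ y ∧ x ≠ y ∧ g = ind s(x, y) + ind s(x, v) + ind s(v, y) := by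
  obtain ⟨a, b, c, hab, hbc, hac, rfl⟩ := h
  have key : s(x, y) = s(a, b) ∨ s(x, y) = s(b, c) ∨ s(x, y) = s(a, c) := by
    by_contra hcon
    push Not at hcon
    obtain ⟨h1, h2, h3⟩ := hcon
    apply hxy
    simp [ind, h1, h2, h3]
  have e : ∀ u w : V, s(u, w) = s(w, u) := fun u w => Sym2.eq_swap
  rcases key with h1 | h1 | h1 <;> rw [Sym2.eq_iff] at h1 <;> rcases h1 with ⟨h2, h3⟩ | ⟨h2, h3⟩ <;>
    rw [h2, h3]
  · exact ⟨c, hac.symm, hbc.symm, hab, by rw [e c b]; abel⟩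
  · exact ⟨c, hbc.symm, hac.symm, hab.symm, by rw [e c a, e b a]⟩
  · exact ⟨a, hab, hac, hbc, by rw [e b a]; abel⟩
  · exact ⟨a, hac, hab, hbc.symm, by rw [e c b, e c a]; abel⟩
  · exact ⟨b, hab.symm, hbc, hac, by abel⟩
  · exact ⟨b, hbc, hab.symm, hac.symm, by rw [e c a, e c b, e b a]; abel⟩

/-- A plane near-triangulation of a disc, in algebraic form: the outer cycle consists of the path
`p 0, …, p m` and the edge `s(p 0, p m)`. -/
structure Disc [Fintype ι] (K : SimpleGraph V) (L : Set V) (f : ι → Sym2 V → ZMod 2)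
    (p : ℕ → V) (m : ℕ) : Prop where
  fam : TwoFam K f
  tri : ∀ i, f i = 0 ∨ IsTri (f i)
  sum : ∑ i, f i = chi p 0 m + ind s(p 0, p m)
  inj : ∀ i ≤ m, ∀ j ≤ m, p i = p j → i = j
  pos : 1 ≤ m
  adj : ∀ i < m, K.Adj (p i) (p (i + 1))
  base : K.Adj (p 0) (p m)
  uniq : ∀ i j, f i s(p 0, p m) ≠ 0 → f j s(p 0, p m) ≠ 0 → i = j
  mem : ∀ a b, K.Adj a b → a ∈ L
  conn : ∀ x, ∀ a ∈ L, ∀ b ∈ L, a ≠ x → b ≠ x → (inside K {x}ᶜ).Reachable a b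

theorem sum_update_zero [Fintype ι] [DecidableEq ι] (i : ι) :
    ∑ j, Function.update f i 0 j = ∑ j, f j + f i := by
  rw [Finset.sum_update_of_mem (Finset.mem_univ i), zero_add,
    ← Finset.add_sum_erase _ _ (Finset.mem_univ i), ← Finset.sdiff_singleton_eq_erase]
  funext e
  have key : ∀ y z : ZMod 2, y = z + y + z := by decide
  exact key _ _

namespace Disc
variable [Fintype ι] {K : SimpleGraph V} {L : Set V} {p : ℕ → V} {m : ℕ}

theorem mem_path (h : Disc K L f p m) {i : ℕ} (hi : i ≤ m) : p i ∈ L := by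
  rcases Nat.lt_or_ge i m with h1 | h1
  · exact h.mem _ _ (h.adj i h1)
  · obtain rfl : i = m := by omega
    exact h.mem _ _ h.base.symm

theorem edge_ne (h : Disc K L f p m) (hm : 2 ≤ m) {a : ℕ} (ha : a < m) :
    s(p 0, p m) ≠ s(p a, p (a + 1)) := by
  rw [Ne, Sym2.eq_iff]
  rintro (⟨h1, h2⟩ | ⟨h1, h2⟩)
  · have := h.inj _ (by omega) _ (by omega) h1
    have := h.inj _ (by omega) _ (by omega) h2
    omega
  · have := h.inj _ (by omega) _ (by omega) h1
    have := h.inj _ (by omega) _ (by omega) h2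
    omega

theorem sum_edge (h : Disc K L f p m) (hm : 2 ≤ m) {a : ℕ} (ha : a < m) :
    (∑ i, f i) s(p a, p (a + 1)) ≠ 0 := by
  rw [h.sum, Pi.add_apply, chi_apply h.inj le_rfl (Nat.zero_le a) ha,
    ind_eq_zero (h.edge_ne hm ha).symm]
  decide

theorem exists_face (h : Disc K L f p m) (hm : 2 ≤ m) {a : ℕ} (ha : a < m) :
    ∃ i v, v ≠ p a ∧ v ≠ p (a + 1) ∧
      f i = ind s(p a, p (a + 1)) + ind s(p a, v) + ind s(v, p (a + 1)) ∧
      f i s(p a, p (a + 1)) ≠ 0 ∧ K.Adj (p a) v ∧ K.Adj v (p (a + 1)) := by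
  have hs := h.sum_edge hm ha
  obtain ⟨i, hi⟩ : ∃ i, f i s(p a, p (a + 1)) ≠ 0 := by
    by_contra hcon
    push Not at hcon
    apply hs
    rw [Finset.sum_apply]
    exact Finset.sum_eq_zero fun i _ => hcon i
  have ht : IsTri (f i) := (h.tri i).resolve_left fun h0 => hi (by rw [h0]; rfl)
  obtain ⟨v, hv1, hv2, hne, hf⟩ := ht.third hi
  have h1 : s(p a, v) ≠ s(p a, p (a + 1)) := by
    rw [Ne, Sym2.eq_iff]
    tauto
  have h2 : s(p a, v) ≠ s(v, p (a + 1)) := by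
    rw [Ne, Sym2.eq_iff]
    tauto
  have h3 : s(v, p (a + 1)) ≠ s(p a, p (a + 1)) := by
    rw [Ne, Sym2.eq_iff]
    tauto
  refine ⟨i, v, hv1, hv2, hf, hi, ?_, ?_⟩
  · rw [← SimpleGraph.mem_edgeSet]
    apply h.fam.supp i
    rw [hf]
    simp [ind, h1, h2]
  · rw [← SimpleGraph.mem_edgeSet]
    apply h.fam.supp i
    rw [hf]
    simp [ind, h2.symm, h3]

theorem tri_update [DecidableEq ι] (h : Disc K L f p m) (i j : ι) :
    Function.update f i 0 j = 0 ∨ IsTri (Function.update f i 0 j) := by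
  by_cases hj : j = i
  · subst hj
    simp
  · rw [Function.update_of_ne hj]
    exact h.tri j

theorem uniq_update [DecidableEq ι] (h : Disc K L f p m) (i j k : ι)
    (hj : Function.update f i 0 j s(p 0, p m) ≠ 0)
    (hk : Function.update f i 0 k s(p 0, p m) ≠ 0) : j = k := by
  have key : ∀ j, Function.update f i 0 j s(p 0, p m) ≠ 0 → f j s(p 0, p m) ≠ 0 := by
    intro j hj
    by_cases hji : j = i
    · subst hji
      simp at hj
    · rwa [Function.update_of_ne hji] at hj
  exact h.uniq j k (key j hj) (key k hk)

theorem sweep_one (h : Disc K L f p 1) : Sweep K L (pathPairs p 1) := by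
  have hadj := h.adj 0 one_pos
  have hs : ∑ i, f i = 0 := by
    rw [h.sum, chi_succ p (Nat.zero_le 0), chi_self, zero_add]
    funext e
    exact zmod_two_add_self _
  have hno : ∀ i, f i s(p 0, p 1) = 0 := by
    intro i
    by_contra hi
    have := congrFun hs s(p 0, p 1)
    rw [Finset.sum_apply, Finset.sum_eq_single i] at this
    · exact hi this
    · intro j _ hj
      by_contra hne
      exact hj (h.uniq j i hne hi)
    · simp
  have hnr : ¬ (K.deleteEdges {s(p 0, p 1)}).Reachable (p 0) (p 1) := fun hr =>
    let ⟨i, hi⟩ := h.fam.exists_mem hadj hr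
    hi (hno i)
  have hL : ∀ x ∈ L, x = p 0 ∨ x = p 1 := by
    intro x hx
    by_contra hcon
    push Not at hcon
    apply hnr
    have h1 := h.conn (p 1) (p 0) (h.mem_path (by omega)) x hx hadj.ne hcon.2
    have h2 := h.conn (p 0) x hx (p 1) (h.mem_path le_rfl) hcon.1 hadj.ne.symm
    have key : ∀ y, y = p 0 ∨ y = p 1 → inside K {y}ᶜ ≤ K.deleteEdges {s(p 0, p 1)} := by
      intro y hy a b hab
      rw [SimpleGraph.deleteEdges_adj]
      refine ⟨hab.1, fun he => ?_⟩
      rw [mem_singleton_iff, Sym2.eq_iff] at he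
      have ha : a ≠ y := hab.2.1
      have hb : b ≠ y := hab.2.2
      rcases he with ⟨rfl, rfl⟩ | ⟨rfl, rfl⟩ <;> tauto
    exact (h1.mono (key _ (Or.inr rfl))).trans (h2.mono (key _ (Or.inl rfl)))
  have hKe : K = SimpleGraph.edge (p 0) (p 1) := by
    ext a b
    rw [SimpleGraph.edge_adj]
    constructor
    · intro hab
      have ha := hL a (h.mem _ _ hab)
      have hb := hL b (h.mem _ _ hab.symm)
      have hne := hab.ne
      refine ⟨?_, hne⟩
      rcases ha with ha | ha <;> rcases hb with hb | hb
      · exact (hne (ha.trans hb.symm)).elim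
      · exact Or.inl ⟨ha, hb⟩
      · exact Or.inr ⟨ha, hb⟩
      · exact (hne (ha.trans hb.symm)).elim
    · rintro ⟨⟨ha, hb⟩ | ⟨ha, hb⟩, -⟩
      · rw [ha, hb]
        exact hadj
      · rw [ha, hb]
        exact hadj.symm
  have hLe : L = {p 0, p 1} := by
    ext x
    constructor
    · exact hL x
    · rintro (rfl | rfl)
      · exact h.mem_path (by omega)
      · exact h.mem_path le_rfl
  have hN : pathPairs p 1 = {(p 0, p 1)} := by
    ext e
    constructor
    · rintro ⟨i, hi, rfl⟩
      obtain rfl : i = 0 := by omega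
      rfl
    · rintro rfl
      exact ⟨0, one_pos, rfl⟩
  rw [hKe, hLe, hN]
  exact Sweep.base _ _ hadj.ne

end Disc

end MacLane

namespace MacLane
set_option linter.unusedSectionVars false
variable {V : Type} [Fintype V] [DecidableEq V]
variable {G : SimpleGraph V} {ι : Type} {f : ι → Sym2 V → ZMod 2} {n : ℕ}

/-- Connectivity outside `S` is inherited along a vertex map realising each edge by a walk. -/
theorem reachable_of_map {W W' : Type} {A : SimpleGraph W} {B : SimpleGraph W'} (r : W → W')
    (h : ∀ c d, A.Adj c d → B.Reachable (r c) (r d)) {a b : W} (hab : A.Reachable a b) :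
    B.Reachable (r a) (r b) := by
  have := eq_of_reachable (K := A) (X := fun c => B.connectedComponentMk (r c))
    (fun c d hcd => SimpleGraph.ConnectedComponent.eq.2 (h c d hcd)) hab
  exact SimpleGraph.ConnectedComponent.eq.1 this

theorem exists_ins {V : Type} (p : ℕ → V) (a : ℕ) (v : V) : ∃ q, Ins p q a ∧ q (a + 1) = v := by
  refine ⟨fun j => if j ≤ a then p j else if j = a + 1 then v else p (j - 1), ⟨?_, ?_⟩, ?_⟩
  · intro i hi
    simp [hi]
  · intro i hi
    simp [show ¬ i + 1 ≤ a by omega, show i ≠ a by omega]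
  · simp

theorem exists_ins_removing {V : Type} (q : ℕ → V) (a : ℕ) : ∃ p, Ins p q a := by
  refine ⟨fun j => if j ≤ a then q j else q (j + 1), ?_, ?_⟩
  · intro i hi
    simp [hi]
  · intro i hi
    simp [show ¬ i ≤ a by omega]

namespace Disc
variable [Fintype ι] {K : SimpleGraph V} {L : Set V} {p : ℕ → V} {m : ℕ}

theorem face_unique (h : Disc K L f p m) (hm : 2 ≤ m) {a : ℕ} (ha : a < m) {i j : ι}
    (hi : f i s(p a, p (a + 1)) ≠ 0) (hj : f j s(p a, p (a + 1)) ≠ 0) : j = i :=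
  h.fam.eq_of_sum_ne (h.sum_edge hm ha) hj hi

/-- Removing a boundary edge whose triangle has its apex off the boundary path. -/
theorem remove_edge [DecidableEq ι] (h : Disc K L f p m) (hm : 2 ≤ m) {a : ℕ} (ha : a < m) {i : ι}
    {v : V} {q : ℕ → V} (hv : ∀ j ≤ m, p j ≠ v)
    (hf : f i = ind s(p a, p (a + 1)) + ind s(p a, v) + ind s(v, p (a + 1)))
    (hi : f i s(p a, p (a + 1)) ≠ 0) (hav : K.Adj (p a) v) (hva : K.Adj v (p (a + 1)))
    (hq : Ins p q a) (hqv : q (a + 1) = v) :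
    Disc (K.deleteEdges {s(p a, p (a + 1))}) L (Function.update f i 0) q (m + 1) := by
  set K' := K.deleteEdges {s(p a, p (a + 1))} with hK'
  have hqi := hq.inj' ha h.inj (by rwa [hqv])
  have hKadj : ∀ c d, K.Adj c d → s(c, d) ≠ s(p a, p (a + 1)) → K'.Adj c d := fun c d hcd hne => by
    rw [hK', SimpleGraph.deleteEdges_adj]
    exact ⟨hcd, hne⟩
  have hle : K' ≤ K := SimpleGraph.deleteEdges_le _
  have hav' : K'.Adj (p a) v := hKadj _ _ hav (by
    rw [Ne, Sym2.eq_iff]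
    have := hv (a + 1) ha
    have := hva.ne
    have := hav.ne
    tauto)
  have hva' : K'.Adj v (p (a + 1)) := hKadj _ _ hva (by
    rw [Ne, Sym2.eq_iff]
    have := hv (a + 1) ha
    have := hva.ne
    have := hav.ne
    tauto)
  have hpadj : ∀ i < m, i ≠ a → K'.Adj (p i) (p (i + 1)) := by
    intro i him hia
    refine hKadj _ _ (h.adj i him) ?_
    rw [Ne, Sym2.eq_iff]
    rintro (⟨h1, h2⟩ | ⟨h1, h2⟩)
    · exact hia (h.inj _ (by omega) _ (by omega) h1)
    · have := h.inj _ (by omega) _ (by omega) h1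
      have := h.inj _ (by omega) _ (by omega) h2
      omega
  have hbase : K'.Adj (p 0) (p m) := hKadj _ _ h.base (h.edge_ne hm ha)
  refine ⟨?_, h.tri_update i, ?_, hqi, by omega, ?_, ?_, ?_, fun c d hcd => h.mem c d (hle hcd), ?_⟩
  · refine h.fam.remove hi (fun j hj => h.face_unique hm ha hi hj) hle ?_ ?_
    · rw [SimpleGraph.mem_edgeSet, hK', SimpleGraph.deleteEdges_adj]
      exact fun h => h.2 rfl
    · intro j hj e' he'
      rw [hK', SimpleGraph.edgeSet_deleteEdges]
      refine ⟨h.fam.supp j e' he', ?_⟩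
      rintro rfl
      exact hj (h.face_unique hm ha hi he')
  · rw [sum_update_zero, h.sum, hq.chi_eq ha, hf, hq.first, hq.last ha, hqv]
    abel
  · intro j hj
    rcases Nat.lt_trichotomy j a with h1 | h1 | h1
    · rw [hq.lo j (by omega), hq.lo (j + 1) h1]
      exact hpadj j (by omega) (by omega)
    · rw [h1, hq.at, hqv]
      exact hav'
    · by_cases h2 : j = a + 1
      · rw [h2, hq.after, hqv]
        exact hva'
      · have h3 := hpadj (j - 1) (by omega) (by omega)
        rw [← hq.hi (j - 1) (by omega), ← hq.hi (j - 1 + 1) (by omega),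
          show j - 1 + 1 = j by omega] at h3
        exact h3
  · rw [hq.first, hq.last ha]
    exact hbase
  · rw [hq.first, hq.last ha]
    exact h.uniq_update i
  · intro x u hu w hw hux hwx
    have main : p a ≠ x → p (a + 1) ≠ x → (inside K' {x}ᶜ).Reachable (p a) (p (a + 1)) := by
      intro h1 h2
      by_cases hxv : v = x
      · have hS : ∀ j ≤ m, p j ∈ ({x}ᶜ : Set V) := fun j hj => by
          rw [← hxv]
          exact hv j hj
        have r1 := reachable_inside (H := K') (S := {x}ᶜ) (w := p) (a := 0) (b := a)
          (fun j _ hj => hpadj j (by omega) (by omega)) (fun j _ hj => hS j (by omega))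
          a (by omega) le_rfl 0 le_rfl (by omega)
        have r2 := reachable_inside (H := K') (S := {x}ᶜ) (w := p) (a := a + 1) (b := m)
          (fun j hj hj' => hpadj j (by omega) (by omega)) (fun j _ hj => hS j (by omega))
          m (by omega) le_rfl (a + 1) le_rfl (by omega)
        have r3 : (inside K' {x}ᶜ).Adj (p 0) (p m) := ⟨hbase, hS 0 (by omega), hS m le_rfl⟩
        exact (r1.trans r3.reachable).trans r2
      · have r1 : (inside K' {x}ᶜ).Adj (p a) v := ⟨hav', h1, hxv⟩
        have r2 : (inside K' {x}ᶜ).Adj v (p (a + 1)) := ⟨hva', hxv, h2⟩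
        exact r1.reachable.trans r2.reachable
    refine reachable_of_map id ?_ (h.conn x u hu w hw hux hwx)
    intro c d hcd
    by_cases he : s(c, d) = s(p a, p (a + 1))
    · have hc : c ≠ x := hcd.2.1
      have hd : d ≠ x := hcd.2.2
      rw [Sym2.eq_iff] at he
      rcases he with ⟨rfl, rfl⟩ | ⟨rfl, rfl⟩
      · exact main hc hd
      · exact (main hd hc).symm
    · exact SimpleGraph.Adj.reachable (G := inside K' {x}ᶜ) ⟨hKadj _ _ hcd.1 he, hcd.2⟩

theorem tip_ne_zero (h : Disc K L f p m) {a : ℕ} (ha : a + 2 ≤ m) {i : ι}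
    (hf : f i = ind s(p a, p (a + 1)) + ind s(p a, p (a + 2)) + ind s(p (a + 2), p (a + 1))) :
    f i s(p (a + 1), p (a + 2)) ≠ 0 := by
  have hn1 : p a ≠ p (a + 1) := (h.adj a (by omega)).ne
  have hn2 : p (a + 1) ≠ p (a + 2) := (h.adj (a + 1) (by omega)).ne
  have hn3 : p a ≠ p (a + 2) := fun he => by
    have := h.inj _ (by omega) _ (by omega) he
    omega
  have h1 : s(p (a + 1), p (a + 2)) ≠ s(p a, p (a + 2)) := by
    rw [Ne, Sym2.eq_iff]
    tauto
  have h2 : s(p (a + 1), p (a + 2)) ≠ s(p a, p (a + 1)) := by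
    rw [Ne, Sym2.eq_iff]
    tauto
  rw [hf, Sym2.eq_swap (a := p (a + 2))]
  simp [ind, h1, h2]

/-- A boundary triangle with two boundary edges has a boundary vertex of degree two as its tip. -/
theorem adj_tip (h : Disc K L f p m) {a : ℕ} (ha : a + 2 ≤ m) {i : ι}
    (hf : f i = ind s(p a, p (a + 1)) + ind s(p a, p (a + 2)) + ind s(p (a + 2), p (a + 1)))
    {y : V} (hy : K.Adj (p (a + 1)) y) : y = p a ∨ y = p (a + 2) := by
  have hm : 2 ≤ m := by omega
  have hn1 : p a ≠ p (a + 1) := (h.adj a (by omega)).ne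
  have hn2 : p (a + 1) ≠ p (a + 2) := (h.adj (a + 1) (by omega)).ne
  have hn3 : p a ≠ p (a + 2) := fun he => by
    have := h.inj _ (by omega) _ (by omega) he
    omega
  have hi1 : f i s(p a, p (a + 1)) = 1 := by
    rw [hf]
    have h1 : s(p a, p (a + 1)) ≠ s(p a, p (a + 2)) := by
      rw [Ne, Sym2.eq_iff]
      tauto
    have h2 : s(p a, p (a + 1)) ≠ s(p (a + 2), p (a + 1)) := by
      rw [Ne, Sym2.eq_iff]
      tauto
    simp [ind, h1, h2]
  have hi2 := h.tip_ne_zero ha hf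
  by_contra hcon
  push Not at hcon
  obtain ⟨X, hX⟩ := h.fam.exact (ind s(p a, p (a + 1)) + ind s(p (a + 1), p (a + 2))) (fun j => by
    rw [dotProduct_add, dotProduct_comm, ind_dot, dotProduct_comm, ind_dot]
    by_cases hj : j = i
    · rw [hj, hi1, zmod_two_eq_one hi2]
      decide
    · have z1 : f j s(p a, p (a + 1)) = 0 := by
        by_contra hne
        exact hj (h.face_unique hm (by omega) (by rw [hi1]; decide) hne)
      have z2 : f j s(p (a + 1), p (a + 2)) = 0 := by
        by_contra hne
        exact hj (h.face_unique hm (a := a + 1) (by omega) hi2 hne)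
      rw [z1, z2, add_zero])
  have hxy : X (p a) = X y := by
    refine eq_of_reachable ?_ (h.conn (p (a + 1)) (p a) (h.mem_path (by omega)) y
      (h.mem _ _ hy.symm) hn1 hy.ne.symm)
    intro c d hcd
    have hc : c ≠ p (a + 1) := hcd.2.1
    have hd : d ≠ p (a + 1) := hcd.2.2
    have := hX s(c, d) hcd.1
    have h1 : s(c, d) ≠ s(p a, p (a + 1)) := by
      rw [Ne, Sym2.eq_iff]
      tauto
    have h2 : s(c, d) ≠ s(p (a + 1), p (a + 2)) := by
      rw [Ne, Sym2.eq_iff]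
      tauto
    rw [Pi.add_apply, ind_eq_zero h1, ind_eq_zero h2, cob_mk, add_zero] at this
    exact zmod_two_eq_of_add this.symm
  have e1 := hX s(p a, p (a + 1)) (h.adj a (by omega))
  have e2 := hX s(p (a + 1), y) hy
  have h0 : s(p a, p (a + 1)) ≠ s(p (a + 1), p (a + 2)) := by
    rw [Ne, Sym2.eq_iff]
    tauto
  have h1 : s(p (a + 1), y) ≠ s(p a, p (a + 1)) := by
    rw [Ne, Sym2.eq_iff]
    tauto
  have h2 : s(p (a + 1), y) ≠ s(p (a + 1), p (a + 2)) := by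
    rw [Ne, Sym2.eq_iff]
    tauto
  rw [Pi.add_apply, ind_eq_zero h0, cob_mk, ind, Pi.single_eq_same, add_zero, hxy, add_comm] at e1
  rw [Pi.add_apply, ind_eq_zero h1, ind_eq_zero h2, cob_mk, add_zero, ← e1] at e2
  exact absurd e2 (by decide)

/-- Removing a boundary vertex of degree two. -/
theorem remove_tip [DecidableEq ι] (h : Disc K L f p m) {a : ℕ} (ha : a + 2 ≤ m) {i : ι}
    (hf : f i = ind s(p a, p (a + 1)) + ind s(p a, p (a + 2)) + ind s(p (a + 2), p (a + 1)))
    (hi : f i s(p a, p (a + 1)) ≠ 0) (hab : K.Adj (p a) (p (a + 2))) {q : ℕ → V}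
    (hq : Ins q p a) :
    Disc (inside K {p (a + 1)}ᶜ) (L \ {p (a + 1)}) (Function.update f i 0) q (m - 1) := by
  obtain ⟨m, rfl⟩ : ∃ k, m = k + 1 := ⟨m - 1, by omega⟩
  rw [Nat.add_sub_cancel]
  have ham : a < m := by omega
  set x := p (a + 1) with hx
  have hnx : ∀ j ≤ m + 1, j ≠ a + 1 → p j ≠ x := fun j hj hne he =>
    hne (h.inj _ hj _ (by omega) he)
  have hqj : ∀ j ≤ m, ∃ k ≤ m + 1, k ≠ a + 1 ∧ q j = p k := by
    intro j hj
    rcases Nat.lt_or_ge a j with h1 | h1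
    · exact ⟨j + 1, by omega, by omega, (hq.hi j h1).symm⟩
    · exact ⟨j, by omega, by omega, (hq.lo j h1).symm⟩
  have hqx : ∀ j ≤ m, q j ≠ x := by
    intro j hj
    obtain ⟨k, hk, hk', he⟩ := hqj j hj
    rw [he]
    exact hnx k hk hk'
  have hle : inside K {x}ᶜ ≤ K := fun c d hcd => hcd.1
  have hn1 : p a ≠ x := hnx a (by omega) (by omega)
  have hn2 : p (a + 2) ≠ x := hnx (a + 2) (by omega) (by omega)
  have h0 : q 0 = p 0 := hq.first.symm
  have hm0 : q m = p (m + 1) := (hq.last ham).symm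
  refine ⟨?_, h.tri_update i, ?_, hq.inj h.inj, by omega, ?_, ?_, ?_, ?_, ?_⟩
  · refine h.fam.remove hi (fun j hj => h.face_unique (by omega) (by omega) hi hj) hle ?_ ?_
    · rw [SimpleGraph.mem_edgeSet]
      exact fun hh => hh.2.2 rfl
    · intro j hj e' he'
      have hK := h.fam.supp j e' he'
      have key : ∀ c d, K.Adj c d → f j s(c, d) ≠ 0 → c ≠ x := by
        rintro c d hcd hne rfl
        rcases h.adj_tip ha hf hcd with rfl | rfl
        · rw [Sym2.eq_swap] at hne
          exact hj (h.face_unique (by omega) (by omega) hi hne)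
        · exact hj (h.face_unique (by omega) (a := a + 1) (by omega) (h.tip_ne_zero ha hf) hne)
      induction e' with
      | _ c d => exact ⟨hK, key c d hK he', key d c hK.symm (by rwa [Sym2.eq_swap])⟩
  · rw [sum_update_zero, h.sum, hq.chi_eq ham, hf, h0, hm0, hq.at, ← hq.after, hx]
    funext e
    simp only [Pi.add_apply]
    rw [Sym2.eq_swap (a := p (a + 2))]
    have key : ∀ x y z w u : ZMod 2, x + (y + z + w) + u + (z + y + w) = x + u := by decide
    exact key _ _ _ _ _
  · intro j hj
    refine ⟨?_, hqx j (by omega), hqx (j + 1) (by omega)⟩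
    rcases Nat.lt_trichotomy j a with h1 | h1 | h1
    · rw [← hq.lo j (by omega), ← hq.lo (j + 1) h1]
      exact h.adj j (by omega)
    · rw [h1, ← hq.at, ← hq.after]
      exact hab
    · rw [← hq.hi j h1, ← hq.hi (j + 1) (by omega)]
      exact h.adj (j + 1) (by omega)
  · exact ⟨by rw [h0, hm0]; exact h.base, hqx 0 (by omega), hqx m le_rfl⟩
  · rw [h0, hm0]
    exact h.uniq_update i
  · exact fun c d hcd => ⟨h.mem c d hcd.1, hcd.2.1⟩
  · intro z u hu w hw huz hwz
    have hab' : (inside K {x}ᶜ).Adj (p a) (p (a + 2)) := ⟨hab, hn1, hn2⟩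
    have hn3 : p a ≠ p (a + 2) := hab.ne
    obtain ⟨t, ht, htz⟩ : ∃ t, (t = p a ∨ t = p (a + 2)) ∧ t ≠ z := by
      by_cases h1 : p a = z
      · exact ⟨p (a + 2), Or.inr rfl, fun h2 => hn3 (h1.trans h2.symm)⟩
      · exact ⟨p a, Or.inl rfl, h1⟩
    have main : ∀ d, K.Adj x d → d ≠ z → (inside (inside K {x}ᶜ) {z}ᶜ).Reachable t d := by
      intro d hd hdz
      by_cases htd : t = d
      · rw [htd]
      · have h1 : (inside K {x}ᶜ).Adj t d := by
          rcases ht with h2 | h2 <;> rcases h.adj_tip ha hf hd with h3 | h3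
          · exact (htd (h2.trans h3.symm)).elim
          · rw [h2, h3]
            exact hab'
          · rw [h2, h3]
            exact hab'.symm
          · exact (htd (h2.trans h3.symm)).elim
        exact SimpleGraph.Adj.reachable (G := inside (inside K {x}ᶜ) {z}ᶜ) ⟨h1, htz, hdz⟩
    have := reachable_of_map (B := inside (inside K {x}ᶜ) {z}ᶜ)
      (fun y => if y = x then t else y) ?_ (h.conn z u hu.1 w hw.1 huz hwz)
    · rwa [if_neg (show u ≠ x from hu.2), if_neg (show w ≠ x from hw.2)] at this
    · intro c d hcd
      have hcz : c ≠ z := hcd.2.1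
      have hdz : d ≠ z := hcd.2.2
      by_cases hc : c = x <;> by_cases hd : d = x
      · exact (hcd.1.ne (hc.trans hd.symm)).elim
      · rw [if_pos hc, if_neg hd]
        exact main d (hc ▸ hcd.1) hdz
      · rw [if_neg hc, if_pos hd]
        exact (main c (hd ▸ hcd.1.symm) hcz).symm
      · rw [if_neg hc, if_neg hd]
        exact SimpleGraph.Adj.reachable (G := inside (inside K {x}ᶜ) {z}ᶜ)
          ⟨⟨hcd.1, hc, hd⟩, hcz, hdz⟩

end Disc

end MacLane

namespace MacLane
set_option linter.unusedSectionVars false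
variable {V : Type} [Fintype V] [DecidableEq V]
variable {G : SimpleGraph V} {ι : Type} {f : ι → Sym2 V → ZMod 2} {n : ℕ}

namespace Disc
variable [Fintype ι] {K : SimpleGraph V} {L : Set V} {p : ℕ → V} {m : ℕ}

theorem sweep_of_edge [DecidableEq ι] (h : Disc K L f p m) (hm : 2 ≤ m) {a : ℕ} (ha : a < m) {i : ι}
    {v : V} (hv : ∀ j ≤ m, p j ≠ v)
    (hf : f i = ind s(p a, p (a + 1)) + ind s(p a, v) + ind s(v, p (a + 1)))
    (hi : f i s(p a, p (a + 1)) ≠ 0) (hav : K.Adj (p a) v) (hva : K.Adj v (p (a + 1)))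
    (ih : ∀ K' < K, ∀ L f p m, Disc (ι := ι) K' L f p m → Sweep K' L (pathPairs p m)) :
    Sweep K L (pathPairs p m) := by
  obtain ⟨q, hq, hqv⟩ := exists_ins p a v
  have hd := h.remove_edge hm ha hv hf hi hav hva hq hqv
  have hadj := h.adj a ha
  have hlt : K.deleteEdges {s(p a, p (a + 1))} < K := by
    refine lt_of_le_of_ne (SimpleGraph.deleteEdges_le _) fun he => ?_
    rw [← he, SimpleGraph.deleteEdges_adj] at hadj
    exact hadj.2 rfl
  have hs := ih _ hlt _ _ _ _ hd
  have := Sweep.close _ _ _ (q a) (q (a + 1)) (q (a + 2)) hs ⟨a, by omega, rfl⟩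
    ⟨a + 1, by omega, rfl⟩ (by rw [hq.at, hq.after]; exact hadj.ne) (by
      rw [hq.at, hq.after, SimpleGraph.deleteEdges_adj]
      exact fun hh => hh.2 rfl)
  rw [← hq.pairs_over ha hd.inj, hq.at, hq.after] at this
  convert this using 1
  ext c d
  rw [SimpleGraph.sup_adj, SimpleGraph.deleteEdges_adj, SimpleGraph.edge_adj, mem_singleton_iff,
    Sym2.eq_iff]
  constructor
  · intro hcd
    have := hcd.ne
    tauto
  · rintro (hcd | ⟨⟨hc, hd⟩ | ⟨hc, hd⟩, -⟩)
    · exact hcd.1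
    · rw [hc, hd]
      exact hadj
    · rw [hc, hd]
      exact hadj.symm

theorem sweep_of_tip [DecidableEq ι] (h : Disc K L f p m) {a : ℕ} (ha : a + 2 ≤ m) {i : ι}
    (hf : f i = ind s(p a, p (a + 1)) + ind s(p a, p (a + 2)) + ind s(p (a + 2), p (a + 1)))
    (hi : f i s(p a, p (a + 1)) ≠ 0) (hab : K.Adj (p a) (p (a + 2)))
    (ih : ∀ K' < K, ∀ L f p m, Disc (ι := ι) K' L f p m → Sweep K' L (pathPairs p m)) :
    Sweep K L (pathPairs p m) := by
  obtain ⟨q, hq⟩ := exists_ins_removing p a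
  have hd := h.remove_tip ha hf hi hab hq
  have h1 := h.adj a (by omega)
  have h2 := h.adj (a + 1) (by omega)
  have hlt : inside K {p (a + 1)}ᶜ < K := by
    refine lt_of_le_of_ne (fun _ _ h => h.1) fun he => ?_
    rw [← he] at h1
    exact h1.2.2 rfl
  have hs := ih _ hlt _ _ _ _ hd
  have := Sweep.up _ _ _ (p a) (p (a + 2)) (p (a + 1)) hs
    ⟨a, by omega, by rw [hq.at, hq.after]⟩ (fun hh => hh.2 rfl)
  have hpairs := hq.pairs_up (m := m - 1) (by omega) (by
    rw [Nat.sub_add_cancel (by omega)]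
    exact h.inj)
  rw [Nat.sub_add_cancel (by omega)] at hpairs
  rw [← hpairs, insert_sdiff_singleton, insert_eq_of_mem (h.mem_path (by omega))] at this
  convert this using 1
  ext c d
  rw [SimpleGraph.sup_adj, SimpleGraph.sup_adj, SimpleGraph.edge_adj, SimpleGraph.edge_adj]
  constructor
  · intro hcd
    by_cases hc : c = p (a + 1)
    · rcases h.adj_tip ha hf (hc ▸ hcd) with hd | hd
      · exact Or.inl (Or.inr ⟨Or.inr ⟨hc, hd⟩, hcd.ne⟩)
      · exact Or.inr ⟨Or.inl ⟨hc, hd⟩, hcd.ne⟩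
    · by_cases hd : d = p (a + 1)
      · rcases h.adj_tip ha hf (hd ▸ hcd.symm) with hc | hc
        · exact Or.inl (Or.inr ⟨Or.inl ⟨hc, hd⟩, hcd.ne⟩)
        · exact Or.inr ⟨Or.inr ⟨hc, hd⟩, hcd.ne⟩
      · exact Or.inl (Or.inl ⟨hcd, hc, hd⟩)
  · rintro ((hcd | ⟨⟨hc, hd⟩ | ⟨hc, hd⟩, -⟩) | ⟨⟨hc, hd⟩ | ⟨hc, hd⟩, -⟩)
    · exact hcd.1
    · rw [hc, hd]
      exact h1
    · rw [hc, hd]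
      exact h1.symm
    · rw [hc, hd]
      exact h2
    · rw [hc, hd]
      exact h2.symm

theorem exists_min_chord (h : Disc K L f p m) (hm : 2 ≤ m) : ∃ a b, a + 2 ≤ b ∧ b ≤ m ∧
    K.Adj (p a) (p b) ∧ ∀ c d, c + 2 ≤ d → d ≤ m → K.Adj (p c) (p d) → b - a ≤ d - c := by
  classical
  have hex : ∃ l a b, a + 2 ≤ b ∧ b ≤ m ∧ K.Adj (p a) (p b) ∧ b - a = l :=
    ⟨m, 0, m, by omega, le_rfl, h.base, by omega⟩
  obtain ⟨a, b, h1, h2, h3, h4⟩ := Nat.find_spec hex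
  refine ⟨a, b, h1, h2, h3, fun c d hcd hd hadj => ?_⟩
  rw [h4]
  exact Nat.find_min' hex ⟨c, d, hcd, hd, hadj, rfl⟩

theorem sweep (K : SimpleGraph V) : ∀ L f p m, Disc (ι := ι) K L f p m →
    Sweep K L (pathPairs p m) := by
  classical
  induction K using WellFoundedLT.induction with
  | _ K ih =>
    intro L f p m h
    by_cases hm : 2 ≤ m
    · obtain ⟨a, b, hab, hbm, hadj, hmin⟩ := h.exists_min_chord hm
      obtain ⟨i, v, hv1, hv2, hf, hi, hav, hva⟩ := h.exists_face hm (a := a) (by omega)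
      by_cases hv : ∀ j ≤ m, p j ≠ v
      · exact h.sweep_of_edge hm (by omega) hv hf hi hav hva ih
      · push Not at hv
        obtain ⟨l, hl, rfl⟩ := hv
        have hla : l ≠ a := by
          rintro rfl
          exact hv1 rfl
        have hla1 : l ≠ a + 1 := by
          rintro rfl
          exact hv2 rfl
        have hside : ¬ (l < a ∨ b < l) := by
          intro hlab
          refine h.fam.addSum.crossing_path (i0 := none) h.inj hm h.sum (a := a) (b := b)
            (c := a + 1) (d := l) (by omega) (by omega) hbm hl hlab hadj ?_
          have hne : ∀ j k, j ≤ m → k ≤ m → j ≠ k → p j ≠ p k := fun j k hj hk hjk he =>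
            hjk (h.inj _ hj _ hk he)
          refine SimpleGraph.Adj.reachable (G := inside K {p a, p b}ᶜ) ⟨hva.symm, ?_, ?_⟩
          · rintro (he | he)
            · exact hne _ _ (by omega) (by omega) (by omega) he
            · exact hne _ _ (by omega) (by omega) (by omega) he
          · rintro (he | he)
            · exact hne _ _ (by omega) (by omega) (by omega) he
            · exact hne _ _ (by omega) (by omega) (by omega) he
        have h1 := hmin a l (by omega) hl hav
        obtain rfl : l = b := by omega
        have h2 : l = a + 2 := by
          by_contra hne
          have := hmin (a + 1) l (by omega) hl hva.symm
          omega
        subst h2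
        exact h.sweep_of_tip (by omega) hf hi hav ih
    · obtain rfl : m = 1 := by
        have := h.pos
        omega
      exact h.sweep_one

end Disc

theorem exists_sweep (hn : 4 ≤ n) (hG : Maximal (Good n) G) (hV : 3 ≤ Fintype.card V) :
    ∃ N, Sweep G univ N := by
  classical
  obtain ⟨ι, _, f, h, htri, hsum, i, hi⟩ := exists_triangle_family hn hG hV
  obtain ⟨a, b, c, hab, hbc, hac, hf⟩ := (htri i).resolve_left hi
  have e1 : s(a, b) ≠ s(b, c) := by
    rw [Ne, Sym2.eq_iff]
    tauto
  have e2 : s(a, b) ≠ s(a, c) := by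
    rw [Ne, Sym2.eq_iff]
    tauto
  have e3 : s(b, c) ≠ s(a, c) := by
    rw [Ne, Sym2.eq_iff]
    tauto
  have f1 : f i s(a, b) ≠ 0 := by
    rw [hf]
    simp [ind, e1, e2]
  have f2 : f i s(b, c) ≠ 0 := by
    rw [hf]
    simp [ind, e1.symm, e3]
  have f3 : f i s(a, c) ≠ 0 := by
    rw [hf]
    simp [ind, e2.symm, e3.symm]
  have hup : ∀ j e', Function.update f i 0 j e' ≠ 0 → j ≠ i ∧ f j e' ≠ 0 := by
    intro j e' hne
    by_cases hj : j = i
    · subst hj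
      simp at hne
    · rw [Function.update_of_ne hj] at hne
      exact ⟨hj, hne⟩
  set p : ℕ → V := fun k => if k = 0 then a else if k = 1 then b else c with hp
  have hd : Disc G univ (Function.update f i 0) p 2 := by
    refine ⟨⟨?_, ?_, ?_, ?_⟩, ?_, ?_, ?_, by omega, ?_, h.supp i _ f3, ?_, fun _ _ _ => mem_univ _,
      fun x u _ w _ hu hw => reachable_compl_singleton hn hG hu hw⟩
    · exact fun j e' hne => h.supp j e' (hup j e' hne).2
    · intro e' j k l h1 h2 h3 hj hk hl
      exact h.cap e' j k l h1 h2 h3 (hup _ _ hj).2 (hup _ _ hk).2 (hup _ _ hl).2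
    · intro j X
      by_cases hj : j = i
      · subst hj
        simp
      · rw [Function.update_of_ne hj]
        exact h.even j X
    · intro g hg
      refine h.exact g fun j => ?_
      have hz : ∀ j ≠ i, f j ⬝ᵥ g = 0 := fun j hj => by
        have := hg j
        rwa [Function.update_of_ne hj] at this
      by_cases hj : j = i
      · subst hj
        have : (∑ k, f k) ⬝ᵥ g = 0 := by rw [hsum, zero_dotProduct]
        rw [sum_dotProduct, Finset.sum_eq_single j (fun k _ hk => hz k hk) (by simp)] at this
        exact this
      · exact hz j hj
    · intro j
      by_cases hj : j = i
      · subst hj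
        simp
      · rw [Function.update_of_ne hj]
        exact htri j
    · rw [sum_update_zero, hsum, hf, chi_succ p (by omega), chi_succ p le_rfl, chi_self]
      simp [hp]
    · intro j hj k hk
      interval_cases j <;> interval_cases k <;> simp [hp, hab, hbc, hac, hab.symm, hbc.symm, hac.symm]
    · intro j hj
      interval_cases j
      · exact h.supp i _ f1
      · exact h.supp i _ f2
    · intro j k hj hk
      by_contra hjk
      exact h.cap _ j k i hjk (hup _ _ hj).1 (hup _ _ hk).1 (hup _ _ hj).2 (hup _ _ hk).2 f3
  exact ⟨_, hd.sweep⟩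

end MacLane

namespace MacLane

/-- The part of the graph of `φ` over `[α, β]`. -/
def Gr (φ : ℝ → ℝ) (α β : ℝ) : Set (ℝ × ℝ) := {z | α ≤ z.1 ∧ z.1 ≤ β ∧ z.2 = φ z.1}

/-- The region between the unit interval and the graph of `φ` over it. -/
def Reg (φ : ℝ → ℝ) : Set (ℝ × ℝ) := {z | 0 ≤ z.1 ∧ z.1 ≤ 1 ∧ 0 ≤ z.2 ∧ z.2 ≤ φ z.1}

/-- `φ` raised by a parabolic bump over `[α, β]`. -/
noncomputable def raise (φ : ℝ → ℝ) (α β x : ℝ) : ℝ := φ x + max 0 ((x - α) * (β - x))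

/-- The open lens between `φ` and `raise φ α β`. -/
def Lens (φ : ℝ → ℝ) (α β : ℝ) : Set (ℝ × ℝ) :=
  {z | α < z.1 ∧ z.1 < β ∧ φ z.1 < z.2 ∧ z.2 < raise φ α β z.1}

section Raise
variable {φ : ℝ → ℝ} {α β x : ℝ}

theorem le_raise : φ x ≤ raise φ α β x := by
  rw [raise]
  linarith [le_max_left 0 ((x - α) * (β - x))]

theorem raise_eq (h : x ≤ α ∨ β ≤ x) (hαβ : α < β) : raise φ α β x = φ x := by
  rw [raise, max_eq_left, add_zero]
  rcases h with h | h <;> nlinarith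

theorem lt_raise (h1 : α < x) (h2 : x < β) : φ x < raise φ α β x := by
  have : 0 < (x - α) * (β - x) := mul_pos (by linarith) (by linarith)
  rw [raise, max_eq_right this.le]
  linarith

theorem continuous_raise (hφ : Continuous φ) : Continuous (raise φ α β) := by
  unfold raise
  fun_prop

theorem lens_eq_image : Lens φ α β =
    (fun w : ℝ × ℝ => (w.1, (1 - w.2) * φ w.1 + w.2 * raise φ α β w.1)) ''
      (Ioo α β ×ˢ Ioo 0 1) := by
  ext ⟨x, y⟩
  constructor
  · rintro ⟨h1, h2, h3, h4⟩
    simp only at h1 h2 h3 h4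
    have hpos : 0 < raise φ α β x - φ x := by linarith
    refine ⟨(x, (y - φ x) / (raise φ α β x - φ x)), ⟨⟨h1, h2⟩, ?_, ?_⟩, ?_⟩
    · exact div_pos (by linarith) hpos
    · rw [div_lt_one hpos]
      linarith
    · simp only [Prod.mk.injEq, true_and]
      field_simp
      ring
  · rintro ⟨⟨x', t⟩, ⟨⟨h1, h2⟩, h3, h4⟩, he⟩
    simp only [Prod.mk.injEq] at he h1 h2 h3 h4
    obtain ⟨rfl, rfl⟩ := he
    have := lt_raise (φ := φ) h1 h2
    refine ⟨h1, h2, ?_, ?_⟩ <;> simp only <;> nlinarith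

theorem isOpen_lens (hφ : Continuous φ) : IsOpen (Lens φ α β) := by
  have hr := continuous_raise (α := α) (β := β) hφ
  change IsOpen ({z : ℝ × ℝ | α < z.1} ∩ ({z : ℝ × ℝ | z.1 < β} ∩ ({z : ℝ × ℝ | φ z.1 < z.2} ∩
    {z : ℝ × ℝ | z.2 < raise φ α β z.1})))
  exact (isOpen_lt (by fun_prop) (by fun_prop)).inter ((isOpen_lt (by fun_prop) (by fun_prop)).inter
    ((isOpen_lt (by fun_prop) (by fun_prop)).inter (isOpen_lt (by fun_prop) (by fun_prop))))

theorem continuous_lens_map (hφ : Continuous φ) : Continuous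
    (fun w : ℝ × ℝ => (w.1, (1 - w.2) * φ w.1 + w.2 * raise φ α β w.1)) := by
  have hr := continuous_raise (α := α) (β := β) hφ
  fun_prop

theorem isPreconnected_lens (hφ : Continuous φ) : IsPreconnected (Lens φ α β) := by
  rw [lens_eq_image]
  exact (isPreconnected_Ioo.prod isPreconnected_Ioo).image _ (continuous_lens_map hφ).continuousOn

theorem closure_lens_subset (hφ : Continuous φ) (hαβ : α < β) :
    closure (Lens φ α β) ⊆ Lens φ α β ∪ Gr φ α β ∪ Gr (raise φ α β) α β := by
  have hr := continuous_raise (α := α) (β := β) hφ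
  have hcl : closure (Lens φ α β) ⊆
      {z | α ≤ z.1} ∩ ({z | z.1 ≤ β} ∩ ({z | φ z.1 ≤ z.2} ∩ {z | z.2 ≤ raise φ α β z.1})) := by
    refine closure_minimal (fun z hz => ⟨hz.1.le, hz.2.1.le, hz.2.2.1.le, hz.2.2.2.le⟩) ?_
    exact (isClosed_le (by fun_prop) (by fun_prop)).inter
      ((isClosed_le (by fun_prop) (by fun_prop)).inter
        ((isClosed_le (by fun_prop) (by fun_prop)).inter (isClosed_le (by fun_prop) (by fun_prop))))
  intro z hz
  obtain ⟨h1, h2, h3, h4⟩ := hcl hz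
  simp only [mem_ofPred_eq] at h1 h2 h3 h4
  by_cases e1 : z.2 = φ z.1
  · exact Or.inl (Or.inr ⟨h1, h2, e1⟩)
  by_cases e2 : z.2 = raise φ α β z.1
  · exact Or.inr ⟨h1, h2, e2⟩
  refine Or.inl (Or.inl ⟨?_, ?_, lt_of_le_of_ne h3 (Ne.symm e1), lt_of_le_of_ne h4 e2⟩)
  · refine lt_of_le_of_ne h1 fun he => e1 (le_antisymm ?_ h3)
    rwa [raise_eq (Or.inl he.ge) hαβ] at h4
  · refine lt_of_le_of_ne h2 fun he => e1 (le_antisymm ?_ h3)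
    rwa [raise_eq (Or.inr he.ge) hαβ] at h4

theorem mem_closure_lens (hφ : Continuous φ) (hαβ : α < β) {t : ℝ} (hx : x ∈ Icc α β)
    (ht : t ∈ Icc (0 : ℝ) 1) :
    (x, (1 - t) * φ x + t * raise φ α β x) ∈ closure (Lens φ α β) := by
  rw [lens_eq_image]
  apply image_closure_subset_closure_image (continuous_lens_map hφ)
  refine ⟨(x, t), ?_, rfl⟩
  rw [closure_prod_eq, closure_Ioo hαβ.ne, closure_Ioo zero_ne_one]
  exact ⟨hx, ht⟩

theorem gr_subset_closure_lens (hφ : Continuous φ) (hαβ : α < β) :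
    Gr φ α β ⊆ closure (Lens φ α β) := by
  rintro ⟨x, y⟩ ⟨h1, h2, h3⟩
  have := mem_closure_lens hφ hαβ (x := x) (t := 0) ⟨h1, h2⟩ ⟨le_rfl, zero_le_one⟩
  simp only at h3
  rw [h3]
  simpa using this

theorem gr_raise_subset_closure_lens (hφ : Continuous φ) (hαβ : α < β) :
    Gr (raise φ α β) α β ⊆ closure (Lens φ α β) := by
  rintro ⟨x, y⟩ ⟨h1, h2, h3⟩
  have := mem_closure_lens hφ hαβ (x := x) (t := 1) ⟨h1, h2⟩ ⟨zero_le_one, le_rfl⟩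
  simp only at h3
  rw [h3]
  simpa using this

theorem gr_path (hφ : Continuous φ) (hαβ : α < β) {u v : ℝ × ℝ} (hu : u = (α, φ α))
    (hv : v = (β, φ β)) : ∃ γ : Path u v, Function.Injective γ ∧ range γ = Gr φ α β := by
  subst hu hv
  have hd : 0 < β - α := by linarith
  refine ⟨⟨⟨fun t => (α + t * (β - α), φ (α + t * (β - α))), by fun_prop⟩, by simp, by simp⟩, ?_, ?_⟩
  · intro s t hst
    have h1 : α + (s : ℝ) * (β - α) = α + t * (β - α) := congrArg Prod.fst hst
    have h2 : (s : ℝ) = t := mul_right_cancel₀ hd.ne' (add_left_cancel h1)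
    exact Subtype.ext h2
  · ext ⟨x, y⟩
    constructor
    · rintro ⟨t, ht⟩
      have h1 : α + (t : ℝ) * (β - α) = x := congrArg Prod.fst ht
      have h2 : φ (α + (t : ℝ) * (β - α)) = y := congrArg Prod.snd ht
      refine ⟨?_, ?_, ?_⟩ <;> simp only
      · nlinarith [t.2.1]
      · nlinarith [t.2.2]
      · rw [← h2, h1]
    · rintro ⟨h1, h2, h3⟩
      simp only at h1 h2 h3
      refine ⟨⟨(x - α) / (β - α), div_nonneg (by linarith) hd.le, ?_⟩, ?_⟩
      · rw [div_le_one hd]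
        linarith
      · have : α + (x - α) / (β - α) * (β - α) = x := by
          rw [div_mul_cancel₀ _ hd.ne']
          ring
        change (α + (x - α) / (β - α) * (β - α), φ (α + (x - α) / (β - α) * (β - α))) = (x, y)
        rw [this, h3]

theorem gr_congr {ψ : ℝ → ℝ} (h : ∀ x, α ≤ x → x ≤ β → φ x = ψ x) : Gr φ α β = Gr ψ α β := by
  ext z
  constructor
  · rintro ⟨h1, h2, h3⟩
    exact ⟨h1, h2, h3.trans (h _ h1 h2)⟩
  · rintro ⟨h1, h2, h3⟩
    exact ⟨h1, h2, h3.trans (h _ h1 h2).symm⟩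

theorem gr_split {μ : ℝ} (h1 : α ≤ μ) (h2 : μ ≤ β) : Gr φ α β = Gr φ α μ ∪ Gr φ μ β := by
  ext z
  constructor
  · rintro ⟨h3, h4, h5⟩
    rcases le_total z.1 μ with h | h
    · exact Or.inl ⟨h3, h, h5⟩
    · exact Or.inr ⟨h, h4, h5⟩
  · rintro (⟨h3, h4, h5⟩ | ⟨h3, h4, h5⟩)
    · exact ⟨h3, h4.trans h2, h5⟩
    · exact ⟨h1.trans h3, h4, h5⟩

/-- The raised arc meets the old region only in its endpoints. -/
theorem eq_of_mem_gr_raise {z : ℝ × ℝ} (hz : z ∈ Gr (raise φ α β) α β) (hR : z ∈ Reg φ) :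
    z.1 = α ∨ z.1 = β := by
  by_contra hcon
  push Not at hcon
  have h1 := lt_of_le_of_ne hz.1 hcon.1.symm
  have h2 := lt_of_le_of_ne hz.2.1 hcon.2
  have := lt_raise (φ := φ) h1 h2
  linarith [hz.2.2, hR.2.2.2]

theorem reg_raise_subset (hαβ : α < β) : Reg (raise φ α β) ⊆
    Reg φ ∪ Lens φ α β ∪ Gr (raise φ α β) α β := by
  rintro z ⟨h1, h2, h3, h4⟩
  by_cases h5 : z.2 ≤ φ z.1
  · exact Or.inl (Or.inl ⟨h1, h2, h3, h5⟩)
  push Not at h5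
  have h6 : α < z.1 := by
    by_contra hcon
    rw [raise_eq (Or.inl (not_lt.1 hcon)) hαβ] at h4
    linarith
  have h7 : z.1 < β := by
    by_contra hcon
    rw [raise_eq (Or.inr (not_lt.1 hcon)) hαβ] at h4
    linarith
  rcases h4.lt_or_eq with h8 | h8
  · exact Or.inl (Or.inr ⟨h6, h7, h5, h8⟩)
  · exact Or.inr ⟨h6.le, h7.le, h8⟩

theorem reg_subset_raise : Reg φ ⊆ Reg (raise φ α β) := fun _ hz =>
  ⟨hz.1, hz.2.1, hz.2.2.1, hz.2.2.2.trans le_raise⟩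

end Raise

end MacLane

namespace MacLane
variable {V : Type}

/-- The union of the arcs of the edges of `K`. -/
def arcs (K : SimpleGraph V) (arc : Sym2 V → Set (ℝ × ℝ)) : Set (ℝ × ℝ) := ⋃ e ∈ K.edgeSet, arc e

/-- `C` is a connected open set bounded by the arcs of a triangle of `K`. -/
def IsCell (K : SimpleGraph V) (pos : V → ℝ × ℝ) (arc : Sym2 V → Set (ℝ × ℝ))
    (C : Set (ℝ × ℝ)) : Prop :=
  IsOpen C ∧ IsPreconnected C ∧ ∃ a b c, K.Adj a b ∧ K.Adj b c ∧ K.Adj a c ∧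
    pos a ∈ closure C ∧ pos b ∈ closure C ∧ pos c ∈ closure C ∧
    closure C ⊆ C ∪ arc s(a, b) ∪ arc s(b, c) ∪ arc s(a, c)

/-- A drawing of `K` with vertex set `L` by graphs of functions, filling the region below `φ`,
such that the pairs in `N` are joined by pieces of the graph of `φ`. -/
structure Drawing (K : SimpleGraph V) (L : Set V) (N : Set (V × V)) (pos : V → ℝ × ℝ)
    (arc : Sym2 V → Set (ℝ × ℝ)) (φ : ℝ → ℝ) : Prop where
  cont : Continuous φ
  nonneg : ∀ x, 0 ≤ φ x
  inj : InjOn pos L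
  mem : ∀ a b, K.Adj a b → a ∈ L
  cov : ∀ a ∈ L, ∃ b, K.Adj a b
  path : ∀ u v, K.Adj u v → ∃ γ : Path (pos u) (pos v), Function.Injective γ ∧
    range γ = arc s(u, v)
  avoid : ∀ e ∈ K.edgeSet, ∀ w ∈ L, pos w ∈ arc e → w ∈ e
  inter : ∀ e ∈ K.edgeSet, ∀ e' ∈ K.edgeSet, e ≠ e' → ∀ z ∈ arc e ∩ arc e',
    ∃ w, w ∈ e ∧ w ∈ e' ∧ z = pos w
  reg : arcs K arc ⊆ Reg φ
  topAdj : ∀ p q, (p, q) ∈ N → K.Adj p q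
  topLt : ∀ p q, (p, q) ∈ N → (pos p).1 < (pos q).1
  topArc : ∀ p q, (p, q) ∈ N → arc s(p, q) = Gr φ (pos p).1 (pos q).1
  topDisj : ∀ p q, (p, q) ∈ N → ∀ p' q', (p', q') ∈ N → (p, q) ≠ (p', q') →
    (pos q).1 ≤ (pos p').1 ∨ (pos q').1 ≤ (pos p).1
  cells : ∀ z ∈ Reg φ, z ∈ arcs K arc ∨
    ∃ C, IsCell K pos arc C ∧ z ∈ C ∧ C ⊆ Reg φ ∧ Disjoint C (arcs K arc)

theorem mem_arcs {K : SimpleGraph V} {arc : Sym2 V → Set (ℝ × ℝ)} {z : ℝ × ℝ} :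
    z ∈ arcs K arc ↔ ∃ e ∈ K.edgeSet, z ∈ arc e := by
  simp [arcs]

theorem IsCell.extend {K K' : SimpleGraph V} {pos pos' : V → ℝ × ℝ}
    {arc arc' : Sym2 V → Set (ℝ × ℝ)} {C : Set (ℝ × ℝ)} (h : IsCell K pos arc C) (hK : K ≤ K')
    (hpos : ∀ a b, K.Adj a b → pos' a = pos a) (harc : ∀ e ∈ K.edgeSet, arc' e = arc e) :
    IsCell K' pos' arc' C := by
  obtain ⟨h1, h2, a, b, c, hab, hbc, hac, ha, hb, hc, hC⟩ := h
  refine ⟨h1, h2, a, b, c, hK hab, hK hbc, hK hac, ?_, ?_, ?_, ?_⟩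
  · rwa [hpos a b hab]
  · rwa [hpos b a hab.symm]
  · rwa [hpos c a hac.symm]
  · rwa [harc _ hab, harc _ hbc, harc _ hac]

namespace Drawing
variable {K : SimpleGraph V} {L : Set V} {N : Set (V × V)} {pos : V → ℝ × ℝ}
  {arc : Sym2 V → Set (ℝ × ℝ)} {φ : ℝ → ℝ}

theorem pos_mem (h : Drawing K L N pos arc φ) {u v : V} (huv : K.Adj u v) :
    pos u ∈ arc s(u, v) := by
  obtain ⟨γ, -, hγ⟩ := h.path u v huv
  rw [← hγ]
  exact ⟨0, γ.source⟩

theorem pos_mem_arcs (h : Drawing K L N pos arc φ) {u : V} (hu : u ∈ L) :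
    pos u ∈ arcs K arc := by
  obtain ⟨v, hv⟩ := h.cov u hu
  exact mem_arcs.2 ⟨_, hv, h.pos_mem hv⟩

theorem pos_eq (h : Drawing K L N pos arc φ) {p q : V} (hpq : (p, q) ∈ N) :
    pos p = ((pos p).1, φ (pos p).1) ∧ pos q = ((pos q).1, φ (pos q).1) := by
  have hadj := h.topAdj p q hpq
  have h1 := h.pos_mem hadj
  have h2 := h.pos_mem hadj.symm
  rw [Sym2.eq_swap, h.topArc p q hpq] at h2
  rw [h.topArc p q hpq] at h1
  exact ⟨Prod.ext rfl h1.2.2, Prod.ext rfl h2.2.2⟩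

/-- The cells of a drawing extended by a raised arc. -/
theorem cells_raise (h : Drawing K L N pos arc φ) {K' : SimpleGraph V} {pos' : V → ℝ × ℝ}
    {arc' : Sym2 V → Set (ℝ × ℝ)} {α β : ℝ} (hαβ : α < β) (hK : K ≤ K')
    (hpos : ∀ a b, K.Adj a b → pos' a = pos a) (harc : ∀ e ∈ K.edgeSet, arc' e = arc e)
    (hends : ∀ z ∈ Gr φ α β, z ∈ arcs K arc)
    (harcs : arcs K' arc' = arcs K arc ∪ Gr (raise φ α β) α β)
    (hcell : IsCell K' pos' arc' (Lens φ α β)) (hα : 0 ≤ α) (hβ : β ≤ 1) :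
    ∀ z ∈ Reg (raise φ α β), z ∈ arcs K' arc' ∨
      ∃ C, IsCell K' pos' arc' C ∧ z ∈ C ∧ C ⊆ Reg (raise φ α β) ∧ Disjoint C (arcs K' arc') := by
  have hold : ∀ C, C ⊆ Reg φ → Disjoint C (arcs K arc) → Disjoint C (arcs K' arc') := by
    intro C hC hd
    rw [harcs, disjoint_union_right]
    refine ⟨hd, Set.disjoint_left.2 fun z hz hz' => ?_⟩
    refine Set.disjoint_left.1 hd hz (hends z ⟨hz'.1, hz'.2.1, ?_⟩)
    rw [hz'.2.2, raise_eq _ hαβ]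
    rcases eq_of_mem_gr_raise hz' (hC hz) with h1 | h1
    · exact Or.inl h1.le
    · exact Or.inr h1.ge
  intro z hz
  rcases reg_raise_subset hαβ hz with (hz' | hz') | hz'
  · rcases h.cells z hz' with h1 | ⟨C, h1, h2, h3, h4⟩
    · exact Or.inl (by rw [harcs]; exact Or.inl h1)
    · exact Or.inr ⟨C, h1.extend hK hpos harc, h2, h3.trans reg_subset_raise, hold C h3 h4⟩
  · refine Or.inr ⟨_, hcell, hz', ?_, ?_⟩
    · intro w hw
      exact ⟨by linarith [hw.1], by linarith [hw.2.1], by linarith [hw.2.2.1, h.nonneg w.1],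
        hw.2.2.2.le⟩
    · rw [harcs, disjoint_union_right]
      refine ⟨Set.disjoint_left.2 fun w hw hw' => ?_, Set.disjoint_left.2 fun w hw hw' => ?_⟩
      · have := (h.reg hw').2.2.2
        linarith [hw.2.2.1]
      · have := hw'.2.2
        linarith [hw.2.2.2]
  · exact Or.inl (by rw [harcs]; exact Or.inr hz')

theorem gr_raise_subset_reg (h : Drawing K L N pos arc φ) {α β : ℝ} (hα : 0 ≤ α) (hβ : β ≤ 1) :
    Gr (raise φ α β) α β ⊆ Reg (raise φ α β) := fun z hz =>
  ⟨hα.trans hz.1, hz.2.1.trans hβ, by rw [hz.2.2]; exact (h.nonneg _).trans le_raise, hz.2.2.le⟩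

theorem base (s t : V) (hst : s ≠ t) : ∃ pos arc φ,
    Drawing (SimpleGraph.edge s t) {s, t} {(s, t)} pos arc φ := by
  classical
  have hs : ∀ e ∈ (SimpleGraph.edge s t).edgeSet, e = s(s, t) := by
    intro e he
    rw [SimpleGraph.edgeSet_edge_of_ne hst] at he
    exact he
  have hadj : (SimpleGraph.edge s t).Adj s t := by simp [SimpleGraph.edge_adj, hst]
  have hmem : ∀ a b, (SimpleGraph.edge s t).Adj a b → s(a, b) = s(s, t) := fun a b hab => hs _ hab
  have harcs : arcs (SimpleGraph.edge s t) (fun _ => Gr (fun _ => 0) 0 1) = Gr (fun _ => 0) 0 1 := by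
    ext z
    rw [mem_arcs]
    exact ⟨fun ⟨_, _, hz⟩ => hz, fun hz => ⟨s(s, t), hadj, hz⟩⟩
  have pt : (if t = s then ((0 : ℝ), (0 : ℝ)) else (1, 0)) = (1, 0) := if_neg hst.symm
  obtain ⟨γ, hγ, hγr⟩ := gr_path (φ := fun _ => 0) continuous_const (zero_lt_one (α := ℝ))
    (u := if s = s then ((0 : ℝ), (0 : ℝ)) else (1, 0))
    (v := if t = s then ((0 : ℝ), (0 : ℝ)) else (1, 0)) (by simp) pt
  refine ⟨fun v => if v = s then (0, 0) else (1, 0), fun _ => Gr (fun _ => 0) 0 1, fun _ => 0,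
    continuous_const, fun _ => le_rfl, ?_, ?_, ?_, ?_, ?_, ?_, ?_, ?_, ?_, ?_, ?_, ?_⟩
  · rintro a (rfl | rfl) b (rfl | rfl) hab
    · rfl
    · simp [hst.symm] at hab
    · simp [hst.symm] at hab
    · rfl
  · intro a b hab
    rcases Sym2.eq_iff.1 (hmem a b hab) with h | h
    · exact Or.inl h.1
    · exact Or.inr h.1
  · rintro a (rfl | rfl)
    · exact ⟨t, hadj⟩
    · exact ⟨s, hadj.symm⟩
  · intro u v huv
    rcases Sym2.eq_iff.1 (hmem u v huv) with ⟨rfl, rfl⟩ | ⟨rfl, rfl⟩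
    · exact ⟨γ, hγ, hγr⟩
    · refine ⟨γ.symm, fun a b hab => ?_, ?_⟩
      · exact unitInterval.symm_bijective.injective (hγ hab)
      · rw [Path.symm_range]
        exact hγr
  · intro e he w hw _
    rw [hs e he]
    rcases hw with rfl | rfl <;> simp
  · intro e he e' he' hne
    exact (hne ((hs e he).trans (hs e' he').symm)).elim
  · rw [harcs]
    exact fun z hz => ⟨hz.1, hz.2.1, hz.2.2.ge, hz.2.2.le⟩
  · intro p q hpq
    obtain ⟨rfl, rfl⟩ := Prod.mk.inj hpq
    exact hadj
  · intro p q hpq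
    obtain ⟨rfl, rfl⟩ := Prod.mk.inj hpq
    simp [hst.symm]
  · intro p q hpq
    obtain ⟨rfl, rfl⟩ := Prod.mk.inj hpq
    simp [hst.symm]
  · intro p q hpq p' q' hpq' hne
    exact (hne (Eq.trans hpq (Eq.symm hpq'))).elim
  · intro z hz
    left
    rw [harcs]
    exact ⟨hz.1, hz.2.1, le_antisymm hz.2.2.2 hz.2.2.1⟩

end Drawing

end MacLane

namespace MacLane
variable {V : Type}

theorem mem_edgeSet_sup_edge_iff {K : SimpleGraph V} {c d : V} (hcd : c ≠ d) {e : Sym2 V} :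
    e ∈ (K ⊔ SimpleGraph.edge c d).edgeSet ↔ e ∈ K.edgeSet ∨ e = s(c, d) := by
  rw [SimpleGraph.edgeSet_sup, SimpleGraph.edgeSet_edge_of_ne hcd]
  rfl

theorem exists_path_symm {pos : V → ℝ × ℝ} {A : Set (ℝ × ℝ)} {u v : V}
    (h : ∃ γ : Path (pos u) (pos v), Function.Injective γ ∧ range γ = A) :
    ∃ γ : Path (pos v) (pos u), Function.Injective γ ∧ range γ = A := by
  obtain ⟨γ, h1, h2⟩ := h
  refine ⟨γ.symm, fun a b hab => unitInterval.symm_bijective.injective (h1 hab), ?_⟩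
  rw [Path.symm_range, h2]

namespace Drawing
variable {K : SimpleGraph V} {L : Set V} {N : Set (V × V)} {pos : V → ℝ × ℝ}
  {arc : Sym2 V → Set (ℝ × ℝ)} {φ : ℝ → ℝ}

theorem pos_reg (h : Drawing K L N pos arc φ) {u : V} (hu : u ∈ L) : pos u ∈ Reg φ :=
  h.reg (h.pos_mem_arcs hu)

theorem eq_of_mem_raise {p q : V}
    (hp : pos p = ((pos p).1, φ (pos p).1)) (hq : pos q = ((pos q).1, φ (pos q).1)) {z : ℝ × ℝ}
    (hz : z ∈ Gr (raise φ (pos p).1 (pos q).1) (pos p).1 (pos q).1) (hR : z ∈ Reg φ)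
    (hlt : (pos p).1 < (pos q).1) : z = pos p ∨ z = pos q := by
  rcases eq_of_mem_gr_raise hz hR with h1 | h1
  · left
    rw [hp]
    refine Prod.ext h1 ?_
    rw [hz.2.2, raise_eq (Or.inl h1.le) hlt, h1]
  · right
    rw [hq]
    refine Prod.ext h1 ?_
    rw [hz.2.2, raise_eq (Or.inr h1.ge) hlt, h1]

/-- Top arcs away from the bump are unaffected. -/
theorem gr_raise_eq {p q : V} {φ : ℝ → ℝ} {α β : ℝ} (hαβ : α < β)
    (hd : β ≤ (pos p).1 ∨ (pos q).1 ≤ α) :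
    Gr φ (pos p).1 (pos q).1 = Gr (raise φ α β) (pos p).1 (pos q).1 :=
  gr_congr fun x h1 h2 => by
    rw [raise_eq _ hαβ]
    rcases hd with hd | hd
    · exact Or.inr (hd.trans h1)
    · exact Or.inl (h2.trans hd)

theorem extend_over (h : Drawing K L N pos arc φ) {p v q : V} (hpv : (p, v) ∈ N) (hvq : (v, q) ∈ N)
    (hne : p ≠ q) (hadj : ¬ K.Adj p q) : ∃ arc' φ', Drawing (K ⊔ SimpleGraph.edge p q) L
      (insert (p, q) (N \ {(p, v), (v, q)})) pos arc' φ' := by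
  classical
  set α := (pos p).1 with hα
  set β := (pos q).1 with hβ
  have h1 : α < (pos v).1 := h.topLt p v hpv
  have h2 : (pos v).1 < β := h.topLt v q hvq
  have hαβ : α < β := h1.trans h2
  have hpL := h.mem _ _ (h.topAdj p v hpv)
  have hqL := h.mem _ _ (h.topAdj v q hvq).symm
  have hα0 : 0 ≤ α := (h.pos_reg hpL).1
  have hβ1 : β ≤ 1 := (h.pos_reg hqL).2.1
  have hp := (h.pos_eq hpv).1
  have hq := (h.pos_eq hvq).2
  set K' := K ⊔ SimpleGraph.edge p q with hK'
  have hKK : K ≤ K' := le_sup_left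
  have hpq' : K'.Adj p q := Or.inr (by simp [SimpleGraph.edge_adj, hne])
  have hE : ∀ e, e ∈ K'.edgeSet ↔ e ∈ K.edgeSet ∨ e = s(p, q) := fun e =>
    mem_edgeSet_sup_edge_iff hne
  set arc' := Function.update arc s(p, q) (Gr (raise φ α β) α β) with harc'
  have hnew : arc' s(p, q) = Gr (raise φ α β) α β := by simp [harc']
  have hold : ∀ e ∈ K.edgeSet, arc' e = arc e := by
    intro e he
    refine Function.update_of_ne ?_ _ _
    rintro rfl
    exact hadj he
  have harcs : arcs K' arc' = arcs K arc ∪ Gr (raise φ α β) α β := by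
    ext z
    rw [mem_union, mem_arcs, mem_arcs]
    constructor
    · rintro ⟨e, he, hz⟩
      rcases (hE e).1 he with he | rfl
      · exact Or.inl ⟨e, he, by rwa [← hold e he]⟩
      · exact Or.inr (by rwa [← hnew])
    · rintro (⟨e, he, hz⟩ | hz)
      · exact ⟨e, (hE e).2 (Or.inl he), by rwa [hold e he]⟩
      · exact ⟨s(p, q), hpq', by rwa [hnew]⟩
  have hlow : Gr φ α β = arc s(p, v) ∪ arc s(v, q) := by
    rw [h.topArc p v hpv, h.topArc v q hvq]
    exact gr_split h1.le h2.le
  have hmeet : ∀ z ∈ Gr (raise φ α β) α β, z ∈ Reg φ → z = pos p ∨ z = pos q := fun z hz hR =>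
    eq_of_mem_raise hp hq hz hR hαβ
  have hinter : ∀ e ∈ K.edgeSet, ∀ z ∈ arc e ∩ Gr (raise φ α β) α β,
      ∃ w, w ∈ e ∧ w ∈ s(p, q) ∧ z = pos w := by
    rintro e he z ⟨hz1, hz2⟩
    rcases hmeet z hz2 (h.reg (mem_arcs.2 ⟨e, he, hz1⟩)) with rfl | rfl
    · exact ⟨p, h.avoid e he p hpL hz1, by simp, rfl⟩
    · exact ⟨q, h.avoid e he q hqL hz1, by simp, rfl⟩
  have hcell : IsCell K' pos arc' (Lens φ α β) := by
    have hg := gr_subset_closure_lens h.cont hαβ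
    rw [hlow] at hg
    refine ⟨isOpen_lens h.cont, isPreconnected_lens h.cont, p, v, q, hKK (h.topAdj p v hpv),
      hKK (h.topAdj v q hvq), hpq', hg (Or.inl (h.pos_mem (h.topAdj p v hpv))),
      hg (Or.inr (h.pos_mem (h.topAdj v q hvq))), ?_, ?_⟩
    · refine hg (Or.inr ?_)
      rw [Sym2.eq_swap]
      exact h.pos_mem (h.topAdj v q hvq).symm
    · rw [hnew, hold _ (h.topAdj p v hpv), hold _ (h.topAdj v q hvq), union_assoc (Lens φ α β),
        ← hlow]
      exact closure_lens_subset h.cont hαβ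
  have hside : ∀ p' q', (p', q') ∈ N \ {(p, v), (v, q)} → β ≤ (pos p').1 ∨ (pos q').1 ≤ α := by
    rintro p' q' ⟨hN, hn⟩
    have hn1 : (p', q') ≠ (p, v) := fun he => hn (Or.inl he)
    have hn2 : (p', q') ≠ (v, q) := fun he => hn (Or.inr he)
    have := h.topLt p' q' hN
    rcases h.topDisj p' q' hN p v hpv hn1 with h3 | h3
    · exact Or.inr h3
    · rcases h.topDisj p' q' hN v q hvq hn2 with h4 | h4
      · linarith
      · exact Or.inl h4
  refine ⟨arc', raise φ α β, continuous_raise h.cont, fun x => (h.nonneg x).trans le_raise, h.inj,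
    ?_, ?_, ?_, ?_, ?_, ?_, ?_, ?_, ?_, ?_,
    h.cells_raise hαβ hKK (fun _ _ _ => rfl) hold (fun z hz => ?_) harcs hcell hα0 hβ1⟩
  · intro a b hab
    rcases (hE s(a, b)).1 hab with hab | hab
    · exact h.mem a b hab
    · rcases Sym2.eq_iff.1 hab with ⟨rfl, -⟩ | ⟨rfl, -⟩
      · exact hpL
      · exact hqL
  · exact fun a ha => (h.cov a ha).imp fun b hb => hKK hb
  · intro u w huw
    have hγ : ∃ γ : Path (pos p) (pos q), Function.Injective γ ∧
        range γ = Gr (raise φ α β) α β := by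
      refine gr_path (continuous_raise h.cont) hαβ ?_ ?_
      · rw [raise_eq (Or.inl le_rfl) hαβ]
        exact hp
      · rw [raise_eq (Or.inr le_rfl) hαβ]
        exact hq
    rcases (hE s(u, w)).1 huw with huw | huw
    · rw [hold _ huw]
      exact h.path u w huw
    · rw [huw, hnew]
      rcases Sym2.eq_iff.1 huw with ⟨hu, hw⟩ | ⟨hu, hw⟩
      · rw [hu, hw]
        exact hγ
      · rw [hu, hw]
        exact exists_path_symm hγ
  · intro e he w hw hwe
    rcases (hE e).1 he with he | rfl
    · rw [hold e he] at hwe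
      exact h.avoid e he w hw hwe
    · rw [hnew] at hwe
      rcases hmeet _ hwe (h.pos_reg hw) with h3 | h3
      · rw [h.inj hw hpL h3]
        simp
      · rw [h.inj hw hqL h3]
        simp
  · intro e he e' he' hee z hz
    rcases (hE e).1 he with he | rfl <;> rcases (hE e').1 he' with he' | rfl
    · rw [hold e he, hold e' he'] at hz
      exact h.inter e he e' he' hee z hz
    · rw [hold e he, hnew] at hz
      exact hinter e he z hz
    · rw [hold e' he', hnew] at hz
      obtain ⟨w, h3, h4, h5⟩ := hinter e' he' z hz.symm
      exact ⟨w, h4, h3, h5⟩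
    · exact (hee rfl).elim
  · rw [harcs]
    exact union_subset (h.reg.trans reg_subset_raise) (h.gr_raise_subset_reg hα0 hβ1)
  · rintro p' q' (he | ⟨hN, -⟩)
    · obtain ⟨rfl, rfl⟩ := Prod.mk.inj he
      exact hpq'
    · exact hKK (h.topAdj _ _ hN)
  · rintro p' q' (he | ⟨hN, -⟩)
    · obtain ⟨rfl, rfl⟩ := Prod.mk.inj he
      exact hαβ
    · exact h.topLt _ _ hN
  · rintro p' q' (he | hN)
    · obtain ⟨rfl, rfl⟩ := Prod.mk.inj he
      exact hnew
    · rw [hold _ (h.topAdj _ _ hN.1), h.topArc _ _ hN.1]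
      exact gr_raise_eq hαβ (hside _ _ hN)
  · rintro p' q' (he | hN) p'' q'' (he' | hN') hn
    · exact (hn (he.trans he'.symm)).elim
    · obtain ⟨rfl, rfl⟩ := Prod.mk.inj he
      exact hside _ _ hN'
    · obtain ⟨rfl, rfl⟩ := Prod.mk.inj he'
      exact (hside _ _ hN).symm
    · exact h.topDisj _ _ hN.1 _ _ hN'.1 hn
  · rw [hlow] at hz
    rcases hz with hz | hz
    · exact mem_arcs.2 ⟨_, h.topAdj p v hpv, hz⟩
    · exact mem_arcs.2 ⟨_, h.topAdj v q hvq, hz⟩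

end Drawing

end MacLane

namespace MacLane
variable {V : Type}

namespace Drawing
variable {K : SimpleGraph V} {L : Set V} {N : Set (V × V)} {pos : V → ℝ × ℝ}
  {arc : Sym2 V → Set (ℝ × ℝ)} {φ : ℝ → ℝ}

theorem not_mem_edge (h : Drawing K L N pos arc φ) {x : V} (hx : x ∉ L) {e : Sym2 V}
    (he : e ∈ K.edgeSet) : x ∉ e := by
  induction e with
  | _ a b =>
    intro hxe
    rcases Sym2.mem_iff.1 hxe with rfl | rfl
    · exact hx (h.mem _ _ he)
    · exact hx (h.mem _ _ (SimpleGraph.Adj.symm he))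

theorem extend_up (h : Drawing K L N pos arc φ) {p q x : V} (hpq : (p, q) ∈ N) (hx : x ∉ L) :
    ∃ pos' arc' φ', Drawing (K ⊔ SimpleGraph.edge p x ⊔ SimpleGraph.edge x q) (insert x L)
      (insert (p, x) (insert (x, q) (N \ {(p, q)}))) pos' arc' φ' := by
  classical
  set α := (pos p).1 with hα
  set β := (pos q).1 with hβ
  have hαβ : α < β := h.topLt p q hpq
  set μ := (α + β) / 2 with hμ
  have hαμ : α < μ := by linarith
  have hμβ : μ < β := by linarith
  have hadj := h.topAdj p q hpq
  have hpL := h.mem _ _ hadj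
  have hqL := h.mem _ _ hadj.symm
  have hxp : p ≠ x := fun he => hx (he ▸ hpL)
  have hxq : x ≠ q := fun he => hx (he ▸ hqL)
  have hα0 : 0 ≤ α := (h.pos_reg hpL).1
  have hβ1 : β ≤ 1 := (h.pos_reg hqL).2.1
  obtain ⟨hp, hq⟩ := h.pos_eq hpq
  set ψ := raise φ α β with hψ
  have hψc : Continuous ψ := continuous_raise h.cont
  set K' := K ⊔ SimpleGraph.edge p x ⊔ SimpleGraph.edge x q with hK'
  have hKK : K ≤ K' := le_sup_left.trans le_sup_left
  have hE : ∀ e, e ∈ K'.edgeSet ↔ e ∈ K.edgeSet ∨ e = s(p, x) ∨ e = s(x, q) := fun e => by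
    rw [hK', mem_edgeSet_sup_edge_iff hxq, mem_edgeSet_sup_edge_iff hxp, or_assoc]
  have hpx' : K'.Adj p x := (hE s(p, x)).2 (Or.inr (Or.inl rfl))
  have hxq' : K'.Adj x q := (hE s(x, q)).2 (Or.inr (Or.inr rfl))
  have hne : s(p, x) ≠ s(x, q) := by
    rw [Ne, Sym2.eq_iff]
    rintro (⟨h1, -⟩ | ⟨h1, -⟩)
    · exact hxp h1
    · exact hadj.ne h1
  set arc' := Function.update (Function.update arc s(p, x) (Gr ψ α μ)) s(x, q) (Gr ψ μ β) with harc'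
  have hnew1 : arc' s(p, x) = Gr ψ α μ := by simp [harc', Function.update_of_ne hne]
  have hnew2 : arc' s(x, q) = Gr ψ μ β := by simp [harc']
  have hold : ∀ e ∈ K.edgeSet, arc' e = arc e := by
    intro e he
    have := h.not_mem_edge hx he
    rw [harc', Function.update_of_ne, Function.update_of_ne]
    · rintro rfl
      simp at this
    · rintro rfl
      simp at this
  set pos' := Function.update pos x (μ, ψ μ) with hpos'
  have hposx : pos' x = (μ, ψ μ) := by simp [hpos']
  have hposL : ∀ w ∈ L, pos' w = pos w := fun w hw =>
    Function.update_of_ne (ne_of_mem_of_not_mem hw hx) _ _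
  have hposp := hposL p hpL
  have hposq := hposL q hqL
  have hsplit : Gr ψ α β = Gr ψ α μ ∪ Gr ψ μ β := gr_split hαμ.le hμβ.le
  have harcs : arcs K' arc' = arcs K arc ∪ Gr ψ α β := by
    ext z
    rw [mem_union, mem_arcs, mem_arcs, hsplit]
    constructor
    · rintro ⟨e, he, hz⟩
      rcases (hE e).1 he with he | rfl | rfl
      · exact Or.inl ⟨e, he, by rwa [← hold e he]⟩
      · exact Or.inr (Or.inl (by rwa [← hnew1]))
      · exact Or.inr (Or.inr (by rwa [← hnew2]))
    · rintro (⟨e, he, hz⟩ | hz | hz)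
      · exact ⟨e, (hE e).2 (Or.inl he), by rwa [hold e he]⟩
      · exact ⟨s(p, x), hpx', by rwa [hnew1]⟩
      · exact ⟨s(x, q), hxq', by rwa [hnew2]⟩
  have hlow : Gr φ α β = arc s(p, q) := (h.topArc p q hpq).symm
  have hmeet : ∀ z ∈ Gr ψ α β, z ∈ Reg φ → z = pos p ∨ z = pos q := fun z hz hR =>
    eq_of_mem_raise hp hq hz hR hαβ
  have hmeet1 : ∀ z ∈ Gr ψ α μ, z ∈ Reg φ → z = pos p := by
    intro z hz hR
    refine (hmeet z (hsplit ▸ Or.inl hz) hR).resolve_right fun he => ?_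
    have : z.1 ≤ μ := hz.2.1
    rw [he] at this
    linarith
  have hmeet2 : ∀ z ∈ Gr ψ μ β, z ∈ Reg φ → z = pos q := by
    intro z hz hR
    refine (hmeet z (hsplit ▸ Or.inr hz) hR).resolve_left fun he => ?_
    have : μ ≤ z.1 := hz.1
    rw [he] at this
    linarith
  have hxR : (μ, ψ μ) ∉ Reg φ := fun hR => by
    have h1 : ψ μ ≤ φ μ := hR.2.2.2
    have h2 : φ μ < ψ μ := lt_raise hαμ hμβ
    linarith
  have hinter1 : ∀ e ∈ K.edgeSet, ∀ z ∈ arc e ∩ Gr ψ α μ,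
      ∃ w, w ∈ e ∧ w ∈ s(p, x) ∧ z = pos' w := by
    rintro e he z ⟨hz1, hz2⟩
    obtain rfl := hmeet1 z hz2 (h.reg (mem_arcs.2 ⟨e, he, hz1⟩))
    exact ⟨p, h.avoid e he p hpL hz1, by simp, hposp.symm⟩
  have hinter2 : ∀ e ∈ K.edgeSet, ∀ z ∈ arc e ∩ Gr ψ μ β,
      ∃ w, w ∈ e ∧ w ∈ s(x, q) ∧ z = pos' w := by
    rintro e he z ⟨hz1, hz2⟩
    obtain rfl := hmeet2 z hz2 (h.reg (mem_arcs.2 ⟨e, he, hz1⟩))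
    exact ⟨q, h.avoid e he q hqL hz1, by simp, hposq.symm⟩
  have hinter3 : ∀ z ∈ Gr ψ α μ ∩ Gr ψ μ β, z = pos' x := by
    rintro z ⟨hz1, hz2⟩
    have h1 : z.1 = μ := le_antisymm hz1.2.1 hz2.1
    rw [hposx]
    exact Prod.ext h1 (by rw [hz1.2.2, h1])
  have hcell : IsCell K' pos' arc' (Lens φ α β) := by
    have hg := gr_subset_closure_lens h.cont hαβ
    rw [hlow] at hg
    have hqm : pos q ∈ arc s(p, q) := by
      rw [Sym2.eq_swap]
      exact h.pos_mem hadj.symm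
    refine ⟨isOpen_lens h.cont, isPreconnected_lens h.cont, p, x, q, hpx', hxq', hKK hadj, ?_, ?_,
      ?_, ?_⟩
    · rw [hposp]
      exact hg (h.pos_mem hadj)
    · rw [hposx]
      exact gr_raise_subset_closure_lens h.cont hαβ ⟨hαμ.le, hμβ.le, rfl⟩
    · rw [hposq]
      exact hg hqm
    · rw [hnew1, hnew2, hold _ hadj, union_assoc (Lens φ α β), ← hsplit, ← hlow, union_right_comm]
      exact closure_lens_subset h.cont hαβ
  have hside : ∀ p' q', (p', q') ∈ N \ {(p, q)} → β ≤ (pos p').1 ∨ (pos q').1 ≤ α := by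
    rintro p' q' ⟨hN, hn⟩
    exact (h.topDisj p' q' hN p q hpq hn).symm
  have hNL : ∀ p' q', (p', q') ∈ N → pos' p' = pos p' ∧ pos' q' = pos q' := fun p' q' hN =>
    ⟨hposL _ (h.mem _ _ (h.topAdj _ _ hN)), hposL _ (h.mem _ _ (h.topAdj _ _ hN).symm)⟩
  refine ⟨pos', arc', ψ, hψc, fun x => (h.nonneg x).trans le_raise, ?_,
    ?_, ?_, ?_, ?_, ?_, ?_, ?_, ?_, ?_, ?_,
    h.cells_raise hαβ hKK (fun a b hab => hposL a (h.mem a b hab)) hold (fun z hz => ?_) harcs hcell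
      hα0 hβ1⟩
  · rintro a (rfl | ha) b (rfl | hb) hab
    · rfl
    · rw [hposx, hposL b hb] at hab
      exact (hxR (hab ▸ h.pos_reg hb)).elim
    · rw [hposx, hposL a ha] at hab
      exact (hxR (hab ▸ h.pos_reg ha)).elim
    · rw [hposL a ha, hposL b hb] at hab
      exact h.inj ha hb hab
  · intro a b hab
    rcases (hE s(a, b)).1 hab with hab | hab | hab
    · exact Or.inr (h.mem a b hab)
    · rcases Sym2.eq_iff.1 hab with ⟨rfl, -⟩ | ⟨rfl, -⟩
      · exact Or.inr hpL
      · exact Or.inl rfl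
    · rcases Sym2.eq_iff.1 hab with ⟨rfl, -⟩ | ⟨rfl, -⟩
      · exact Or.inl rfl
      · exact Or.inr hqL
  · rintro a (rfl | ha)
    · exact ⟨q, hxq'⟩
    · exact (h.cov a ha).imp fun b hb => hKK hb
  · intro u w huw
    have hp' : pos' p = (α, ψ α) := by
      rw [hposp, hψ, raise_eq (Or.inl le_rfl) hαβ]
      exact hp
    have hq' : pos' q = (β, ψ β) := by
      rw [hposq, hψ, raise_eq (Or.inr le_rfl) hαβ]
      exact hq
    have hγ1 := gr_path hψc hαμ hp' hposx
    have hγ2 := gr_path hψc hμβ hposx hq'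
    rcases (hE s(u, w)).1 huw with huw | huw | huw
    · rw [hold _ huw, hposL u (h.mem _ _ huw), hposL w (h.mem _ _ (SimpleGraph.Adj.symm huw))]
      exact h.path u w huw
    · rw [huw, hnew1]
      rcases Sym2.eq_iff.1 huw with ⟨hu, hw⟩ | ⟨hu, hw⟩
      · rw [hu, hw]
        exact hγ1
      · rw [hu, hw]
        exact exists_path_symm hγ1
    · rw [huw, hnew2]
      rcases Sym2.eq_iff.1 huw with ⟨hu, hw⟩ | ⟨hu, hw⟩
      · rw [hu, hw]
        exact hγ2
      · rw [hu, hw]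
        exact exists_path_symm hγ2
  · rintro e he w hw hwe
    rcases (hE e).1 he with heK | rfl | rfl
    · rw [hold e heK] at hwe
      rcases hw with rfl | hw
      · rw [hposx] at hwe
        exact (hxR (h.reg (mem_arcs.2 ⟨e, heK, hwe⟩))).elim
      · rw [hposL w hw] at hwe
        exact h.avoid e heK w hw hwe
    · rcases hw with rfl | hw
      · simp
      · rw [hnew1, hposL w hw] at hwe
        rw [h.inj hw hpL (hmeet1 _ hwe (h.pos_reg hw))]
        simp
    · rcases hw with rfl | hw
      · simp
      · rw [hnew2, hposL w hw] at hwe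
        rw [h.inj hw hqL (hmeet2 _ hwe (h.pos_reg hw))]
        simp
  · intro e he e' he' hee z hz
    rcases (hE e).1 he with heK | rfl | rfl <;> rcases (hE e').1 he' with heK' | rfl | rfl
    · rw [hold e heK, hold e' heK'] at hz
      obtain ⟨w, h1, h2, h3⟩ := h.inter e heK e' heK' hee z hz
      refine ⟨w, h1, h2, ?_⟩
      rw [hpos', Function.update_of_ne]
      · exact h3
      · rintro rfl
        exact h.not_mem_edge hx heK h1
    · rw [hold e heK, hnew1] at hz
      exact hinter1 e heK z hz
    · rw [hold e heK, hnew2] at hz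
      exact hinter2 e heK z hz
    · rw [hold e' heK', hnew1] at hz
      obtain ⟨w, h3, h4, h5⟩ := hinter1 e' heK' z hz.symm
      exact ⟨w, h4, h3, h5⟩
    · exact (hee rfl).elim
    · rw [hnew1, hnew2] at hz
      exact ⟨x, by simp, by simp, hinter3 z hz⟩
    · rw [hold e' heK', hnew2] at hz
      obtain ⟨w, h3, h4, h5⟩ := hinter2 e' heK' z hz.symm
      exact ⟨w, h4, h3, h5⟩
    · rw [hnew1, hnew2] at hz
      exact ⟨x, by simp, by simp, hinter3 z hz.symm⟩
    · exact (hee rfl).elim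
  · rw [harcs]
    exact union_subset (h.reg.trans reg_subset_raise) (h.gr_raise_subset_reg hα0 hβ1)
  · rintro p' q' (he | he | ⟨hN, -⟩)
    · obtain ⟨rfl, rfl⟩ := Prod.mk.inj he
      exact hpx'
    · obtain ⟨rfl, rfl⟩ := Prod.mk.inj he
      exact hxq'
    · exact hKK (h.topAdj _ _ hN)
  · rintro p' q' (he | he | ⟨hN, -⟩)
    · obtain ⟨rfl, rfl⟩ := Prod.mk.inj he
      rw [hposp, hposx]
      exact hαμ
    · obtain ⟨rfl, rfl⟩ := Prod.mk.inj he
      rw [hposq, hposx]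
      exact hμβ
    · rw [(hNL _ _ hN).1, (hNL _ _ hN).2]
      exact h.topLt _ _ hN
  · rintro p' q' (he | he | hN)
    · obtain ⟨rfl, rfl⟩ := Prod.mk.inj he
      rw [hposp, hposx]
      exact hnew1
    · obtain ⟨rfl, rfl⟩ := Prod.mk.inj he
      rw [hposq, hposx]
      exact hnew2
    · rw [(hNL _ _ hN.1).1, (hNL _ _ hN.1).2, hold _ (h.topAdj _ _ hN.1), h.topArc _ _ hN.1]
      exact gr_raise_eq hαβ (hside _ _ hN)
  · have hx1 : (pos' x).1 = μ := by rw [hposx]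
    have key : ∀ p' q', (p', q') ∈ N \ {(p, q)} → β ≤ (pos' p').1 ∨ (pos' q').1 ≤ α := by
      intro p' q' hN
      rw [(hNL _ _ hN.1).1, (hNL _ _ hN.1).2]
      exact hside _ _ hN
    rintro p' q' (he | he | hN) p'' q'' (he' | he' | hN') hn
    · exact (hn (he.trans he'.symm)).elim
    · obtain ⟨rfl, rfl⟩ := Prod.mk.inj he
      obtain ⟨rfl, rfl⟩ := Prod.mk.inj he'
      exact Or.inl le_rfl
    · obtain ⟨rfl, rfl⟩ := Prod.mk.inj he
      rw [hx1, hposp]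
      rcases key _ _ hN' with h1 | h1
      · exact Or.inl (hμβ.le.trans h1)
      · exact Or.inr h1
    · obtain ⟨rfl, rfl⟩ := Prod.mk.inj he
      obtain ⟨rfl, rfl⟩ := Prod.mk.inj he'
      exact Or.inr le_rfl
    · exact (hn (he.trans he'.symm)).elim
    · obtain ⟨rfl, rfl⟩ := Prod.mk.inj he
      rw [hx1, hposq]
      rcases key _ _ hN' with h1 | h1
      · exact Or.inl h1
      · exact Or.inr (h1.trans hαμ.le)
    · obtain ⟨rfl, rfl⟩ := Prod.mk.inj he'
      rw [hx1, hposp]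
      rcases key _ _ hN with h1 | h1
      · exact Or.inr (hμβ.le.trans h1)
      · exact Or.inl h1
    · obtain ⟨rfl, rfl⟩ := Prod.mk.inj he'
      rw [hx1, hposq]
      rcases key _ _ hN with h1 | h1
      · exact Or.inr h1
      · exact Or.inl (h1.trans hαμ.le)
    · rw [(hNL _ _ hN.1).1, (hNL _ _ hN.1).2, (hNL _ _ hN'.1).1, (hNL _ _ hN'.1).2]
      exact h.topDisj _ _ hN.1 _ _ hN'.1 hn
  · rw [hlow] at hz
    exact mem_arcs.2 ⟨_, hadj, hz⟩

end Drawing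

theorem Sweep.exists_drawing {K : SimpleGraph V} {L : Set V} {N : Set (V × V)} (h : Sweep K L N) :
    ∃ pos arc φ, Drawing K L N pos arc φ := by
  induction h with
  | base s t hst => exact Drawing.base s t hst
  | up K L N p q x h hpq hx ih =>
    obtain ⟨pos, arc, φ, hd⟩ := ih
    exact hd.extend_up hpq hx
  | close K L N p v q h hpv hvq hne hadj ih =>
    obtain ⟨pos, arc, φ, hd⟩ := ih
    exact ⟨pos, hd.extend_over hpv hvq hne hadj⟩

end MacLane

namespace MacLane
variable {V : Type} {H : SimpleGraph V} {N : Set (V × V)} {pos : V → ℝ × ℝ}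
  {arc : Sym2 V → Set (ℝ × ℝ)} {φ : ℝ → ℝ}

/-- The plane embedding given by a drawing with full vertex set. -/
def Drawing.embedding (h : Drawing H univ N pos arc φ) : PlaneEmbedding H where
  pos := pos
  pos_inj := injOn_univ.1 h.inj
  arc e := arc e
  arc_path := by
    rintro ⟨e, he⟩
    induction e with
    | _ a b => exact ⟨a, b, rfl, h.path a b he⟩
  arc_avoid e w hw := h.avoid e e.2 w (mem_univ w) hw
  arc_inter e e' hne z hz :=
    h.inter e e.2 e' e'.2 (fun he => hne (Subtype.ext he)) z hz

theorem Drawing.image_embedding (h : Drawing H univ N pos arc φ) :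
    h.embedding.image = arcs H arc := by
  ext z
  rw [PlaneEmbedding.image, mem_arcs]
  constructor
  · rintro (⟨v, rfl⟩ | hz)
    · exact mem_arcs.1 (h.pos_mem_arcs (mem_univ v))
    · obtain ⟨e, he⟩ := mem_iUnion.1 hz
      exact ⟨e, e.2, he⟩
  · rintro ⟨e, he, hz⟩
    exact Or.inr (mem_iUnion.2 ⟨⟨e, he⟩, hz⟩)

/-- The component of a point in the complement of a set disjoint from a ray is unbounded. -/
theorem not_isBounded_of_ray {A : Set (ℝ × ℝ)} {x d : ℝ × ℝ} (hd : d ≠ 0)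
    (hA : ∀ t : ℝ, 0 ≤ t → x + t • d ∉ A) : ¬ IsBounded (connectedComponentIn Aᶜ x) := by
  intro hb
  have hsub : (fun t : ℝ => x + t • d) '' Ici 0 ⊆ connectedComponentIn Aᶜ x := by
    refine IsPreconnected.subset_connectedComponentIn ?_ ⟨0, self_mem_Ici, by simp⟩ ?_
    · exact isPreconnected_Ici.image _ (by fun_prop)
    · rintro _ ⟨t, ht, rfl⟩
      exact hA t ht
  obtain ⟨R, hR⟩ := (hb.subset hsub).exists_norm_le
  have hd' : 0 < ‖d‖ := norm_pos_iff.2 hd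
  have hpos : 0 ≤ (|R| + ‖x‖ + 1) / ‖d‖ := by positivity
  have h1 := hR _ ⟨_, hpos, rfl⟩
  have h2 : ‖((|R| + ‖x‖ + 1) / ‖d‖) • d‖ = |R| + ‖x‖ + 1 := by
    rw [norm_smul, Real.norm_of_nonneg hpos, div_mul_cancel₀ _ hd'.ne']
  have h3 := norm_sub_norm_le (((|R| + ‖x‖ + 1) / ‖d‖) • d) (-x)
  rw [norm_neg, sub_neg_eq_add, add_comm _ x, h2] at h3
  have := le_abs_self R
  dsimp only at h1
  linarith

theorem Drawing.mem_reg_of_isBounded (h : Drawing H univ N pos arc φ) {x : ℝ × ℝ}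
    (hb : IsBounded (connectedComponentIn (arcs H arc)ᶜ x)) : x ∈ Reg φ := by
  by_contra hx
  have key : ∀ d : ℝ × ℝ, d ≠ 0 → (∀ t : ℝ, 0 ≤ t → x + t • d ∉ Reg φ) → False :=
    fun d hd hA => not_isBounded_of_ray hd (fun t ht hz => hA t ht (h.reg hz)) hb
  by_cases h1 : 0 ≤ x.1
  · by_cases h2 : x.1 ≤ 1
    · by_cases h3 : 0 ≤ x.2
      · refine key (0, 1) (by simp) fun t ht hz => hx ⟨h1, h2, h3, ?_⟩
        have h4 := hz.2.2.2
        simp only [Prod.fst_add, Prod.snd_add, Prod.smul_mk, smul_eq_mul, mul_one, mul_zero,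
          add_zero] at h4
        linarith
      · refine key (0, -1) (by simp) fun t ht hz => h3 ?_
        have h4 := hz.2.2.1
        simp only [Prod.snd_add, Prod.smul_mk, smul_eq_mul] at h4
        linarith
    · refine key (1, 0) (by simp) fun t ht hz => h2 ?_
      have h4 := hz.2.1
      simp only [Prod.fst_add, Prod.smul_mk, smul_eq_mul] at h4
      linarith
  · refine key (-1, 0) (by simp) fun t ht hz => h1 ?_
    have h4 := hz.1
    simp only [Prod.fst_add, Prod.smul_mk, smul_eq_mul] at h4
    linarith

theorem Drawing.boundaryVerts_eq (h : Drawing H univ N pos arc φ) {f : Set (ℝ × ℝ)}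
    (hf : h.embedding.IsBoundedFace f) : ∃ a b c, H.Adj a b ∧ H.Adj b c ∧ H.Adj a c ∧
      h.embedding.boundaryVerts f = {a, b, c} := by
  obtain ⟨⟨x, hx, rfl⟩, hb⟩ := hf
  rw [h.image_embedding] at hx hb ⊢
  obtain ⟨C, ⟨hCo, hCp, a, b, c, hab, hbc, hac, ha, hb', hc, hcl⟩, hxC, -, hd⟩ :=
    (h.cells x (h.mem_reg_of_isBounded hb)).resolve_left hx
  have hcl' : closure C ⊆ C ∪ arcs H arc := by
    intro z hz
    rcases hcl hz with ((hz | hz) | hz) | hz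
    · exact Or.inl hz
    · exact Or.inr (mem_arcs.2 ⟨_, hab, hz⟩)
    · exact Or.inr (mem_arcs.2 ⟨_, hbc, hz⟩)
    · exact Or.inr (mem_arcs.2 ⟨_, hac, hz⟩)
  have heq : connectedComponentIn (arcs H arc)ᶜ x = C := by
    refine Subset.antisymm ?_ (hCp.subset_connectedComponentIn hxC hd.subset_compl_right)
    refine isPreconnected_connectedComponentIn.subset_of_closure_inter_subset hCo
      ⟨x, mem_connectedComponentIn hx, hxC⟩ ?_
    rintro z ⟨hz, hz'⟩
    exact (hcl' hz).resolve_right (connectedComponentIn_subset _ _ hz')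
  rw [heq]
  refine ⟨a, b, c, hab, hbc, hac, Subset.antisymm (fun v hv => ?_) ?_⟩
  · have hv' : pos v ∈ closure C := hv
    have hvu := mem_univ v
    have hvC : pos v ∉ C := fun hC => Set.disjoint_left.1 hd hC (h.pos_mem_arcs hvu)
    rcases hcl hv' with ((hz | hz) | hz) | hz
    · exact (hvC hz).elim
    · have := h.avoid _ hab v hvu hz
      simp only [Sym2.mem_iff] at this
      rcases this with rfl | rfl <;> simp
    · have := h.avoid _ hbc v hvu hz
      simp only [Sym2.mem_iff] at this
      rcases this with rfl | rfl <;> simp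
    · have := h.avoid _ hac v hvu hz
      simp only [Sym2.mem_iff] at this
      rcases this with rfl | rfl <;> simp
  · rintro v (rfl | rfl | rfl)
    · exact ha
    · exact hb'
    · exact hc

end MacLane

namespace MacLane

theorem treewidth_le_card {V : Type} [Fintype V] {G : SimpleGraph V} {k : ℕ}
    (hk : Fintype.card V ≤ k + 1) : treewidth G ≤ k := by
  refine Nat.sInf_le ⟨⟨Unit, ⊥, SimpleGraph.IsTree.of_subsingleton, fun _ => univ⟩, ?_, fun _ => ?_⟩
  · refine ⟨fun _ => ⟨(), mem_univ _⟩, fun _ _ _ => ⟨(), mem_univ _, mem_univ _⟩, fun v => ?_⟩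
    have : Nonempty {i : Unit | v ∈ (univ : Set V)} := ⟨⟨(), mem_univ v⟩⟩
    exact SimpleGraph.IsTree.of_subsingleton.connected
  · rwa [ncard_univ, Nat.card_eq_fintype_card]

theorem exists_treeDecomp {V : Type} {G : SimpleGraph V} (h : treewidth G ≠ 0) :
    ∃ D : Decomp V, IsTreeDecomp G D ∧ ∀ i, (D.bag i).ncard ≤ treewidth G + 1 :=
  Nat.sInf_mem (s := {k | ∃ D : Decomp V, IsTreeDecomp G D ∧ ∀ i, (D.bag i).ncard ≤ k + 1})
    (Nat.nonempty_of_pos_sInf (Nat.pos_of_ne_zero h))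

end MacLane

open MacLane

/-- If a planar graph `G` has treewidth at least 3, then there is a
plane supergraph `H` of `G` on the same vertex set, together with a plane embedding,
in which every bounded face is a triangle, whose em-width equals the treewidth of `G`. -/
theorem planar_triangulation_emwidth_eq_treewidth {V : Type} [Fintype V]
    (G : SimpleGraph V) (hplanar : Nonempty (PlaneEmbedding G))
    (htw : 3 ≤ treewidth G) :
    ∃ H : SimpleGraph V, G ≤ H ∧ ∃ P : PlaneEmbedding H,
      (∀ f, P.IsBoundedFace f → (P.boundaryVerts f).ncard = 3) ∧
      emwidth P = treewidth G := by
  classical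
  obtain ⟨P₀⟩ := hplanar
  obtain ⟨D, hD, hbag⟩ := exists_treeDecomp (G := G) (by omega)
  have hgood : Good (treewidth G + 1) G :=
    ⟨isMacLane_of_planeEmbedding P₀, D, hD.pDec, hD.1, hbag⟩
  obtain ⟨H, hGH, hH⟩ := Finite.exists_le_maximal hgood
  have hcard : 3 ≤ Fintype.card V := by
    by_contra hlt
    have := treewidth_le_card (G := G) (k := 2) (by omega)
    omega
  obtain ⟨N, hN⟩ := exists_sweep (by omega) hH hcard
  obtain ⟨pos, arc, φ, hd⟩ := hN.exists_drawing
  obtain ⟨-, D', hD', hcov, hbag'⟩ := hH.prop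
  have hem : ∃ D : Decomp V, IsEmDecomp hd.embedding D ∧
      ∀ i, (D.bag i).ncard ≤ treewidth G + 1 := by
    refine ⟨D', ⟨hD'.isTreeDecomp hcov, fun f hf => ?_⟩, hbag'⟩
    obtain ⟨a, b, c, hab, hbc, hac, hf⟩ := hd.boundaryVerts_eq hf
    obtain ⟨i, ha, hb, hc⟩ := hD'.triangle hab hac hbc
    refine ⟨i, hf ▸ ?_⟩
    rintro v (rfl | rfl | rfl) <;> assumption
  refine ⟨H, hGH, hd.embedding, fun f hf => ?_, le_antisymm (Nat.sInf_le hem) ?_⟩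
  · obtain ⟨a, b, c, hab, hbc, hac, hf⟩ := hd.boundaryVerts_eq hf
    rw [hf, ncard_eq_three]
    exact ⟨a, b, c, hab.ne, hac.ne, hbc.ne, rfl⟩
  · obtain ⟨D₁, h₁, hb₁⟩ : emwidth hd.embedding ∈ {k | ∃ D : Decomp V,
        IsEmDecomp hd.embedding D ∧ ∀ i, (D.bag i).ncard ≤ k + 1} := Nat.sInf_mem ⟨_, hem⟩
    exact Nat.sInf_le ⟨D₁, (h₁.1.pDec.mono hGH).isTreeDecomp h₁.1.1, hb₁⟩
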